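/- arXiv:2306.07128 — 12 statements merged into one kernel-verified Lean document; each statement's English description precedes it below -/
import Mathlib

section
/- Let γ₁ = e^{246} + e^{257} − e^{347} + e^{356} and γ₂ = e^{247} − e^{256} + e^{346} + e^{357}, and for real numbers a₁,…,a₅ let φ = a₁e^{123} + a₂e^{145} + a₃e^{167} + a₄γ₁ + a₅γ₂. Then for all v, w ∈ ℝ⁷, b_φ(v,w) = [ a₁a₂a₃·v₁w₁ − (a₄²+a₅²)·( a₁(v₂w₂+v₃w₃) − a₂(v₄w₄+v₅w₅) + a₃(v₆w₆+v₇w₇) ) ]·e^{1234567}, where vᵢ denotes the i-th coordinate of v. (This is the computation of b_φ for the generic invariant 3-form on a generic Aloff–Wallach space.) -/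
open scoped BigOperators

namespace Stmt1

/-- Vectors in ℝ⁷. -/
abbrev V : Type := Fin 7 → ℝ

/-- The basis wedge `e^{idx 0} ∧ ⋯ ∧ e^{idx (k-1)}` (determinant convention). -/
def eW {k : ℕ} (idx : Fin k → Fin 7) : (Fin k → V) → ℝ :=
  fun x => Matrix.det (Matrix.of fun a b => x a (idx b))

/-- The wedge product of a `k`-form and an `l`-form. -/
noncomputable def wedge {k l : ℕ} (α : (Fin k → V) → ℝ) (β : (Fin l → V) → ℝ) :
    (Fin (k + l) → V) → ℝ :=
  fun x => ((Nat.factorial k * Nat.factorial l : ℕ) : ℝ)⁻¹ *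
    ∑ σ : Equiv.Perm (Fin (k + l)),
      ((Equiv.Perm.sign σ : ℤ) : ℝ) *
        (α fun i => x (σ (Fin.castAdd l i))) * (β fun j => x (σ (Fin.natAdd k j)))

/-- Interior product: insert the vector `v` into the first argument. -/
def iota {k : ℕ} (v : V) (α : (Fin (k + 1) → V) → ℝ) : (Fin k → V) → ℝ :=
  fun x => α (Fin.cons v x)

/-- `b_φ(v,w) = (1/6) (ι_v φ) ∧ (ι_w φ) ∧ φ`, a `7`-form. -/
noncomputable def bForm (φ : (Fin 3 → V) → ℝ) (v w : V) : (Fin 7 → V) → ℝ :=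
  fun x => (6 : ℝ)⁻¹ * wedge (wedge (iota v φ) (iota w φ)) φ x

/-- `γ₁ = e^{246} + e^{257} − e^{347} + e^{356}` (0-indexed). -/
def gamma1 : (Fin 3 → V) → ℝ :=
  fun x => eW ![1, 3, 5] x + eW ![1, 4, 6] x - eW ![2, 3, 6] x + eW ![2, 4, 5] x

/-- `γ₂ = e^{247} − e^{256} + e^{346} + e^{357}` (0-indexed). -/
def gamma2 : (Fin 3 → V) → ℝ :=
  fun x => eW ![1, 3, 6] x - eW ![1, 4, 5] x + eW ![2, 3, 5] x + eW ![2, 4, 6] x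

/-- `φ = a₁e^{123} + a₂e^{145} + a₃e^{167} + a₄γ₁ + a₅γ₂`. -/
def phi (a₁ a₂ a₃ a₄ a₅ : ℝ) : (Fin 3 → V) → ℝ :=
  fun x => a₁ * eW ![0, 1, 2] x + a₂ * eW ![0, 3, 4] x + a₃ * eW ![0, 5, 6] x
    + a₄ * gamma1 x + a₅ * gamma2 x

theorem wedge_add_right {k l : ℕ} (α : (Fin k → V) → ℝ) (β β' : (Fin l → V) → ℝ) :
    wedge α (β + β') = wedge α β + wedge α β' := by
  funext x
  simp [wedge, mul_add, Finset.sum_add_distrib]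

theorem wedge_smul_right {k l : ℕ} (α : (Fin k → V) → ℝ) (c : ℝ) (β : (Fin l → V) → ℝ) :
    wedge α (c • β) = c • wedge α β := by
  funext x
  simp only [wedge, Pi.smul_apply, smul_eq_mul, Finset.mul_sum]
  exact Finset.sum_congr rfl fun _ _ => by ring

theorem wedge_sub_right {k l : ℕ} (α : (Fin k → V) → ℝ) (β β' : (Fin l → V) → ℝ) :
    wedge α (β - β') = wedge α β - wedge α β' := by
  funext x
  simp [wedge, mul_sub, Finset.sum_sub_distrib]

/-- `eW` as an alternating map. -/
noncomputable def eWAlt {k : ℕ} (idx : Fin k → Fin 7) : V [⋀^Fin k]→ₗ[ℝ] ℝ :=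
  Matrix.detRowAlternating.compLinearMap (LinearMap.funLeft ℝ ℝ idx)

theorem coe_eWAlt {k : ℕ} (idx : Fin k → Fin 7) : ⇑(eWAlt idx) = eW idx := rfl

/-- The wedge product of two alternating maps, as an alternating map. -/
noncomputable def wedgeAlt {k l : ℕ} (α : V [⋀^Fin k]→ₗ[ℝ] ℝ) (β : V [⋀^Fin l]→ₗ[ℝ] ℝ) :
    V [⋀^Fin (k + l)]→ₗ[ℝ] ℝ :=
  ((Nat.factorial k * Nat.factorial l : ℕ) : ℝ)⁻¹ •
    MultilinearMap.alternatization
      (((LinearMap.mul' ℝ ℝ).compMultilinearMap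
        (MultilinearMap.domCoprod (α : MultilinearMap ℝ (fun _ : Fin k => V) ℝ)
          (β : MultilinearMap ℝ (fun _ : Fin l => V) ℝ))).domDomCongr finSumFinEquiv)

theorem coe_wedgeAlt {k l : ℕ} (α : V [⋀^Fin k]→ₗ[ℝ] ℝ) (β : V [⋀^Fin l]→ₗ[ℝ] ℝ) :
    ⇑(wedgeAlt α β) = wedge α β := by
  funext x
  simp [wedgeAlt, wedge, MultilinearMap.alternatization_apply, Units.smul_def, mul_assoc]

/-- If the `J`-coordinates of the first `k` vectors vanish and those of the last `l` vectors form
the identity matrix, then `α ∧ e^J` takes the same value on these vectors as `α` on the first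
`k` of them. -/
theorem wedge_eW_apply {k l : ℕ} (α : V [⋀^Fin k]→ₗ[ℝ] ℝ) (J : Fin l → Fin 7)
    (x : Fin (k + l) → V) (h₀ : ∀ i j, x (Fin.castAdd l i) (J j) = 0)
    (h₁ : ∀ i j, x (Fin.natAdd k i) (J j) = (1 : Matrix (Fin l) (Fin l) ℝ) i j) :
    wedge α (eW J) x = α fun i => x (Fin.castAdd l i) := by
  classical
  set f : Equiv.Perm (Fin (k + l)) → ℝ := fun σ =>
    ((Equiv.Perm.sign σ : ℤ) : ℝ) * (α fun i => x (σ (Fin.castAdd l i))) *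
      (eW J fun j => x (σ (Fin.natAdd k j))) with hf
  let blocks : Equiv.Perm (Fin k) × Equiv.Perm (Fin l) → Equiv.Perm (Fin (k + l)) :=
    fun p => finSumFinEquiv.permCongr (Equiv.Perm.sumCongrHom _ _ p)
  have blocks_inj : Function.Injective blocks :=
    finSumFinEquiv.permCongr.injective.comp Equiv.Perm.sumCongrHom_injective
  have f_blocks (p) : f (blocks p) = α fun i => x (Fin.castAdd l i) := by
    obtain ⟨π, ρ⟩ := p
    have hα : (α fun i => x (blocks (π, ρ) (Fin.castAdd l i))) =
        ((Equiv.Perm.sign π : ℤ) : ℝ) * α fun i => x (Fin.castAdd l i) := by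
      have := α.map_perm (fun i => x (Fin.castAdd l i)) π
      simpa [blocks, Equiv.permCongr_apply, Function.comp_def, Units.smul_def] using this
    have hJ : (eW J fun j => x (blocks (π, ρ) (Fin.natAdd k j))) =
        ((Equiv.Perm.sign ρ : ℤ) : ℝ) := by
      have := Matrix.det_permute ρ (1 : Matrix (Fin l) (Fin l) ℝ)
      rw [Matrix.det_one, mul_one] at this
      rw [← this, eW]
      congr 1
      ext a b
      simp [blocks, Equiv.permCongr_apply, h₁]
      rfl
    have hs : Equiv.Perm.sign (blocks (π, ρ)) = Equiv.Perm.sign π * Equiv.Perm.sign ρ := by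
      simp [blocks, Equiv.Perm.sign_permCongr]
    simp only [hf, hα, hJ, hs]
    rcases Int.units_eq_one_or (Equiv.Perm.sign π) with h | h <;>
      rcases Int.units_eq_one_or (Equiv.Perm.sign ρ) with h' | h' <;> simp [h, h']
  have f_zero (σ) (hσ : σ ∉ Set.range blocks) : f σ = 0 := by
    by_cases h : ∃ a i, σ (Fin.natAdd k a) = Fin.castAdd l i
    · obtain ⟨a, i, hai⟩ := h
      have : (eW J fun j => x (σ (Fin.natAdd k j))) = 0 :=
        Matrix.det_eq_zero_of_row_eq_zero a fun j => by simp [hai, h₀]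
      simp [hf, this]
    · refine absurd ?_ hσ
      push Not at h
      have hmaps : Set.MapsTo (finSumFinEquiv.symm.permCongr σ)
          (Set.range (Sum.inr : Fin l → Fin k ⊕ Fin l)) (Set.range Sum.inr) := by
        rintro _ ⟨a, rfl⟩
        rcases hy : finSumFinEquiv.symm (σ (Fin.natAdd k a)) with i | j
        · refine absurd ?_ (h a i)
          rw [← finSumFinEquiv_apply_left, ← hy, Equiv.apply_symm_apply]
        · exact ⟨j, by simp [Equiv.permCongr_apply, hy]⟩
      obtain ⟨p, hp⟩ := Equiv.Perm.mem_sumCongrHom_range_of_perm_mapsTo_inl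
        ((Equiv.Perm.perm_mapsTo_inl_iff_mapsTo_inr _).mpr hmaps)
      refine ⟨p, ?_⟩
      simp only [blocks, hp]
      ext
      simp [Equiv.permCongr_apply]
  have key : ∑ σ, f σ = (Nat.factorial k * Nat.factorial l : ℕ) *
      α fun i => x (Fin.castAdd l i) := by
    rw [← Fintype.sum_of_injective blocks blocks_inj _ f f_zero fun p => rfl]
    simp [f_blocks, Fintype.card_perm]
  have hpos : ((Nat.factorial k * Nat.factorial l : ℕ) : ℝ) ≠ 0 := by positivity
  change _ * ∑ σ, f σ = _
  rw [key, inv_mul_cancel_left₀ hpos]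

theorem wedge_two_two (α β : V [⋀^Fin 2]→ₗ[ℝ] ℝ) (x : Fin 4 → V) :
    wedge (k := 2) (l := 2) α β x =
      α ![x 0, x 1] * β ![x 2, x 3] - α ![x 0, x 2] * β ![x 1, x 3]
        + α ![x 0, x 3] * β ![x 1, x 2] + α ![x 1, x 2] * β ![x 0, x 3]
        - α ![x 1, x 3] * β ![x 0, x 2] + α ![x 2, x 3] * β ![x 0, x 1] := by
  have swap (γ : V [⋀^Fin 2]→ₗ[ℝ] ℝ) (u v : V) : γ ![u, v] = -γ ![v, u] := by
    rw [← γ.map_swap ![v, u] (i := 0) (j := 1) (by decide)]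
    congr 1
    ext i
    fin_cases i <;> simp
  have eta (y : Fin 2 → V) : y = ![y 0, y 1] := by
    ext i
    fin_cases i <;> simp
  have hw : wedge (k := 2) (l := 2) α β x = 4⁻¹ * ∑ σ : Equiv.Perm (Fin 4),
      ((Equiv.Perm.sign σ : ℤ) : ℝ) * α ![x (σ 0), x (σ (Fin.succ 0))] *
        β ![x (σ (Fin.succ (Fin.succ 0))), x (σ (Fin.succ (Fin.succ (Fin.succ 0))))] := by
    have h4 : ((Nat.factorial 2 * Nat.factorial 2 : ℕ) : ℝ) = 4 := by norm_num [Nat.factorial]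
    rw [wedge, h4]
    congr 1
    refine Finset.sum_congr rfl fun σ _ => ?_
    congr 2
    · rw [eta fun i => x (σ (Fin.castAdd 2 i))]
      rfl
    · rw [eta fun i => x (σ (Fin.natAdd 2 i))]
      rfl
  rw [hw]
  simp only [← Equiv.Perm.decomposeFin.symm.sum_comp, Fintype.sum_prod_type, Fin.sum_univ_succ,
    Finset.univ_unique, Finset.sum_singleton, Equiv.Perm.decomposeFin.symm_sign,
    Equiv.Perm.decomposeFin_symm_apply_zero, Equiv.Perm.decomposeFin_symm_apply_succ]
  simp [Equiv.swap_apply_def, Fin.ext_iff]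
  rw [swap α (x 1) (x 0), swap α (x 2) (x 0), swap α (x 3) (x 0), swap α (x 2) (x 1),
    swap α (x 3) (x 1), swap α (x 3) (x 2), swap β (x 1) (x 0), swap β (x 2) (x 0),
    swap β (x 3) (x 0), swap β (x 2) (x 1), swap β (x 3) (x 1), swap β (x 3) (x 2)]
  ring

/-- The wedge product of two `2`-forms and a basis `3`-form, evaluated on the standard basis. -/
theorem wedge_wedge_eW_basis (α β : V [⋀^Fin 2]→ₗ[ℝ] ℝ) (K : Equiv.Perm (Fin 7))
    (J : Fin 3 → Fin 7) (hJ : ∀ j, J j = K (Fin.natAdd 4 j)) (e : Fin 7 → V)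
    (he : ∀ i j, e i j = (1 : Matrix (Fin 7) (Fin 7) ℝ) i j) :
    wedge (k := 4) (l := 3) (wedge (k := 2) (l := 2) α β) (eW J) e =
      ((Equiv.Perm.sign K : ℤ) : ℝ) *
        (α ![e (K 0), e (K 1)] * β ![e (K 2), e (K 3)]
          - α ![e (K 0), e (K 2)] * β ![e (K 1), e (K 3)]
          + α ![e (K 0), e (K 3)] * β ![e (K 1), e (K 2)]
          + α ![e (K 1), e (K 2)] * β ![e (K 0), e (K 3)]
          - α ![e (K 1), e (K 3)] * β ![e (K 0), e (K 2)]
          + α ![e (K 2), e (K 3)] * β ![e (K 0), e (K 1)]) := by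
  have hcomp : (e ∘ K) ∘ (K⁻¹ : Equiv.Perm (Fin 7)) = e := by
    ext i
    simp
  have hK := wedge_eW_apply (k := 4) (l := 3) (wedgeAlt (k := 2) (l := 2) α β) J (e ∘ K)
    (fun i j => by
      rw [Function.comp_apply, he, hJ, Matrix.one_apply_ne]
      exact fun h => absurd (K.injective h) (by
        simp only [Fin.ext_iff, Fin.val_castAdd, Fin.val_natAdd]
        omega))
    (fun i j => by
      rw [Function.comp_apply, he, hJ, Matrix.one_apply, Matrix.one_apply]
      simp [K.injective.eq_iff, Fin.ext_iff])
  rw [coe_wedgeAlt (k := 2) (l := 2), wedge_two_two] at hK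
  obtain ⟨γ, hγ⟩ : ∃ γ : V [⋀^Fin 7]→ₗ[ℝ] ℝ,
      ⇑γ = wedge (k := 4) (l := 3) (wedge (k := 2) (l := 2) α β) (eW J) := by
    refine ⟨wedgeAlt (k := 4) (l := 3) (wedgeAlt (k := 2) (l := 2) α β) (eWAlt J), ?_⟩
    rw [coe_wedgeAlt (k := 4) (l := 3), coe_wedgeAlt (k := 2) (l := 2), coe_eWAlt]
  have hperm := γ.map_perm (e ∘ K) (K⁻¹ : Equiv.Perm (Fin 7))
  rw [hcomp, Equiv.Perm.sign_inv, Units.smul_def, zsmul_eq_mul, hγ] at hperm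
  exact hperm.trans (congrArg _ hK)

/-- `phi` as an alternating map. -/
noncomputable def phiAlt (a₁ a₂ a₃ a₄ a₅ : ℝ) : V [⋀^Fin 3]→ₗ[ℝ] ℝ :=
  a₁ • eWAlt ![0, 1, 2] + a₂ • eWAlt ![0, 3, 4] + a₃ • eWAlt ![0, 5, 6]
    + a₄ • (eWAlt ![1, 3, 5] + eWAlt ![1, 4, 6] - eWAlt ![2, 3, 6] + eWAlt ![2, 4, 5])
    + a₅ • (eWAlt ![1, 3, 6] - eWAlt ![1, 4, 5] + eWAlt ![2, 3, 5] + eWAlt ![2, 4, 6])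

theorem phi_eq (a₁ a₂ a₃ a₄ a₅ : ℝ) : phi a₁ a₂ a₃ a₄ a₅ =
    a₁ • eW ![0, 1, 2] + a₂ • eW ![0, 3, 4] + a₃ • eW ![0, 5, 6]
      + a₄ • (eW ![1, 3, 5] + eW ![1, 4, 6] - eW ![2, 3, 6] + eW ![2, 4, 5])
      + a₅ • (eW ![1, 3, 6] - eW ![1, 4, 5] + eW ![2, 3, 5] + eW ![2, 4, 6]) := rfl

/-- A `7`-form on `ℝ⁷` is determined by its value on the standard basis. -/
theorem alternating_seven_apply (γ : V [⋀^Fin 7]→ₗ[ℝ] ℝ) (x : Fin 7 → V) :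
    γ x = γ (fun i => Pi.single i 1) * eW ![0, 1, 2, 3, 4, 5, 6] x := by
  have h := DFunLike.congr_fun (γ.eq_smul_basis_det (Pi.basisFun ℝ (Fin 7))) x
  have hid : (![0, 1, 2, 3, 4, 5, 6] : Fin 7 → Fin 7) = id := by
    ext i
    fin_cases i <;> rfl
  have hb : ⇑(Pi.basisFun ℝ (Fin 7)) = fun i => Pi.single i 1 := by
    ext i
    simp
  have hd : (Pi.basisFun ℝ (Fin 7)).det x = eW ![0, 1, 2, 3, 4, 5, 6] x := by
    rw [hid, Module.Basis.det_apply, ← Matrix.det_transpose]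
    rfl
  rw [h, AlternatingMap.smul_apply, hb, hd, smul_eq_mul]

/-- The matrix of the `2`-form `ι_u φ` in the standard basis. -/
def contractionMatrix (a₁ a₂ a₃ a₄ a₅ : ℝ) (u : V) : Matrix (Fin 7) (Fin 7) ℝ :=
  !![0, a₁ * u 2, -(a₁ * u 1), a₂ * u 4, -(a₂ * u 3), a₃ * u 6, -(a₃ * u 5);
    -(a₁ * u 2), 0, a₁ * u 0, a₄ * u 5 + a₅ * u 6, -(a₅ * u 5 - a₄ * u 6),
      -(a₄ * u 3 - a₅ * u 4), -(a₅ * u 3 + a₄ * u 4);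
    a₁ * u 1, -(a₁ * u 0), 0, a₅ * u 5 - a₄ * u 6, a₄ * u 5 + a₅ * u 6,
      -(a₅ * u 3 + a₄ * u 4), a₄ * u 3 - a₅ * u 4;
    -(a₂ * u 4), -(a₄ * u 5 + a₅ * u 6), -(a₅ * u 5 - a₄ * u 6),
      0, a₂ * u 0, a₄ * u 1 + a₅ * u 2, a₅ * u 1 - a₄ * u 2;
    a₂ * u 3, a₅ * u 5 - a₄ * u 6, -(a₄ * u 5 + a₅ * u 6), -(a₂ * u 0),
      0, -(a₅ * u 1 - a₄ * u 2), a₄ * u 1 + a₅ * u 2;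
    -(a₃ * u 6), a₄ * u 3 - a₅ * u 4, a₅ * u 3 + a₄ * u 4, -(a₄ * u 1 + a₅ * u 2),
      a₅ * u 1 - a₄ * u 2, 0, a₃ * u 0;
    a₃ * u 5, a₅ * u 3 + a₄ * u 4, -(a₄ * u 3 - a₅ * u 4), -(a₅ * u 1 - a₄ * u 2),
      -(a₄ * u 1 + a₅ * u 2), -(a₃ * u 0), 0]

theorem eW_single_single (u : V) (p q r i j : Fin 7) :
    eW ![p, q, r] ![u, Pi.single i 1, Pi.single j 1] =
      u p * ((if q = i then 1 else 0) * (if r = j then 1 else 0)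
          - (if r = i then 1 else 0) * (if q = j then 1 else 0))
        - u q * ((if p = i then 1 else 0) * (if r = j then 1 else 0)
          - (if r = i then 1 else 0) * (if p = j then 1 else 0))
        + u r * ((if p = i then 1 else 0) * (if q = j then 1 else 0)
          - (if q = i then 1 else 0) * (if p = j then 1 else 0)) := by
  simp only [eW, Matrix.det_fin_three, Matrix.of_apply, Pi.single_apply,
    Matrix.cons_val]
  ring

theorem iota_phi_single (a₁ a₂ a₃ a₄ a₅ : ℝ) (u : V) (i j : Fin 7) :
    iota u (phi a₁ a₂ a₃ a₄ a₅) ![Pi.single i 1, Pi.single j 1] =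
      contractionMatrix a₁ a₂ a₃ a₄ a₅ u i j := by
  fin_cases i <;> fin_cases j <;>
    simp [iota, phi, gamma1, gamma2, eW_single_single, contractionMatrix] <;>
    ring

theorem bForm_phi_basis (a₁ a₂ a₃ a₄ a₅ : ℝ) (v w : V) :
    bForm (phi a₁ a₂ a₃ a₄ a₅) v w (fun i => Pi.single i 1) =
      a₁ * a₂ * a₃ * (v 0 * w 0)
        - (a₄ ^ 2 + a₅ ^ 2) *
          (a₁ * (v 1 * w 1 + v 2 * w 2) - a₂ * (v 3 * w 3 + v 4 * w 4)
            + a₃ * (v 5 * w 5 + v 6 * w 6)) := by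
  let M := contractionMatrix a₁ a₂ a₃ a₄ a₅
  let ω (u : V) := iota u (phi a₁ a₂ a₃ a₄ a₅)
  have key (K : Equiv.Perm (Fin 7)) (hs : Equiv.Perm.sign K = 1) (i j k l p q r : Fin 7)
      (hK : ⇑K = ![i, j, k, l, p, q, r]) :
      wedge (k := 4) (l := 3) (wedge (k := 2) (l := 2) (ω v) (ω w)) (eW ![p, q, r])
          (fun i => Pi.single i 1) =
        M v i j * M w k l - M v i k * M w j l + M v i l * M w j k
          + M v j k * M w i l - M v j l * M w i k + M v k l * M w i j := by
    have h := wedge_wedge_eW_basis ((phiAlt a₁ a₂ a₃ a₄ a₅).curryLeft v)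
      ((phiAlt a₁ a₂ a₃ a₄ a₅).curryLeft w) K ![p, q, r]
      (fun j => by rw [hK]; fin_cases j <;> rfl) (fun i => Pi.single i 1)
      (fun i j => by simp [Matrix.one_apply, Pi.single_apply, eq_comm])
    rw [hs, hK] at h
    have hι (u : V) : ⇑((phiAlt a₁ a₂ a₃ a₄ a₅).curryLeft u) = iota u (phi a₁ a₂ a₃ a₄ a₅) := rfl
    simp only [hι, iota_phi_single] at h
    simpa using h
  change 6⁻¹ * wedge (k := 4) (l := 3) (wedge (k := 2) (l := 2) (ω v) (ω w))
    (phi a₁ a₂ a₃ a₄ a₅) _ = _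
  rw [phi_eq]
  simp only [wedge_add_right, wedge_sub_right, wedge_smul_right, Pi.add_apply, Pi.sub_apply,
    Pi.smul_apply, smul_eq_mul]
  rw [key ⟨![3, 4, 5, 6, 0, 1, 2], ![4, 5, 6, 0, 1, 2, 3], by decide, by decide⟩ (by decide)
      3 4 5 6 0 1 2 rfl,
    key ⟨![1, 2, 5, 6, 0, 3, 4], ![4, 0, 1, 5, 6, 2, 3], by decide, by decide⟩ (by decide)
      1 2 5 6 0 3 4 rfl,
    key ⟨![1, 2, 3, 4, 0, 5, 6], ![4, 0, 1, 2, 3, 5, 6], by decide, by decide⟩ (by decide)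
      1 2 3 4 0 5 6 rfl,
    key ⟨![0, 2, 4, 6, 1, 3, 5], ![0, 4, 1, 5, 2, 6, 3], by decide, by decide⟩ (by decide)
      0 2 4 6 1 3 5 rfl,
    key ⟨![0, 2, 3, 5, 1, 4, 6], ![0, 4, 1, 2, 5, 3, 6], by decide, by decide⟩ (by decide)
      0 2 3 5 1 4 6 rfl,
    key ⟨![0, 1, 4, 5, 2, 3, 6], ![0, 1, 4, 5, 2, 3, 6], by decide, by decide⟩ (by decide)
      0 1 4 5 2 3 6 rfl,
    key ⟨![0, 1, 3, 6, 2, 4, 5], ![0, 1, 4, 2, 5, 6, 3], by decide, by decide⟩ (by decide)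
      0 1 3 6 2 4 5 rfl,
    key ⟨![2, 0, 4, 5, 1, 3, 6], ![1, 4, 0, 5, 2, 3, 6], by decide, by decide⟩ (by decide)
      2 0 4 5 1 3 6 rfl,
    key ⟨![2, 0, 3, 6, 1, 4, 5], ![1, 4, 0, 2, 5, 6, 3], by decide, by decide⟩ (by decide)
      2 0 3 6 1 4 5 rfl,
    key ⟨![1, 0, 4, 6, 2, 3, 5], ![1, 0, 4, 5, 2, 6, 3], by decide, by decide⟩ (by decide)
      1 0 4 6 2 3 5 rfl,
    key ⟨![1, 0, 3, 5, 2, 4, 6], ![1, 0, 4, 2, 5, 3, 6], by decide, by decide⟩ (by decide)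
      1 0 3 5 2 4 6 rfl]
  simp only [M, contractionMatrix]
  simp
  ring

/-- the value of `b_φ` for the generic invariant 3-form on a generic
Aloff–Wallach space; here `vᵢ` (the `i`-th coordinate of `v`) is `v (i-1)` in 0-indexing. -/
theorem bForm_phi (a₁ a₂ a₃ a₄ a₅ : ℝ) (v w : V) :
    bForm (phi a₁ a₂ a₃ a₄ a₅) v w =
      fun x =>
        (a₁ * a₂ * a₃ * (v 0 * w 0)
          - (a₄ ^ 2 + a₅ ^ 2) *
            (a₁ * (v 1 * w 1 + v 2 * w 2) - a₂ * (v 3 * w 3 + v 4 * w 4)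
              + a₃ * (v 5 * w 5 + v 6 * w 6))) * eW ![0, 1, 2, 3, 4, 5, 6] x := by
  funext x
  have h := alternating_seven_apply ((6 : ℝ)⁻¹ • wedgeAlt
    (wedgeAlt ((phiAlt a₁ a₂ a₃ a₄ a₅).curryLeft v) ((phiAlt a₁ a₂ a₃ a₄ a₅).curryLeft w))
    (phiAlt a₁ a₂ a₃ a₄ a₅)) x
  have hb : ⇑((6 : ℝ)⁻¹ • wedgeAlt
      (wedgeAlt ((phiAlt a₁ a₂ a₃ a₄ a₅).curryLeft v) ((phiAlt a₁ a₂ a₃ a₄ a₅).curryLeft w))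
      (phiAlt a₁ a₂ a₃ a₄ a₅)) = bForm (phi a₁ a₂ a₃ a₄ a₅) v w := by
    funext y
    rw [AlternatingMap.smul_apply, coe_wedgeAlt, coe_wedgeAlt]
    rfl
  rw [← bForm_phi_basis, ← hb]
  exact h

end Stmt1
end

section
/- Let γ₁ = e^{246} + e^{257} − e^{347} + e^{356} and γ₂ = e^{247} − e^{256} + e^{346} + e^{357}, and for real numbers a₁,…,a₅ let φ = a₁e^{123} + a₂e^{145} + a₃e^{167} + a₄γ₁ + a₅γ₂. Then the ℝ-valued symmetric bilinear form (v,w) ↦ (coefficient of b_φ(v,w) relative to e^{1234567}) is definite (i.e., positive definite or negative definite) if and only if a₄² + a₅² ≠ 0 and either (a₁ > 0 and a₂ < 0 and a₃ > 0) or (a₁ < 0 and a₂ > 0 and a₃ < 0). (Equivalently, φ defines a G₂-structure exactly for these parameter values.) -/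
open scoped BigOperators

namespace Stmt2

/-- Vectors in ℝ⁷. -/
abbrev V : Type := Fin 7 → ℝ

/-- The basis wedge `e^{idx 0} ∧ ⋯ ∧ e^{idx (k-1)}` (determinant convention). -/
def eW {k : ℕ} (idx : Fin k → Fin 7) : (Fin k → V) → ℝ :=
  fun x => Matrix.det (Matrix.of fun a b => x a (idx b))

/-- The wedge product of a `k`-form and an `l`-form. -/
noncomputable def wedge {k l : ℕ} (α : (Fin k → V) → ℝ) (β : (Fin l → V) → ℝ) :
    (Fin (k + l) → V) → ℝ :=
  fun x => ((Nat.factorial k * Nat.factorial l : ℕ) : ℝ)⁻¹ *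
    ∑ σ : Equiv.Perm (Fin (k + l)),
      ((Equiv.Perm.sign σ : ℤ) : ℝ) *
        (α fun i => x (σ (Fin.castAdd l i))) * (β fun j => x (σ (Fin.natAdd k j)))

/-- Interior product: insert the vector `v` into the first argument. -/
def iota {k : ℕ} (v : V) (α : (Fin (k + 1) → V) → ℝ) : (Fin k → V) → ℝ :=
  fun x => α (Fin.cons v x)

/-- `b_φ(v,w) = (1/6) (ι_v φ) ∧ (ι_w φ) ∧ φ`, a `7`-form. -/
noncomputable def bForm (φ : (Fin 3 → V) → ℝ) (v w : V) : (Fin 7 → V) → ℝ :=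
  fun x => (6 : ℝ)⁻¹ * wedge (wedge (iota v φ) (iota w φ)) φ x

/-- `γ₁ = e^{246} + e^{257} − e^{347} + e^{356}` (0-indexed). -/
def gamma1 : (Fin 3 → V) → ℝ :=
  fun x => eW ![1, 3, 5] x + eW ![1, 4, 6] x - eW ![2, 3, 6] x + eW ![2, 4, 5] x

/-- `γ₂ = e^{247} − e^{256} + e^{346} + e^{357}` (0-indexed). -/
def gamma2 : (Fin 3 → V) → ℝ :=
  fun x => eW ![1, 3, 6] x - eW ![1, 4, 5] x + eW ![2, 3, 5] x + eW ![2, 4, 6] x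

/-- `φ = a₁e^{123} + a₂e^{145} + a₃e^{167} + a₄γ₁ + a₅γ₂`. -/
def phi (a₁ a₂ a₃ a₄ a₅ : ℝ) : (Fin 3 → V) → ℝ :=
  fun x => a₁ * eW ![0, 1, 2] x + a₂ * eW ![0, 3, 4] x + a₃ * eW ![0, 5, 6] x
    + a₄ * gamma1 x + a₅ * gamma2 x

/-- The standard basis of ℝ⁷. -/
noncomputable def stdBasis : Fin 7 → V := fun i => Pi.single i 1

/-- The coefficient of the 7-form `b_φ(v,w)` relative to `e^{1234567}`, i.e. its value
on the standard basis tuple (note `e^{1234567}(e₁,…,e₇) = 1`). -/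
noncomputable def Bcoef (a₁ a₂ a₃ a₄ a₅ : ℝ) (v w : V) : ℝ :=
  bForm (phi a₁ a₂ a₃ a₄ a₅) v w stdBasis

/-- Expansion of a wedge square of a `2`-form. -/
lemma wedge_self_two (α : (Fin 2 → V) → ℝ) (h : ∀ x y, α ![x, y] = -α ![y, x])
    (x : Fin 4 → V) :
    wedge α α x = 2 * (α ![x 0, x 1] * α ![x 2, x 3] - α ![x 0, x 2] * α ![x 1, x 3]
      + α ![x 0, x 3] * α ![x 1, x 2]) := by
  have key : ∀ σ : Equiv.Perm (Fin 4),
      ((Equiv.Perm.sign σ : ℤ) : ℝ) * (α fun i => x (σ (Fin.castAdd 2 i))) *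
        (α fun j => x (σ (Fin.natAdd 2 j))) =
      ((Equiv.Perm.sign σ : ℤ) : ℝ) * α ![x (σ 0), x (σ (Fin.succ 0))] *
        α ![x (σ (Fin.succ (Fin.succ 0))), x (σ (Fin.succ (Fin.succ (Fin.succ 0))))] := by
    intro σ
    congr 2
    · congr 1
      ext i; fin_cases i <;> rfl
    · ext i; fin_cases i <;> rfl
  unfold wedge
  simp only [Nat.reduceAdd]
  rw [Finset.sum_congr rfl fun σ _ => key σ]
  simp only [Finset.univ_perm_fin_succ, ← Finset.univ_product_univ, Finset.sum_map,
    Finset.sum_product, Fin.sum_univ_succ, Finset.univ_unique, Finset.sum_singleton,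
    Equiv.toEmbedding_apply, Equiv.Perm.decomposeFin_symm_apply_succ,
    Equiv.Perm.decomposeFin_symm_apply_zero, Equiv.Perm.decomposeFin.symm_sign]
  simp [Equiv.swap_apply_def, Fin.ext_iff]
  rw [h (x 1) (x 0), h (x 2) (x 0), h (x 3) (x 0), h (x 2) (x 1), h (x 3) (x 1), h (x 3) (x 2)]
  ring

/-- The sign of a permutation squares to one in `ℝ`. -/
lemma sign_mul_sign_self {n : ℕ} (τ : Equiv.Perm (Fin n)) :
    ((Equiv.Perm.sign τ : ℤ) : ℝ) * ((Equiv.Perm.sign τ : ℤ) : ℝ) = 1 := by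
  rw [← Int.cast_mul, ← Units.val_mul, Int.units_mul_self, Units.val_one, Int.cast_one]

/-- Permuting the arguments of a wedge product multiplies it by the sign. -/
lemma wedge_comp_perm {k l : ℕ} (α : (Fin k → V) → ℝ) (β : (Fin l → V) → ℝ)
    (x : Fin (k + l) → V) (τ : Equiv.Perm (Fin (k + l))) :
    wedge α β (x ∘ τ) = ((Equiv.Perm.sign τ : ℤ) : ℝ) * wedge α β x := by
  unfold wedge
  rw [mul_left_comm, Finset.mul_sum _ _ ((Equiv.Perm.sign τ : ℤ) : ℝ)]
  congr 1
  refine Fintype.sum_equiv (Equiv.mulLeft τ) _ _ fun σ => ?_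
  simp only [Equiv.coe_mulLeft, Equiv.Perm.sign_mul, Equiv.Perm.coe_mul, Function.comp_apply,
    Units.val_mul, Int.cast_mul]
  linear_combination (-((Equiv.Perm.sign σ : ℤ) : ℝ) *
    (α fun i => x (τ (σ (Fin.castAdd l i)))) * (β fun j => x (τ (σ (Fin.natAdd k j))))) * sign_mul_sign_self τ

/-- Laplace expansion: the value on the standard basis of the wedge product of an alternating
`4`-form with a basis `3`-form picks out the complementary coefficient. -/
lemma wedge_eW_stdBasis (ω : (Fin 4 → V) → ℝ)
    (h : ∀ x (τ : Equiv.Perm (Fin 4)), ω (x ∘ τ) = ((Equiv.Perm.sign τ : ℤ) : ℝ) * ω x)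
    (ρ : Equiv.Perm (Fin 7)) :
    wedge (l := 3) ω (eW fun b => ρ (Fin.natAdd 4 b)) stdBasis =
      ((Equiv.Perm.sign ρ : ℤ) : ℝ) * ω fun i => stdBasis (ρ (Fin.castAdd 3 i)) := by
  let e : Equiv.Perm (Fin 4 ⊕ Fin 3) ≃ Equiv.Perm (Fin 7) :=
    (finSumFinEquiv (m := 4) (n := 3)).permCongr
  let f : Equiv.Perm (Fin 4) × Equiv.Perm (Fin 3) → Equiv.Perm (Fin 7) :=
    fun p => ρ * e (Equiv.sumCongr p.1 p.2)
  have hf : Function.Injective f := fun p q hpq =>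
    Equiv.Perm.sumCongrHom_injective (e.injective (mul_left_cancel hpq))
  unfold wedge
  rw [← Fintype.sum_of_injective f hf
    (fun _ => ((Equiv.Perm.sign ρ : ℤ) : ℝ) * ω fun i => stdBasis (ρ (Fin.castAdd 3 i)))]
  · simp only [Finset.sum_const, Finset.card_univ, Fintype.card_prod, Fintype.card_perm,
      Fintype.card_fin, nsmul_eq_mul]
    norm_num [Nat.factorial]
    ring
  · intro σ hσ
    refine mul_eq_zero_of_right _ ?_
    by_contra hne
    apply hσ
    have hmaps : Set.MapsTo (e.symm (ρ⁻¹ * σ)) (Set.range Sum.inl) (Set.range Sum.inl) := by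
      rw [Equiv.Perm.perm_mapsTo_inl_iff_mapsTo_inr]
      rintro _ ⟨a, rfl⟩
      by_contra hna
      refine hne (Matrix.det_eq_zero_of_row_eq_zero a fun b => ?_)
      rw [Matrix.of_apply]
      simp only [stdBasis]
      rw [Pi.single_apply, if_neg]
      intro hab
      refine hna ⟨b, ?_⟩
      change _ = (finSumFinEquiv (m := 4) (n := 3)).symm (ρ⁻¹ (σ (Fin.natAdd 4 a)))
      rw [← hab, Equiv.Perm.coe_inv, Equiv.symm_apply_apply]
      exact (finSumFinEquiv_symm_apply_natAdd (m := 4) b).symm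
    obtain ⟨p, hp⟩ := Equiv.Perm.mem_sumCongrHom_range_of_perm_mapsTo_inl hmaps
    refine ⟨p, ?_⟩
    change ρ * e (Equiv.Perm.sumCongrHom _ _ p) = σ
    rw [hp, Equiv.apply_symm_apply, mul_inv_cancel_left]
  · rintro ⟨τ, υ⟩
    have h1 : ∀ i, f (τ, υ) (Fin.castAdd 3 i) = ρ (Fin.castAdd 3 (τ i)) := fun i => by
      have := finSumFinEquiv_symm_apply_castAdd (n := 3) i
      simp [f, e, Equiv.permCongr_apply, this]
      rfl
    have h2 : ∀ i, f (τ, υ) (Fin.natAdd 4 i) = ρ (Fin.natAdd 4 (υ i)) := fun i => by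
      have := finSumFinEquiv_symm_apply_natAdd (m := 4) i
      simp [f, e, Equiv.permCongr_apply, this]
      rfl
    have h3 : Equiv.Perm.sign (f (τ, υ)) =
        Equiv.Perm.sign ρ * (Equiv.Perm.sign τ * Equiv.Perm.sign υ) := by
      simp only [f, e, Equiv.Perm.sign_mul, Equiv.Perm.sign_permCongr, Equiv.Perm.sign_sumCongr]
    have h4 : eW (fun b => ρ (Fin.natAdd 4 b))
        (fun j => stdBasis (ρ (Fin.natAdd 4 (υ j)))) = ((Equiv.Perm.sign υ : ℤ) : ℝ) := by
      rw [← Matrix.det_permutation]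
      unfold eW
      congr 1
      ext a b
      simp [stdBasis, Pi.single_apply, Equiv.toPEquiv_apply, PEquiv.toMatrix_apply,
        (Fin.natAdd_injective 3 4).eq_iff, eq_comm]
    have h5 := h (fun i => stdBasis (ρ (Fin.castAdd 3 i))) τ
    simp only [Function.comp_def] at h5
    simp only [h1, h2, h3, h4, h5, Units.val_mul, Int.cast_mul]
    linear_combination (-((Equiv.Perm.sign ρ : ℤ) : ℝ) *
      (ω fun i => stdBasis (ρ (Fin.castAdd 3 i)))) * 
        (((Equiv.Perm.sign υ : ℤ) : ℝ) ^ 2 * sign_mul_sign_self τ + sign_mul_sign_self υ)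

lemma wedge_add_right {k l : ℕ} (α : (Fin k → V) → ℝ) (β β' : (Fin l → V) → ℝ) :
    wedge α (β + β') = wedge α β + wedge α β' := by
  ext x
  simp only [wedge, Pi.add_apply, mul_add, Finset.sum_add_distrib]

lemma wedge_smul_right {k l : ℕ} (α : (Fin k → V) → ℝ) (c : ℝ) (β : (Fin l → V) → ℝ) :
    wedge α (c • β) = c • wedge α β := by
  ext x
  simp only [wedge, Pi.smul_apply, smul_eq_mul, mul_left_comm _ c, ← Finset.mul_sum]

lemma phi_eq (a₁ a₂ a₃ a₄ a₅ : ℝ) : phi a₁ a₂ a₃ a₄ a₅ =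
    a₁ • eW ![0, 1, 2] + a₂ • eW ![0, 3, 4] + a₃ • eW ![0, 5, 6]
      + a₄ • eW ![1, 3, 5] + a₄ • eW ![1, 4, 6] + (-a₄) • eW ![2, 3, 6] + a₄ • eW ![2, 4, 5]
      + a₅ • eW ![1, 3, 6] + (-a₅) • eW ![1, 4, 5] + a₅ • eW ![2, 3, 5] + a₅ • eW ![2, 4, 6] := by
  ext x
  simp only [phi, gamma1, gamma2, Pi.add_apply, Pi.smul_apply, smul_eq_mul]
  ring

/-- `wedge_eW_stdBasis` with the complementary index tuples `p`, `t` written out. -/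
lemma wedge_eW_stdBasis_of_perm (ω : (Fin 4 → V) → ℝ)
    (h : ∀ x (τ : Equiv.Perm (Fin 4)), ω (x ∘ τ) = ((Equiv.Perm.sign τ : ℤ) : ℝ) * ω x)
    (p : Fin 4 → Fin 7) (t : Fin 3 → Fin 7) (ρ : Equiv.Perm (Fin 7)) (s : ℤ)
    (hp : ∀ i, ρ (Fin.castAdd 3 i) = p i) (ht : ∀ i, ρ (Fin.natAdd 4 i) = t i)
    (hs : (Equiv.Perm.sign ρ : ℤ) = s) :
    wedge (l := 3) ω (eW t) stdBasis = s * ω fun i => stdBasis (p i) := by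
  have := wedge_eW_stdBasis ω h ρ
  simp only [hp, ht, hs] at this
  exact this

lemma wedge_phi_stdBasis (a₁ a₂ a₃ a₄ a₅ : ℝ) (ω : (Fin 4 → V) → ℝ)
    (h : ∀ x (τ : Equiv.Perm (Fin 4)), ω (x ∘ τ) = ((Equiv.Perm.sign τ : ℤ) : ℝ) * ω x) :
    wedge (l := 3) ω (phi a₁ a₂ a₃ a₄ a₅) stdBasis =
      a₁ * ω (fun i => stdBasis (![3, 4, 5, 6] i))
      + a₂ * ω (fun i => stdBasis (![1, 2, 5, 6] i))
      + a₃ * ω (fun i => stdBasis (![1, 2, 3, 4] i))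
      + a₄ * ω (fun i => stdBasis (![0, 2, 4, 6] i))
      + a₄ * ω (fun i => stdBasis (![0, 2, 3, 5] i))
      + (-a₄) * ω (fun i => stdBasis (![0, 1, 4, 5] i))
      + a₄ * ω (fun i => stdBasis (![0, 1, 3, 6] i))
      - a₅ * ω (fun i => stdBasis (![0, 2, 4, 5] i))
      - (-a₅) * ω (fun i => stdBasis (![0, 2, 3, 6] i))
      - a₅ * ω (fun i => stdBasis (![0, 1, 4, 6] i))
      - a₅ * ω (fun i => stdBasis (![0, 1, 3, 5] i)) := by
  simp only [phi_eq, wedge_add_right, wedge_smul_right, Pi.add_apply, Pi.smul_apply, smul_eq_mul]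
  rw [
    wedge_eW_stdBasis_of_perm ω h ![3, 4, 5, 6] ![0, 1, 2] ⟨![3, 4, 5, 6, 0, 1, 2], ![4, 5, 6, 0, 1, 2, 3], by decide, by decide⟩ (1)
      (by decide) (by decide) (by decide),
    wedge_eW_stdBasis_of_perm ω h ![1, 2, 5, 6] ![0, 3, 4] ⟨![1, 2, 5, 6, 0, 3, 4], ![4, 0, 1, 5, 6, 2, 3], by decide, by decide⟩ (1)
      (by decide) (by decide) (by decide),
    wedge_eW_stdBasis_of_perm ω h ![1, 2, 3, 4] ![0, 5, 6] ⟨![1, 2, 3, 4, 0, 5, 6], ![4, 0, 1, 2, 3, 5, 6], by decide, by decide⟩ (1)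
      (by decide) (by decide) (by decide),
    wedge_eW_stdBasis_of_perm ω h ![0, 2, 4, 6] ![1, 3, 5] ⟨![0, 2, 4, 6, 1, 3, 5], ![0, 4, 1, 5, 2, 6, 3], by decide, by decide⟩ (1)
      (by decide) (by decide) (by decide),
    wedge_eW_stdBasis_of_perm ω h ![0, 2, 3, 5] ![1, 4, 6] ⟨![0, 2, 3, 5, 1, 4, 6], ![0, 4, 1, 2, 5, 3, 6], by decide, by decide⟩ (1)
      (by decide) (by decide) (by decide),
    wedge_eW_stdBasis_of_perm ω h ![0, 1, 4, 5] ![2, 3, 6] ⟨![0, 1, 4, 5, 2, 3, 6], ![0, 1, 4, 5, 2, 3, 6], by decide, by decide⟩ (1)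
      (by decide) (by decide) (by decide),
    wedge_eW_stdBasis_of_perm ω h ![0, 1, 3, 6] ![2, 4, 5] ⟨![0, 1, 3, 6, 2, 4, 5], ![0, 1, 4, 2, 5, 6, 3], by decide, by decide⟩ (1)
      (by decide) (by decide) (by decide),
    wedge_eW_stdBasis_of_perm ω h ![0, 2, 4, 5] ![1, 3, 6] ⟨![0, 2, 4, 5, 1, 3, 6], ![0, 4, 1, 5, 2, 3, 6], by decide, by decide⟩ (-1)
      (by decide) (by decide) (by decide),
    wedge_eW_stdBasis_of_perm ω h ![0, 2, 3, 6] ![1, 4, 5] ⟨![0, 2, 3, 6, 1, 4, 5], ![0, 4, 1, 2, 5, 6, 3], by decide, by decide⟩ (-1)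
      (by decide) (by decide) (by decide),
    wedge_eW_stdBasis_of_perm ω h ![0, 1, 4, 6] ![2, 3, 5] ⟨![0, 1, 4, 6, 2, 3, 5], ![0, 1, 4, 5, 2, 6, 3], by decide, by decide⟩ (-1)
      (by decide) (by decide) (by decide),
    wedge_eW_stdBasis_of_perm ω h ![0, 1, 3, 5] ![2, 4, 6] ⟨![0, 1, 3, 5, 2, 4, 6], ![0, 1, 4, 2, 5, 3, 6], by decide, by decide⟩ (-1)
      (by decide) (by decide) (by decide)]
  push_cast
  ring

lemma iota_eW (v x y : V) (i j k : Fin 7) : iota v (eW ![i, j, k]) ![x, y] =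
    v i * (x j * y k - x k * y j) - v j * (x i * y k - x k * y i)
      + v k * (x i * y j - x j * y i) := by
  simp [iota, eW, Matrix.det_fin_three]
  ring

lemma iota_add {k : ℕ} (v : V) (α β : (Fin (k + 1) → V) → ℝ) :
    iota v (α + β) = iota v α + iota v β := rfl

lemma iota_smul {k : ℕ} (v : V) (c : ℝ) (α : (Fin (k + 1) → V) → ℝ) :
    iota v (c • α) = c • iota v α := rfl

/-- The quadratic form of `phi` is diagonal in the standard basis. -/
lemma Bcoef_self (a₁ a₂ a₃ a₄ a₅ : ℝ) (v : V) : Bcoef a₁ a₂ a₃ a₄ a₅ v v =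
    a₁ * a₂ * a₃ * v 0 ^ 2 - (a₄ ^ 2 + a₅ ^ 2) *
      (a₁ * (v 1 ^ 2 + v 2 ^ 2) - a₂ * (v 3 ^ 2 + v 4 ^ 2) + a₃ * (v 5 ^ 2 + v 6 ^ 2)) := by
  have h1 : Bcoef a₁ a₂ a₃ a₄ a₅ v v = (6 : ℝ)⁻¹ * wedge (l := 3)
      (wedge (iota v (phi a₁ a₂ a₃ a₄ a₅)) (iota v (phi a₁ a₂ a₃ a₄ a₅)))
      (phi a₁ a₂ a₃ a₄ a₅) stdBasis := rfl
  rw [h1, wedge_phi_stdBasis _ _ _ _ _ _ (wedge_comp_perm (k := 2) (l := 2) _ _)]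
  have hα : ∀ x y, iota v (phi a₁ a₂ a₃ a₄ a₅) ![x, y] =
      -iota v (phi a₁ a₂ a₃ a₄ a₅) ![y, x] := fun x y => by
    simp only [phi_eq, iota_add, iota_smul, Pi.add_apply, Pi.smul_apply, smul_eq_mul, iota_eW]
    ring
  have hst : ∀ i j : Fin 7, stdBasis i j = if j = i then 1 else 0 := fun i j => by
    simp only [stdBasis, Pi.single_apply]
  simp only [wedge_self_two _ hα]
  simp only [phi_eq, iota_add, iota_smul, Pi.add_apply, Pi.smul_apply, smul_eq_mul, iota_eW, hst]
  simp
  ring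

lemma weighted_sq_pos {c₀ c₁ c₂ c₃ : ℝ} (h₀ : 0 < c₀) (h₁ : 0 < c₁) (h₂ : 0 < c₂) (h₃ : 0 < c₃)
    {v : V} (hv : v ≠ 0) :
    0 < c₀ * v 0 ^ 2 + c₁ * (v 1 ^ 2 + v 2 ^ 2) + c₂ * (v 3 ^ 2 + v 4 ^ 2)
      + c₃ * (v 5 ^ 2 + v 6 ^ 2) := by
  obtain ⟨i, hi⟩ := Function.ne_iff.mp hv
  have hi' : v i ≠ 0 := hi
  fin_cases i <;> simp at hi' <;> positivity

/-- the bilinear form `(v,w) ↦ coefficient of b_φ(v,w) w.r.t. e^{1234567}`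
is definite (positive definite or negative definite) iff `a₄² + a₅² ≠ 0` and either
`a₁ > 0, a₂ < 0, a₃ > 0` or `a₁ < 0, a₂ > 0, a₃ < 0`. -/
theorem bForm_definite_iff (a₁ a₂ a₃ a₄ a₅ : ℝ) :
    ((∀ v : V, v ≠ 0 → 0 < Bcoef a₁ a₂ a₃ a₄ a₅ v v) ∨
      (∀ v : V, v ≠ 0 → Bcoef a₁ a₂ a₃ a₄ a₅ v v < 0)) ↔
    (a₄ ^ 2 + a₅ ^ 2 ≠ 0 ∧
      ((0 < a₁ ∧ a₂ < 0 ∧ 0 < a₃) ∨ (a₁ < 0 ∧ 0 < a₂ ∧ a₃ < 0))) := by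
  simp only [Bcoef_self]
  constructor
  · intro h
    have hne : ∀ i : Fin 7, (Pi.single i 1 : V) ≠ 0 := fun i => by simp
    have hsq : 0 ≤ a₄ ^ 2 + a₅ ^ 2 := by positivity
    rcases h with h | h
    all_goals
      have h1 := h _ (hne 1)
      have h3 := h _ (hne 3)
      have h5 := h _ (hne 5)
      simp at h1 h3 h5
      have hQ : a₄ ^ 2 + a₅ ^ 2 ≠ 0 := fun h => by simp [h] at h1
      refine ⟨hQ, ?_⟩
    · exact Or.inr ⟨by nlinarith, by nlinarith, by nlinarith⟩
    · exact Or.inl ⟨by nlinarith, by nlinarith, by nlinarith⟩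
  · rintro ⟨hQ, ⟨h1, h2, h3⟩ | ⟨h1, h2, h3⟩⟩
    all_goals have hQ' : 0 < a₄ ^ 2 + a₅ ^ 2 := lt_of_le_of_ne (by positivity) hQ.symm
    · refine Or.inr fun v hv => ?_
      have := weighted_sq_pos (mul_pos (mul_pos h1 (neg_pos.mpr h2)) h3) (mul_pos hQ' h1)
        (mul_pos hQ' (neg_pos.mpr h2)) (mul_pos hQ' h3) hv
      linarith
    · refine Or.inl fun v hv => ?_
      have := weighted_sq_pos (mul_pos (mul_pos (neg_pos.mpr h1) h2) (neg_pos.mpr h3))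
        (mul_pos hQ' (neg_pos.mpr h1)) (mul_pos hQ' h2) (mul_pos hQ' (neg_pos.mpr h3)) hv
      linarith

end Stmt2
end

section
/- Let p > q ≥ 0 be integers. In 𝔰𝔲(3), set e₁ = (1/3)·diag(−(p+2q)i, (2p+q)i, (q−p)i), e₂ = [[0,1,0],[−1,0,0],[0,0,0]], e₃ = [[0,i,0],[i,0,0],[0,0,0]], e₄ = [[0,0,1],[0,0,0],[−1,0,0]], e₅ = [[0,0,i],[0,0,0],[i,0,0]], e₆ = [[0,0,0],[0,0,1],[0,−1,0]], e₇ = [[0,0,0],[0,0,i],[0,i,0]], e₈ = diag(pi, qi, −(p+q)i); these form a basis of 𝔰𝔲(3), and let 𝔪 = span(e₁,…,e₇), 𝔥 = span(e₈), with dual basis (e¹,…,e⁷) of 𝔪* and D the projected differential for the decomposition 𝔰𝔲(3) = 𝔪 ⊕ 𝔥. Let γ₁ = e^{246} + e^{257} − e^{347} + e^{356}. Then for all real numbers s > 0 and c > 0, the 3-form T = s·((p+q)e^{123} + q·e^{145} − p·e^{167}) + c·γ₁ on 𝔪 satisfies DT ≠ 0. (Hence the torsion 3-form of the invariant G₂T-structures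 on the Aloff–Wallach space N^{p,q} = SU(3)/U(1)_{p,q} is never closed.) -/
open scoped BigOperators

namespace Stmt3

open Complex (I)

/-- Coordinates for the 7-dimensional complement 𝔪 ⊂ 𝔰𝔲(3). -/
abbrev V : Type := Fin 7 → ℝ

/-- The basis wedge `e^{idx 0} ∧ ⋯ ∧ e^{idx (k-1)}` of the dual basis (determinant
convention), viewed in the coordinates of 𝔪. -/
def eW {k : ℕ} (idx : Fin k → Fin 7) : (Fin k → V) → ℝ :=
  fun x => Matrix.det (Matrix.of fun a b => x a (idx b))

/-- The projected Chevalley–Eilenberg differential of a 3-form, for the projected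
bracket `pb`:
`Dα(x₀,x₁,x₂,x₃) = Σ_{i<j} (−1)^{i+j} α(pb xᵢ xⱼ, …remaining…)`. -/
def D3 {M : Type*} (pb : M → M → M) (α : (Fin 3 → M) → ℝ) : (Fin 4 → M) → ℝ :=
  fun x =>
    -α ![pb (x 0) (x 1), x 2, x 3] + α ![pb (x 0) (x 2), x 1, x 3]
      - α ![pb (x 0) (x 3), x 1, x 2] - α ![pb (x 1) (x 2), x 0, x 3]
      + α ![pb (x 1) (x 3), x 0, x 2] - α ![pb (x 2) (x 3), x 0, x 1]

/-- The basis `(e₁,…,e₇)` of 𝔪 ⊂ 𝔰𝔲(3) for the Aloff–Wallach space `N^{p,q}`. -/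
noncomputable def E (p q : ℤ) : Fin 7 → Matrix (Fin 3) (Fin 3) ℂ :=
  ![!![(-(p : ℂ) - 2 * q) * I / 3, 0, 0; 0, (2 * (p : ℂ) + q) * I / 3, 0;
      0, 0, ((q : ℂ) - p) * I / 3],
    !![0, 1, 0; -1, 0, 0; 0, 0, 0],
    !![0, I, 0; I, 0, 0; 0, 0, 0],
    !![0, 0, 1; 0, 0, 0; -1, 0, 0],
    !![0, 0, I; 0, 0, 0; I, 0, 0],
    !![0, 0, 0; 0, 0, 1; 0, -1, 0],
    !![0, 0, 0; 0, 0, I; 0, I, 0]]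

/-- The generator `e₈ = diag(pi, qi, −(p+q)i)` of 𝔥. -/
noncomputable def E8 (p q : ℤ) : Matrix (Fin 3) (Fin 3) ℂ :=
  !![(p : ℂ) * I, 0, 0; 0, (q : ℂ) * I, 0; 0, 0, -((p : ℂ) + q) * I]

/-- The identification of coordinates with elements of 𝔪: `v ↦ Σᵢ vᵢ eᵢ`. -/
noncomputable def Φ (p q : ℤ) (v : V) : Matrix (Fin 3) (Fin 3) ℂ :=
  ∑ i, v i • E p q i

/-- `γ₁ = e^{246} + e^{257} − e^{347} + e^{356}` (0-indexed). -/
def gamma1 : (Fin 3 → V) → ℝ :=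
  fun x => eW ![1, 3, 5] x + eW ![1, 4, 6] x - eW ![2, 3, 6] x + eW ![2, 4, 5] x

/-- The torsion 3-form `T = s·((p+q)e^{123} + q e^{145} − p e^{167}) + c·γ₁`. -/
def T (p q : ℤ) (s c : ℝ) : (Fin 3 → V) → ℝ :=
  fun x => s * (((p : ℝ) + q) * eW ![0, 1, 2] x + (q : ℝ) * eW ![0, 3, 4] x
    - (p : ℝ) * eW ![0, 5, 6] x) + c * gamma1 x

theorem Φ_eq (p q : ℤ) (v : V) :
    Φ p q v =
      !![(v 0 * (-(p : ℂ) - 2 * q) / 3) * I, v 1 + v 2 * I, v 3 + v 4 * I;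
        -v 1 + v 2 * I, (v 0 * (2 * (p : ℂ) + q) / 3) * I, v 5 + v 6 * I;
        -v 3 + v 4 * I, -v 5 + v 6 * I, (v 0 * ((q : ℂ) - p) / 3) * I] := by
  ext i j
  fin_cases i <;> fin_cases j <;>
    simp [Φ, E, Fin.sum_univ_succ, Matrix.add_apply] <;> ring

/-- The components along `e₁, e₂, e₃` of a matrix written as `Φ v + h • e₈`. -/
theorem coords_of_eq {p q : ℤ} {v : V} {h : ℝ} {M : Matrix (Fin 3) (Fin 3) ℂ}
    (hM : M = Φ p q v + h • E8 p q) :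
    2 * ((p : ℝ) ^ 2 + p * q + q ^ 2) * v 0 = 3 * (p * (M 1 1).im - q * (M 0 0).im) ∧
      v 1 = (M 0 1).re ∧ v 2 = (M 0 1).im := by
  subst hM
  refine ⟨?_, ?_, ?_⟩
  · have h0 : (v 0 * (-(p : ℂ) - 2 * q) / 3).re = v 0 * (-(p : ℝ) - 2 * q) / 3 := by
      rw [← Complex.ofReal_re (v 0 * (-(p : ℝ) - 2 * q) / 3)]; push_cast; rfl
    have h1 : (v 0 * (2 * (p : ℂ) + q) / 3).re = v 0 * (2 * (p : ℝ) + q) / 3 := by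
      rw [← Complex.ofReal_re (v 0 * (2 * (p : ℝ) + q) / 3)]; push_cast; rfl
    simp [Φ_eq, E8, -Complex.div_ofNat_re, -Complex.mul_re, h0, h1]
    ring
  all_goals simp [Φ_eq, E8]

/-- The coefficient of `e^{4567}` in `D3 pb (T p q s c)`. -/
theorem D3_T_apply (p q : ℤ) (s c : ℝ) (pb : V → V → V) :
    D3 pb (T p q s c) (fun i => Pi.single (![3, 4, 5, 6] i) 1) =
      s * (p * pb (Pi.single 3 1) (Pi.single 4 1) 0 - q * pb (Pi.single 5 1) (Pi.single 6 1) 0)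
        + c * (pb (Pi.single 3 1) (Pi.single 5 1) 1 - pb (Pi.single 3 1) (Pi.single 6 1) 2
          + pb (Pi.single 4 1) (Pi.single 5 1) 2 + pb (Pi.single 4 1) (Pi.single 6 1) 1) := by
  simp [D3, T, gamma1, eW, Matrix.det_fin_three, Pi.single_apply, Fin.ext_iff]
  ring

/-- for integers `p > q ≥ 0` and all `s, c > 0`, the 3-form
`T = s·((p+q)e^{123} + q·e^{145} − p·e^{167}) + c·γ₁` on 𝔪 has `DT ≠ 0`, where `D` is
the projected Chevalley–Eilenberg differential of the reductive splitting
`𝔰𝔲(3) = 𝔪 ⊕ 𝔥`; the projected bracket is characterized by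
`[Φ(x), Φ(y)] = Φ(pb x y) + h₈(x,y)·e₈`. -/
theorem DT_ne_zero (p q : ℤ) (hq : 0 ≤ q) (hpq : q < p) (s c : ℝ) (hs : 0 < s)
    (hc : 0 < c) (pb : V → V → V) (h8 : V → V → ℝ)
    (hbr : ∀ x y : V,
      Φ p q x * Φ p q y - Φ p q y * Φ p q x = Φ p q (pb x y) + h8 x y • E8 p q) :
    D3 pb (T p q s c) ≠ 0 := by
  intro h
  have hD := congrFun h fun i => Pi.single (![3, 4, 5, 6] i) 1
  rw [D3_T_apply, Pi.zero_apply] at hD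
  have h34 := (coords_of_eq (hbr (Pi.single 3 1) (Pi.single 4 1))).1
  have h56 := (coords_of_eq (hbr (Pi.single 5 1) (Pi.single 6 1))).1
  have h35 := (coords_of_eq (hbr (Pi.single 3 1) (Pi.single 5 1))).2.1
  have h36 := (coords_of_eq (hbr (Pi.single 3 1) (Pi.single 6 1))).2.2
  have h45 := (coords_of_eq (hbr (Pi.single 4 1) (Pi.single 5 1))).2.2
  have h46 := (coords_of_eq (hbr (Pi.single 4 1) (Pi.single 6 1))).2.1
  simp [Φ_eq, Fin.ext_iff]
    at h34 h56 h35 h36 h45 h46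
  have hq' : (0 : ℝ) ≤ q := by exact_mod_cast hq
  have hp' : (0 : ℝ) < p := by exact_mod_cast hq.trans_lt hpq
  rw [h35, h36, h45, h46] at hD
  have hN : 0 < (p : ℝ) ^ 2 + p * q + q ^ 2 := by positivity
  have key : 6 * s * p * q + 4 * c * ((p : ℝ) ^ 2 + p * q + q ^ 2) = 0 := by
    linear_combination -((p : ℝ) ^ 2 + p * q + q ^ 2) * hD + s * p / 2 * h34 - s * q / 2 * h56
  have : 0 < 6 * s * p * q + 4 * c * ((p : ℝ) ^ 2 + p * q + q ^ 2) := by positivity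
  exact this.ne' key

end Stmt3
end

section
/- In 𝔰𝔲(3), set e₁ = diag(i,−i,0), e₂ = [[0,−1,0],[1,0,0],[0,0,0]], e₃ = [[0,−i,0],[−i,0,0],[0,0,0]], e₄ = [[0,0,1],[0,0,0],[−1,0,0]], e₅ = [[0,0,0],[0,0,−i],[0,−i,0]], e₆ = [[0,0,0],[0,0,−1],[0,1,0]], e₇ = [[0,0,i],[0,0,0],[i,0,0]], e₈ = diag(i,i,−2i); these form a basis of 𝔰𝔲(3), and let 𝔪 = span(e₁,…,e₇), 𝔥 = span(e₈), with dual basis (e¹,…,e⁷) of 𝔪* and D the projected differential for 𝔰𝔲(3) = 𝔪 ⊕ 𝔥. Set ω₀ = e^{47}−e^{56}, ω₁ = e^{47}+e^{56}, ω₂ = e^{46}−e^{57}, ω₃ = e^{45}+e^{67}. Suppose ρ = μ·e^{4567} + e^{23}∧β₁ + e^{13}∧β₂ + e^{12}∧β₃ is a 4-form on 𝔪 with μ ∈ ℝ and β₁, β₂, β₃ ∈ span(ω₀, ω₁, ω₂, ω₃), and suppose Dρ = λ·e¹∧ρ for some real λ ≠ 0. Then β₁ = −μ·ω₁, and β₂,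 β₃ ∈ span(ω₀, ω₂, ω₃). -/
open scoped BigOperators

namespace Stmt4

open Complex (I)

/-- Coordinates for the 7-dimensional complement 𝔪 ⊂ 𝔰𝔲(3). -/
abbrev V : Type := Fin 7 → ℝ

/-- The basis wedge `e^{idx 0} ∧ ⋯ ∧ e^{idx (k-1)}` of the dual basis (determinant
convention), viewed in the coordinates of 𝔪. -/
def eW {k : ℕ} (idx : Fin k → Fin 7) : (Fin k → V) → ℝ :=
  fun x => Matrix.det (Matrix.of fun a b => x a (idx b))

/-- The wedge product of a `k`-form and an `l`-form. -/
noncomputable def wedge {k l : ℕ} (α : (Fin k → V) → ℝ) (β : (Fin l → V) → ℝ) :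
    (Fin (k + l) → V) → ℝ :=
  fun x => ((Nat.factorial k * Nat.factorial l : ℕ) : ℝ)⁻¹ *
    ∑ σ : Equiv.Perm (Fin (k + l)),
      ((Equiv.Perm.sign σ : ℤ) : ℝ) *
        (α fun i => x (σ (Fin.castAdd l i))) * (β fun j => x (σ (Fin.natAdd k j)))

/-- The projected Chevalley–Eilenberg differential of a 4-form, for the projected
bracket `pb`. -/
def D4 {M : Type*} (pb : M → M → M) (α : (Fin 4 → M) → ℝ) : (Fin 5 → M) → ℝ :=
  fun x =>
    -α ![pb (x 0) (x 1), x 2, x 3, x 4] + α ![pb (x 0) (x 2), x 1, x 3, x 4]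
      - α ![pb (x 0) (x 3), x 1, x 2, x 4] + α ![pb (x 0) (x 4), x 1, x 2, x 3]
      - α ![pb (x 1) (x 2), x 0, x 3, x 4] + α ![pb (x 1) (x 3), x 0, x 2, x 4]
      - α ![pb (x 1) (x 4), x 0, x 2, x 3] - α ![pb (x 2) (x 3), x 0, x 1, x 4]
      + α ![pb (x 2) (x 4), x 0, x 1, x 3] - α ![pb (x 3) (x 4), x 0, x 1, x 2]

/-- The basis `(e₁,…,e₇)` of 𝔪 ⊂ 𝔰𝔲(3) for the exceptional Aloff–Wallach
space `N^{1,1}`. -/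
noncomputable def E : Fin 7 → Matrix (Fin 3) (Fin 3) ℂ :=
  ![!![I, 0, 0; 0, -I, 0; 0, 0, 0],
    !![0, -1, 0; 1, 0, 0; 0, 0, 0],
    !![0, -I, 0; -I, 0, 0; 0, 0, 0],
    !![0, 0, 1; 0, 0, 0; -1, 0, 0],
    !![0, 0, 0; 0, 0, -I; 0, -I, 0],
    !![0, 0, 0; 0, 0, -1; 0, 1, 0],
    !![0, 0, I; 0, 0, 0; I, 0, 0]]

/-- The generator `e₈ = diag(i, i, −2i)` of 𝔥. -/
noncomputable def E8 : Matrix (Fin 3) (Fin 3) ℂ :=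
  !![I, 0, 0; 0, I, 0; 0, 0, -2 * I]

/-- The identification of coordinates with elements of 𝔪: `v ↦ Σᵢ vᵢ eᵢ`. -/
noncomputable def Φ (v : V) : Matrix (Fin 3) (Fin 3) ℂ :=
  ∑ i, v i • E i

/-- `ω₀ = e^{47} − e^{56}` (0-indexed). -/
def omega0 : (Fin 2 → V) → ℝ := fun x => eW ![3, 6] x - eW ![4, 5] x

/-- `ω₁ = e^{47} + e^{56}` (0-indexed). -/
def omega1 : (Fin 2 → V) → ℝ := fun x => eW ![3, 6] x + eW ![4, 5] x

/-- `ω₂ = e^{46} − e^{57}` (0-indexed). -/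
def omega2 : (Fin 2 → V) → ℝ := fun x => eW ![3, 5] x - eW ![4, 6] x

/-- `ω₃ = e^{45} + e^{67}` (0-indexed). -/
def omega3 : (Fin 2 → V) → ℝ := fun x => eW ![3, 4] x + eW ![5, 6] x

/-- `ρ = μ·e^{4567} + e^{23}∧β₁ + e^{13}∧β₂ + e^{12}∧β₃`. -/
noncomputable def rho (μ : ℝ) (β₁ β₂ β₃ : (Fin 2 → V) → ℝ) : (Fin 4 → V) → ℝ :=
  fun x => μ * eW ![3, 4, 5, 6] x + wedge (eW ![1, 2]) β₁ x
    + wedge (eW ![0, 2]) β₂ x + wedge (eW ![0, 1]) β₃ x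

/-- The wedge of two basis forms is the basis form of the concatenated index. -/
theorem wedge_eW {k l : ℕ} (p : Fin k → Fin 7) (q : Fin l → Fin 7) :
    wedge (eW p) (eW q) = eW (Fin.append p q) := by
  funext x
  have key : ∀ (τ₁ : Equiv.Perm (Fin k)) (τ₂ : Equiv.Perm (Fin l)),
      ∑ σ : Equiv.Perm (Fin (k + l)), ((Equiv.Perm.sign σ : ℤ) : ℝ) *
        ((((Equiv.Perm.sign τ₁ : ℤ) : ℝ) * ∏ i, x (σ (Fin.castAdd l (τ₁ i))) (p i)) *
          (((Equiv.Perm.sign τ₂ : ℤ) : ℝ) * ∏ j, x (σ (Fin.natAdd k (τ₂ j))) (q j))) =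
        eW (Fin.append p q) x := by
    intro τ₁ τ₂
    let τ : Equiv.Perm (Fin (k + l)) :=
      finSumFinEquiv.permCongr (Equiv.Perm.sumCongr τ₁ τ₂)
    have hτ : Equiv.Perm.sign τ = Equiv.Perm.sign τ₁ * Equiv.Perm.sign τ₂ := by
      simp [τ, Equiv.Perm.sign_permCongr, Equiv.Perm.sign_sumCongr]
    rw [eW, Matrix.det_apply']
    refine Eq.trans ?_ (Equiv.sum_comp (Equiv.mulRight τ) _)
    refine Finset.sum_congr rfl fun σ _ => ?_
    simp only [Equiv.coe_mulRight, Equiv.Perm.sign_mul, hτ, Fin.prod_univ_add,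
      Matrix.of_apply, Fin.append_left, Fin.append_right, Equiv.Perm.mul_apply]
    simp [τ, Equiv.permCongr_apply]
    ring
  have hsum : ∑ σ : Equiv.Perm (Fin (k + l)), ((Equiv.Perm.sign σ : ℤ) : ℝ) *
        (eW p fun i => x (σ (Fin.castAdd l i))) * (eW q fun j => x (σ (Fin.natAdd k j))) =
      ((Nat.factorial k * Nat.factorial l : ℕ) : ℝ) * eW (Fin.append p q) x := by
    calc _ = ∑ σ : Equiv.Perm (Fin (k + l)), ∑ τ₁ : Equiv.Perm (Fin k),
          ∑ τ₂ : Equiv.Perm (Fin l), ((Equiv.Perm.sign σ : ℤ) : ℝ) *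
          ((((Equiv.Perm.sign τ₁ : ℤ) : ℝ) * ∏ i, x (σ (Fin.castAdd l (τ₁ i))) (p i)) *
          (((Equiv.Perm.sign τ₂ : ℤ) : ℝ) * ∏ j, x (σ (Fin.natAdd k (τ₂ j))) (q j))) := by
          refine Finset.sum_congr rfl fun σ _ => ?_
          simp only [eW, Matrix.det_apply', Matrix.of_apply]
          rw [mul_assoc, Finset.sum_mul_sum, Finset.mul_sum]
          simp only [Finset.mul_sum]
      _ = ∑ τ₁ : Equiv.Perm (Fin k), ∑ τ₂ : Equiv.Perm (Fin l), eW (Fin.append p q) x := by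
          rw [Finset.sum_comm]
          refine Finset.sum_congr rfl fun τ₁ _ => ?_
          rw [Finset.sum_comm]
          exact Finset.sum_congr rfl fun τ₂ _ => key τ₁ τ₂
      _ = _ := by
          simp [Fintype.card_perm, mul_assoc]
  rw [wedge, hsum, inv_mul_cancel_left₀]
  positivity

theorem wedge_add {k l : ℕ} (α : (Fin k → V) → ℝ) (β γ : (Fin l → V) → ℝ) :
    wedge α (β + γ) = wedge α β + wedge α γ := by
  funext x
  simp only [wedge, Pi.add_apply, mul_add, Finset.sum_add_distrib]

theorem wedge_smul {k l : ℕ} (α : (Fin k → V) → ℝ) (c : ℝ) (β : (Fin l → V) → ℝ) :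
    wedge α (c • β) = c • wedge α β := by
  funext x
  simp only [wedge, Pi.smul_apply, smul_eq_mul, Finset.mul_sum]
  exact Finset.sum_congr rfl fun σ _ => by ring

theorem wedge_sub {k l : ℕ} (α : (Fin k → V) → ℝ) (β γ : (Fin l → V) → ℝ) :
    wedge α (β - γ) = wedge α β - wedge α γ := by
  rw [sub_eq_add_neg, ← neg_one_smul ℝ γ, wedge_add, wedge_smul, neg_one_smul, sub_eq_add_neg]

theorem omega0_eq : omega0 = eW ![3, 6] - eW ![4, 5] := rfl

theorem omega1_eq : omega1 = eW ![3, 6] + eW ![4, 5] := rfl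

theorem omega2_eq : omega2 = eW ![3, 5] - eW ![4, 6] := rfl

theorem omega3_eq : omega3 = eW ![3, 4] + eW ![5, 6] := rfl

theorem wedge_eW_two_two (a b c d : Fin 7) :
    wedge (eW ![a, b]) (eW ![c, d]) = eW ![a, b, c, d] := by
  rw [wedge_eW]
  congr 1
  funext i
  fin_cases i <;> rfl

theorem wedge_eW_one_four (a b c d e : Fin 7) :
    wedge (eW ![a]) (eW ![b, c, d, e]) = eW ![a, b, c, d, e] := by
  rw [wedge_eW]
  congr 1
  funext i
  fin_cases i <;> rfl

theorem rho_eq (μ : ℝ) (β₁ β₂ β₃ : (Fin 2 → V) → ℝ) :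
    rho μ β₁ β₂ β₃ = μ • eW ![3, 4, 5, 6] + wedge (eW ![1, 2]) β₁
      + wedge (eW ![0, 2]) β₂ + wedge (eW ![0, 1]) β₃ := rfl

theorem Φ_eq (v : V) : Φ v =
    !![v 0 * I, -v 1 - v 2 * I, v 3 + v 6 * I;
       v 1 - v 2 * I, -v 0 * I, -v 5 - v 4 * I;
       -v 3 + v 6 * I, v 5 - v 4 * I, 0] := by
  ext i j
  fin_cases i <;> fin_cases j <;> simp [Φ, E, Fin.sum_univ_succ, Matrix.sum_apply] <;> ring

/-- The structure constants of the projected bracket. -/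
theorem bracket_eq {x y z : V} {h : ℝ} (hz : Φ x * Φ y - Φ y * Φ x = Φ z + h • E8) :
    z = ![2 * (x 1 * y 2 - x 2 * y 1) + (x 3 * y 6 - x 6 * y 3) + (x 4 * y 5 - x 5 * y 4),
      -2 * (x 0 * y 2 - x 2 * y 0) - (x 3 * y 5 - x 5 * y 3) + (x 4 * y 6 - x 6 * y 4),
      2 * (x 0 * y 1 - x 1 * y 0) + (x 3 * y 4 - x 4 * y 3) + (x 5 * y 6 - x 6 * y 5),
      -(x 0 * y 6 - x 6 * y 0) + (x 1 * y 5 - x 5 * y 1) - (x 2 * y 4 - x 4 * y 2),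
      -(x 0 * y 5 - x 5 * y 0) - (x 1 * y 6 - x 6 * y 1) + (x 2 * y 3 - x 3 * y 2),
      (x 0 * y 4 - x 4 * y 0) - (x 1 * y 3 - x 3 * y 1) - (x 2 * y 6 - x 6 * y 2),
      (x 0 * y 3 - x 3 * y 0) + (x 1 * y 4 - x 4 * y 1) + (x 2 * y 5 - x 5 * y 2)] := by
  rw [Φ_eq, Φ_eq, Φ_eq] at hz
  have h00 := congrArg Complex.im (congrFun₂ hz 0 0)
  have h11 := congrArg Complex.im (congrFun₂ hz 1 1)
  have h10 := congrFun₂ hz 1 0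
  have h02 := congrFun₂ hz 0 2
  have h12 := congrFun₂ hz 1 2
  have r10 := congrArg Complex.re h10
  have i10 := congrArg Complex.im h10
  have r02 := congrArg Complex.re h02
  have i02 := congrArg Complex.im h02
  have r12 := congrArg Complex.re h12
  have i12 := congrArg Complex.im h12
  clear h10 h02 h12
  simp [E8] at h00 h11 r10 i10 r02 i02 r12 i12
  funext i
  fin_cases i <;> simp <;> linarith

theorem mem_span_quadruple {M : Type*} [AddCommGroup M] [Module ℝ M] {a b c d v : M}
    (hv : v ∈ Submodule.span ℝ ({a, b, c, d} : Set M)) :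
    ∃ s t u w : ℝ, v = s • a + t • b + u • c + w • d := by
  obtain ⟨s, z, hz, rfl⟩ := Submodule.mem_span_insert.1 hv
  obtain ⟨t, u, w, rfl⟩ := Submodule.mem_span_triple.1 hz
  exact ⟨s, t, u, w, by abel⟩

theorem eW_four (a b c d : Fin 7) (x y z w : V) :
    eW ![a, b, c, d] ![x, y, z, w] =
      x a * (y b * (z c * w d - z d * w c) - y c * (z b * w d - z d * w b)
        + y d * (z b * w c - z c * w b))
      - x b * (y a * (z c * w d - z d * w c) - y c * (z a * w d - z d * w a)
        + y d * (z a * w c - z c * w a))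
      + x c * (y a * (z b * w d - z d * w b) - y b * (z a * w d - z d * w a)
        + y d * (z a * w b - z b * w a))
      - x d * (y a * (z b * w c - z c * w b) - y b * (z a * w c - z c * w a)
        + y c * (z a * w b - z b * w a)) := by
  simp [eW, Matrix.det_succ_row_zero, Fin.sum_univ_succ, Fin.succAbove]
  ring

/-- Expansion of a decomposable 5-form along its first column. -/
theorem eW_five (a b c d e : Fin 7) (x : Fin 5 → V) :
    eW ![a, b, c, d, e] x =
      x 0 a * eW ![b, c, d, e] ![x 1, x 2, x 3, x 4]
      - x 1 a * eW ![b, c, d, e] ![x 0, x 2, x 3, x 4]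
      + x 2 a * eW ![b, c, d, e] ![x 0, x 1, x 3, x 4]
      - x 3 a * eW ![b, c, d, e] ![x 0, x 1, x 2, x 4]
      + x 4 a * eW ![b, c, d, e] ![x 0, x 1, x 2, x 3] := by
  have h (i : Fin 5) (y : Fin 4 → V) (hy : y = fun j => x (i.succAbove j)) :
      eW ![b, c, d, e] y = ((Matrix.of fun r s => x r (![a, b, c, d, e] s)).submatrix
        i.succAbove Fin.succ).det := by
    subst hy
    rfl
  rw [h 0 _ (by funext j; fin_cases j <;> rfl), h 1 _ (by funext j; fin_cases j <;> rfl),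
    h 2 _ (by funext j; fin_cases j <;> rfl), h 3 _ (by funext j; fin_cases j <;> rfl),
    h 4 _ (by funext j; fin_cases j <;> rfl), eW, Matrix.det_succ_column_zero,
    Fin.sum_univ_five]
  simp
  ring

/-- if `ρ = μ·e^{4567} + e^{23}∧β₁ + e^{13}∧β₂ + e^{12}∧β₃` with
`β₁, β₂, β₃ ∈ span(ω₀,ω₁,ω₂,ω₃)` satisfies `Dρ = λ·e¹∧ρ` with `λ ≠ 0`, then
`β₁ = −μ·ω₁` and `β₂, β₃ ∈ span(ω₀,ω₂,ω₃)`.  Here `D` is the projected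
Chevalley–Eilenberg differential of the reductive splitting `𝔰𝔲(3) = 𝔪 ⊕ 𝔥`,
with projected bracket characterized by `[Φ(x), Φ(y)] = Φ(pb x y) + h₈(x,y)·e₈`. -/
theorem rho_integrable (μ lam : ℝ) (hlam : lam ≠ 0) (β₁ β₂ β₃ : (Fin 2 → V) → ℝ)
    (hβ₁ : β₁ ∈ Submodule.span ℝ ({omega0, omega1, omega2, omega3} :
      Set ((Fin 2 → V) → ℝ)))
    (hβ₂ : β₂ ∈ Submodule.span ℝ ({omega0, omega1, omega2, omega3} :
      Set ((Fin 2 → V) → ℝ)))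
    (hβ₃ : β₃ ∈ Submodule.span ℝ ({omega0, omega1, omega2, omega3} :
      Set ((Fin 2 → V) → ℝ)))
    (pb : V → V → V) (h8 : V → V → ℝ)
    (hbr : ∀ x y : V, Φ x * Φ y - Φ y * Φ x = Φ (pb x y) + h8 x y • E8)
    (hint : D4 pb (rho μ β₁ β₂ β₃) = fun x => lam * wedge (eW ![0]) (rho μ β₁ β₂ β₃) x) :
    (β₁ = fun x => -(μ * omega1 x)) ∧
      β₂ ∈ Submodule.span ℝ ({omega0, omega2, omega3} : Set ((Fin 2 → V) → ℝ)) ∧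
      β₃ ∈ Submodule.span ℝ ({omega0, omega2, omega3} : Set ((Fin 2 → V) → ℝ)) := by
  obtain ⟨a0, a1, a2, a3, rfl⟩ := mem_span_quadruple hβ₁
  obtain ⟨b0, b1, b2, b3, rfl⟩ := mem_span_quadruple hβ₂
  obtain ⟨c0, c1, c2, c3, rfl⟩ := mem_span_quadruple hβ₃
  have hpb := fun x y => bracket_eq (hbr x y)
  have hev := fun t : Fin 5 → Fin 7 => congrFun hint fun i => Pi.single (t i) 1
  simp only [rho_eq, omega0_eq, omega1_eq, omega2_eq, omega3_eq, wedge_add, wedge_sub,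
    wedge_smul, wedge_eW_two_two, wedge_eW_one_four, D4, Pi.add_apply, Pi.sub_apply,
    Pi.smul_apply, smul_eq_mul, eW_five] at hev
  have h01234 := hev ![0, 1, 2, 3, 4]
  have h01235 := hev ![0, 1, 2, 3, 5]
  have h01236 := hev ![0, 1, 2, 3, 6]
  have h01245 := hev ![0, 1, 2, 4, 5]
  have h03456 := hev ![0, 3, 4, 5, 6]
  have h13456 := hev ![1, 3, 4, 5, 6]
  have h23456 := hev ![2, 3, 4, 5, 6]
  clear hev
  simp [hpb, eW_four] at h01234 h01235 h01236 h01245 h03456 h13456 h23456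
  clear hint hbr hpb
  have ha3 : a3 = 0 := mul_left_cancel₀ hlam (by linarith)
  have ha2 : a2 = 0 := mul_left_cancel₀ hlam (by linarith)
  have ha0 : a0 = 0 := mul_left_cancel₀ hlam (by linarith)
  have ha1 : a1 = -μ := mul_left_cancel₀ hlam (by linarith)
  have hb1 : b1 = 0 := by linarith
  have hc1 : c1 = 0 := by linarith
  subst ha0 ha1 ha2 ha3 hb1 hc1
  refine ⟨?_, Submodule.mem_span_triple.2 ⟨b0, b2, b3, by simp⟩,
    Submodule.mem_span_triple.2 ⟨c0, c2, c3, by simp⟩⟩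
  funext x
  simp

end Stmt4
end

section
/- Let ω₁ = e^{47} + e^{56}, and let γ₂, γ₃ be any elements of span(e^{47}−e^{56}, e^{46}−e^{57}, e^{45}+e^{67}). For μ ∈ ℝ set ρ̂ = μ·(e^{123} − e¹∧ω₁) + e²∧γ₂ + e³∧γ₃, an alternating 3-form on ℝ⁷. Then (ι_{e₁}ρ̂)∧(ι_{e₁}ρ̂)∧ρ̂ = 6μ³·e^{1234567}, (ι_{e₁}ρ̂)∧(ι_{e₂}ρ̂)∧ρ̂ = 0, and (ι_{e₁}ρ̂)∧(ι_{e₃}ρ̂)∧ρ̂ = 0. (This establishes that for the 4-forms ρ with Dρ = λe¹∧ρ on N^{1,1} and on S⁷ = Sp(2)/Sp(1), the associated bilinear map B_ρ satisfies B_ρ(e¹,e¹) = μ³Ω⊗Ω and B_ρ(e¹,eᵏ) = 0 for k = 2,3.) -/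
open scoped BigOperators

namespace Stmt5

/-- Vectors in ℝ⁷. -/
abbrev V : Type := Fin 7 → ℝ

/-- The basis wedge `e^{idx 0} ∧ ⋯ ∧ e^{idx (k-1)}` (determinant convention). -/
def eW {k : ℕ} (idx : Fin k → Fin 7) : (Fin k → V) → ℝ :=
  fun x => Matrix.det (Matrix.of fun a b => x a (idx b))

/-- The wedge product of a `k`-form and an `l`-form. -/
noncomputable def wedge {k l : ℕ} (α : (Fin k → V) → ℝ) (β : (Fin l → V) → ℝ) :
    (Fin (k + l) → V) → ℝ :=
  fun x => ((Nat.factorial k * Nat.factorial l : ℕ) : ℝ)⁻¹ *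
    ∑ σ : Equiv.Perm (Fin (k + l)),
      ((Equiv.Perm.sign σ : ℤ) : ℝ) *
        (α fun i => x (σ (Fin.castAdd l i))) * (β fun j => x (σ (Fin.natAdd k j)))

/-- Interior product: insert the vector `v` into the first argument. -/
def iota {k : ℕ} (v : V) (α : (Fin (k + 1) → V) → ℝ) : (Fin k → V) → ℝ :=
  fun x => α (Fin.cons v x)


/-- `ω₁ = e^{47} + e^{56}` (0-indexed). -/
def omega1 : (Fin 2 → V) → ℝ := fun x => eW ![3, 6] x + eW ![4, 5] x

/-- A generic element `p·(e^{47}−e^{56}) + q·(e^{46}−e^{57}) + r·(e^{45}+e^{67})`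
of the span of the three 2-forms appearing in the statement. -/
def spanElt (p q r : ℝ) : (Fin 2 → V) → ℝ :=
  fun x => p * (eW ![3, 6] x - eW ![4, 5] x) + q * (eW ![3, 5] x - eW ![4, 6] x)
    + r * (eW ![3, 4] x + eW ![5, 6] x)

/-- `ρ̂ = μ·(e^{123} − e¹∧ω₁) + e²∧γ₂ + e³∧γ₃`. -/
noncomputable def rhoHat (μ : ℝ) (γ₂ γ₃ : (Fin 2 → V) → ℝ) : (Fin 3 → V) → ℝ :=
  fun x => μ * (eW ![0, 1, 2] x - wedge (eW ![0]) omega1 x)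
    + wedge (eW ![1]) γ₂ x + wedge (eW ![2]) γ₃ x

/-- The standard basis vectors `e₁, e₂, e₃` of ℝ⁷ (0-indexed). -/
noncomputable def e (i : Fin 7) : V := Pi.single i 1

theorem wedge_add_left {k l : ℕ} (α α' : (Fin k → V) → ℝ) (β : (Fin l → V) → ℝ) :
    wedge (α + α') β = wedge α β + wedge α' β := by
  ext x
  simp only [wedge, Pi.add_apply, mul_add, add_mul, Finset.sum_add_distrib]

theorem wedge_add_right {k l : ℕ} (α : (Fin k → V) → ℝ) (β β' : (Fin l → V) → ℝ) :
    wedge α (β + β') = wedge α β + wedge α β' := by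
  ext x
  simp only [wedge, Pi.add_apply, mul_add, Finset.sum_add_distrib]

theorem wedge_smul_left {k l : ℕ} (c : ℝ) (α : (Fin k → V) → ℝ) (β : (Fin l → V) → ℝ) :
    wedge (c • α) β = c • wedge α β := by
  ext x
  simp only [wedge, Pi.smul_apply, smul_eq_mul, Finset.mul_sum]
  exact Finset.sum_congr rfl fun _ _ => by ring

theorem wedge_smul_right {k l : ℕ} (c : ℝ) (α : (Fin k → V) → ℝ) (β : (Fin l → V) → ℝ) :
    wedge α (c • β) = c • wedge α β := by
  ext x
  simp only [wedge, Pi.smul_apply, smul_eq_mul, Finset.mul_sum]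
  exact Finset.sum_congr rfl fun _ _ => by ring

/-- The wedge product of two basis wedges is the basis wedge of the concatenated indices. -/
theorem wedge_eW {k l : ℕ} (I : Fin k → Fin 7) (J : Fin l → Fin 7) :
    wedge (eW I) (eW J) = eW (Fin.append I J) := by
  ext x
  have block (τ : Equiv.Perm (Fin k)) (υ : Equiv.Perm (Fin l)) :
      ∑ σ : Equiv.Perm (Fin (k + l)), ((Equiv.Perm.sign σ : ℤ) : ℝ) *
        ((((Equiv.Perm.sign τ : ℤ) : ℝ) * ∏ i, x (σ (Fin.castAdd l (τ i))) (I i)) *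
          (((Equiv.Perm.sign υ : ℤ) : ℝ) * ∏ j, x (σ (Fin.natAdd k (υ j))) (J j))) =
      eW (Fin.append I J) x := by
    rw [eW, Matrix.det_apply']
    refine Fintype.sum_equiv
      (Equiv.mulRight (finSumFinEquiv.permCongr (Equiv.Perm.sumCongr τ υ))) _ _ fun σ => ?_
    simp only [Equiv.coe_mulRight, Equiv.Perm.sign_mul, Equiv.Perm.sign_permCongr,
      Equiv.Perm.sign_sumCongr, Fin.prod_univ_add, Matrix.of_apply, Fin.append_left,
      Fin.append_right, Equiv.Perm.mul_apply, Equiv.permCongr_apply,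
      finSumFinEquiv_symm_apply_castAdd, finSumFinEquiv_symm_apply_natAdd,
      Equiv.Perm.sumCongr_apply, Sum.map_inl, Sum.map_inr, finSumFinEquiv_apply_left,
      finSumFinEquiv_apply_right, Units.val_mul, Int.cast_mul]
    ring
  have expand : ∑ σ : Equiv.Perm (Fin (k + l)), ((Equiv.Perm.sign σ : ℤ) : ℝ) *
        (eW I fun i => x (σ (Fin.castAdd l i))) * (eW J fun j => x (σ (Fin.natAdd k j))) =
      ∑ _τ : Equiv.Perm (Fin k), ∑ _υ : Equiv.Perm (Fin l), eW (Fin.append I J) x := by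
    rw [Finset.sum_congr rfl fun τ _ => Finset.sum_congr rfl fun υ _ => (block τ υ).symm]
    simp only [eW, Matrix.det_apply', Matrix.of_apply, mul_assoc, Finset.sum_mul_sum]
    simp only [Finset.mul_sum]
    rw [Finset.sum_comm]
    exact Finset.sum_congr rfl fun _ _ => Finset.sum_comm
  rw [wedge, expand]
  simp only [Finset.sum_const, Finset.card_univ, Fintype.card_perm, Fintype.card_fin,
    nsmul_eq_mul, Nat.cast_mul]
  have hk : (k.factorial : ℝ) ≠ 0 := by positivity
  have hl : (l.factorial : ℝ) ≠ 0 := by positivity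
  field_simp

theorem eW_comp_perm {k : ℕ} (idx : Fin k → Fin 7) (σ : Equiv.Perm (Fin k)) :
    eW (idx ∘ σ) = ((Equiv.Perm.sign σ : ℤ) : ℝ) • eW idx := by
  ext x
  exact Matrix.det_permute' σ (Matrix.of fun a b => x a (idx b))

theorem eW_eq_zero {k : ℕ} {idx : Fin k → Fin 7} (h : ¬ Function.Injective idx) :
    eW idx = 0 := by
  obtain ⟨i, j, hij, hne⟩ := Function.not_injective_iff.1 h
  ext x
  exact Matrix.det_zero_of_column_eq hne fun a => by simp [hij]

/-- The sign of a sequence of numbers: the sign of the permutation sorting it, or zero if an entry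
is repeated. -/
def seqSign {k n : ℕ} (idx : Fin k → Fin n) : ℤ :=
  ∏ i, ∏ j ∈ Finset.Ioi i, (if idx i < idx j then 1 else if idx j < idx i then -1 else 0)

theorem eW_top (idx : Fin 7 → Fin 7) :
    eW idx = (seqSign idx : ℝ) • eW ![0, 1, 2, 3, 4, 5, 6] := by
  by_cases h : Function.Injective idx
  · have hid : (![0, 1, 2, 3, 4, 5, 6] : Fin 7 → Fin 7) = id := by decide
    let σ := Equiv.ofBijective idx (Finite.injective_iff_bijective.1 h)
    have hs : seqSign idx = Equiv.Perm.sign σ := by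
      rw [Equiv.Perm.sign_eq_prod_prod_Ioi, seqSign]
      push_cast
      refine Finset.prod_congr rfl fun i _ => Finset.prod_congr rfl fun j hj => ?_
      have hne : idx i ≠ idx j := fun hij => (Finset.mem_Ioi.1 hj).ne (h hij)
      simp only [σ, Equiv.ofBijective_apply]
      rcases lt_or_gt_of_ne hne with hlt | hlt <;> simp [hlt, hlt.not_gt]
    rw [hs, hid, ← eW_comp_perm]
    rfl
  · rw [eW_eq_zero h]
    obtain ⟨i, j, hij, hne⟩ := Function.not_injective_iff.1 h
    have : seqSign idx = 0 := by
      rcases lt_or_gt_of_ne hne with hlt | hlt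
      · exact Finset.prod_eq_zero (Finset.mem_univ i)
          (Finset.prod_eq_zero (Finset.mem_Ioi.2 hlt) (by simp [hij]))
      · exact Finset.prod_eq_zero (Finset.mem_univ j)
          (Finset.prod_eq_zero (Finset.mem_Ioi.2 hlt) (by simp [hij]))
    simp [this]

theorem iota_add {k : ℕ} (v : V) (α β : (Fin (k + 1) → V) → ℝ) :
    iota v (α + β) = iota v α + iota v β := rfl

theorem iota_smul {k : ℕ} (v : V) (c : ℝ) (α : (Fin (k + 1) → V) → ℝ) :
    iota v (c • α) = c • iota v α := rfl

theorem iota_neg {k : ℕ} (v : V) (α : (Fin (k + 1) → V) → ℝ) :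
    iota v (-α) = -iota v α := rfl

theorem iota_eW (v : V) (i j k : Fin 7) :
    iota v (eW ![i, j, k]) = v i • eW ![j, k] + (-v j) • eW ![i, k] + v k • eW ![i, j] := by
  ext x
  have h1 : (Fin.cons v x : Fin 3 → V) 1 = x 0 := rfl
  have h2 : (Fin.cons v x : Fin 3 → V) 2 = x 1 := rfl
  simp [iota, eW, Matrix.det_fin_three, Matrix.det_fin_two, h1, h2]
  ring

theorem wedge_neg_left {k l : ℕ} (α : (Fin k → V) → ℝ) (β : (Fin l → V) → ℝ) :
    wedge (-α) β = -wedge α β := by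
  simpa using wedge_smul_left (-1) α β

theorem wedge_neg_right {k l : ℕ} (α : (Fin k → V) → ℝ) (β : (Fin l → V) → ℝ) :
    wedge α (-β) = -wedge α β := by
  simpa using wedge_smul_right (-1) α β

theorem wedge_eW_one_two (i j k : Fin 7) :
    wedge (eW ![i]) (eW ![j, k]) = (eW ![i, j, k] : (Fin 3 → V) → ℝ) := by
  refine (wedge_eW _ _).trans (congrArg eW ?_)
  ext a; fin_cases a <;> rfl

theorem wedge_eW_two_two (i j k l : Fin 7) :
    wedge (eW ![i, j]) (eW ![k, l]) = eW (k := 2 + 2) ![i, j, k, l] := by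
  refine (wedge_eW _ _).trans (congrArg eW ?_)
  ext a; fin_cases a <;> rfl

theorem wedge_eW_four_three (i j k l m n o : Fin 7) :
    wedge (eW (k := 2 + 2) ![i, j, k, l]) (eW ![m, n, o]) =
      eW (k := 2 + 2 + 3) ![i, j, k, l, m, n, o] := by
  refine (wedge_eW _ _).trans (congrArg eW ?_)
  ext a; fin_cases a <;> rfl

theorem rhoHat_eq (μ p₂ q₂ r₂ p₃ q₃ r₃ : ℝ) :
    rhoHat μ (spanElt p₂ q₂ r₂) (spanElt p₃ q₃ r₃) =
      μ • (eW ![0, 1, 2] + -(eW ![0, 3, 6] + eW ![0, 4, 5])) +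
        (p₂ • (eW ![1, 3, 6] + -eW ![1, 4, 5]) + q₂ • (eW ![1, 3, 5] + -eW ![1, 4, 6]) +
          r₂ • (eW ![1, 3, 4] + eW ![1, 5, 6])) +
        (p₃ • (eW ![2, 3, 6] + -eW ![2, 4, 5]) + q₃ • (eW ![2, 3, 5] + -eW ![2, 4, 6]) +
          r₃ • (eW ![2, 3, 4] + eW ![2, 5, 6])) := by
  have hω : omega1 = eW ![3, 6] + eW ![4, 5] := rfl
  have hγ (p q r : ℝ) : spanElt p q r = p • (eW ![3, 6] + -eW ![4, 5]) +
      q • (eW ![3, 5] + -eW ![4, 6]) + r • (eW ![3, 4] + eW ![5, 6]) := by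
    ext x
    simp only [spanElt, Pi.add_apply, Pi.smul_apply, Pi.neg_apply, smul_eq_mul, sub_eq_add_neg]
  have hρ (γ₂ γ₃ : (Fin 2 → V) → ℝ) : rhoHat μ γ₂ γ₃ =
      μ • (eW ![0, 1, 2] + -wedge (eW ![0]) omega1) + wedge (eW ![1]) γ₂ + wedge (eW ![2]) γ₃ := by
    ext x
    simp only [rhoHat, Pi.add_apply, Pi.smul_apply, Pi.neg_apply, smul_eq_mul, sub_eq_add_neg]
  rw [hρ, hω, hγ, hγ]
  simp only [wedge_add_right, wedge_smul_right, wedge_neg_right, ← wedge_eW_one_two]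

theorem iota_zero_rhoHat (μ p₂ q₂ r₂ p₃ q₃ r₃ : ℝ) :
    iota (e 0) (rhoHat μ (spanElt p₂ q₂ r₂) (spanElt p₃ q₃ r₃)) =
      μ • (eW ![1, 2] + -(eW ![3, 6] + eW ![4, 5])) := by
  simp [rhoHat_eq, iota_add, iota_smul, iota_neg, iota_eW, e]

theorem iota_one_rhoHat (μ p₂ q₂ r₂ p₃ q₃ r₃ : ℝ) :
    iota (e 1) (rhoHat μ (spanElt p₂ q₂ r₂) (spanElt p₃ q₃ r₃)) =
      -(μ • eW ![0, 2]) + (p₂ • (eW ![3, 6] + -eW ![4, 5]) + q₂ • (eW ![3, 5] + -eW ![4, 6]) +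
          r₂ • (eW ![3, 4] + eW ![5, 6])) := by
  simp [rhoHat_eq, iota_add, iota_smul, iota_neg, iota_eW, e]

theorem iota_two_rhoHat (μ p₂ q₂ r₂ p₃ q₃ r₃ : ℝ) :
    iota (e 2) (rhoHat μ (spanElt p₂ q₂ r₂) (spanElt p₃ q₃ r₃)) =
      μ • eW ![0, 1] + (p₃ • (eW ![3, 6] + -eW ![4, 5]) + q₃ • (eW ![3, 5] + -eW ![4, 6]) +
          r₃ • (eW ![3, 4] + eW ![5, 6])) := by
  simp [rhoHat_eq, iota_add, iota_smul, iota_neg, iota_eW, e]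

theorem wedge_wedge_eW (i j k l m n o : Fin 7) :
    wedge (wedge (eW ![i, j]) (eW ![k, l])) (eW ![m, n, o]) =
      eW (k := 2 + 2 + 3) ![i, j, k, l, m, n, o] := by
  rw [wedge_eW_two_two, wedge_eW_four_three]

theorem wedge_wedge_eW_eq_zero {i j k l m n o : Fin 7} (h : ¬ [i, j, k, l, m, n, o].Nodup) :
    wedge (wedge (eW ![i, j]) (eW ![k, l])) (eW ![m, n, o]) = 0 := by
  rw [wedge_wedge_eW]
  refine eW_eq_zero (k := 7) fun hinj => h ?_
  simpa using List.nodup_ofFn.2 hinj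

theorem wedge_wedge_eW_of_even {i j k l m n o : Fin 7}
    (h : seqSign ![i, j, k, l, m, n, o] = 1) :
    wedge (wedge (eW ![i, j]) (eW ![k, l])) (eW ![m, n, o]) =
      eW (k := 2 + 2 + 3) ![0, 1, 2, 3, 4, 5, 6] := by
  rw [wedge_wedge_eW]
  exact (eW_top _).trans (by simp [h])

theorem wedge_wedge_eW_of_odd {i j k l m n o : Fin 7}
    (h : seqSign ![i, j, k, l, m, n, o] = -1) :
    wedge (wedge (eW ![i, j]) (eW ![k, l])) (eW ![m, n, o]) =
      -eW (k := 2 + 2 + 3) ![0, 1, 2, 3, 4, 5, 6] := by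
  rw [wedge_wedge_eW]
  exact (eW_top _).trans (by simp [h])

/-- for `ρ̂ = μ·(e^{123} − e¹∧ω₁) + e²∧γ₂ + e³∧γ₃` with
`γ₂, γ₃ ∈ span(e^{47}−e^{56}, e^{46}−e^{57}, e^{45}+e^{67})` one has
`(ι_{e₁}ρ̂)∧(ι_{e₁}ρ̂)∧ρ̂ = 6μ³·e^{1234567}` and
`(ι_{e₁}ρ̂)∧(ι_{e₂}ρ̂)∧ρ̂ = 0 = (ι_{e₁}ρ̂)∧(ι_{e₃}ρ̂)∧ρ̂`. -/
theorem rhoHat_wedges (μ : ℝ) (p₂ q₂ r₂ p₃ q₃ r₃ : ℝ)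
    (γ₂ γ₃ : (Fin 2 → V) → ℝ)
    (hγ₂ : γ₂ = spanElt p₂ q₂ r₂) (hγ₃ : γ₃ = spanElt p₃ q₃ r₃) :
    (wedge (wedge (iota (e 0) (rhoHat μ γ₂ γ₃)) (iota (e 0) (rhoHat μ γ₂ γ₃)))
        (rhoHat μ γ₂ γ₃)
      = fun x => 6 * μ ^ 3 * eW ![0, 1, 2, 3, 4, 5, 6] x) ∧
    (wedge (wedge (iota (e 0) (rhoHat μ γ₂ γ₃)) (iota (e 1) (rhoHat μ γ₂ γ₃)))
        (rhoHat μ γ₂ γ₃) = 0) ∧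
    (wedge (wedge (iota (e 0) (rhoHat μ γ₂ γ₃)) (iota (e 2) (rhoHat μ γ₂ γ₃)))
        (rhoHat μ γ₂ γ₃) = 0) := by
  subst hγ₂ hγ₃
  have hvol : (fun x => 6 * μ ^ 3 * eW ![0, 1, 2, 3, 4, 5, 6] x) =
      (6 * μ ^ 3) • eW (k := 2 + 2 + 3) ![0, 1, 2, 3, 4, 5, 6] := rfl
  rw [hvol, iota_zero_rhoHat, iota_one_rhoHat, iota_two_rhoHat, rhoHat_eq]
  simp only [wedge_add_left, wedge_add_right, wedge_smul_left, wedge_smul_right, wedge_neg_left,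
    wedge_neg_right]
  simp (disch := decide) only [wedge_wedge_eW_eq_zero]
  simp only [smul_zero, neg_zero, add_zero, zero_add]
  simp (disch := decide) only [wedge_wedge_eW_of_even, wedge_wedge_eW_of_odd]
  refine ⟨?_, ?_, ?_⟩ <;> module

end Stmt5
end

section
/- Let 𝔤₁ be the 7-dimensional real Lie algebra with basis (e₁,…,e₇) whose only nonzero Lie brackets among basis vectors are ⁅e₄,e₅⁆ = −e₆, ⁅e₅,e₆⁆ = −e₄, ⁅e₆,e₄⁆ = −e₅ (so 𝔤₁ ≅ ℝ³ ⊕ 𝔰𝔲(2) ⊕ ℝ and the dual basis satisfies de⁴ = e^{56}, de⁵ = −e^{46}, de⁶ = e^{45}, deⁱ = 0 for i ∈ {1,2,3,7}). Let φ₀ = e^{123} + e¹∧(e^{45}+e^{67}) + e²∧(e^{46}−e^{57}) − e³∧(e^{47}+e^{56}) and ψ₀ = e^{4567} + e^{23}∧(e^{45}+e^{67}) − e^{13}∧(e^{46}−e^{57}) − e^{12}∧(e^{47}+e^{56}). Then: (i) dψ₀ = e⁷∧ψ₀; (ii) dφ₀∧φ₀ = 0; (iii) d(e^{456}) = 0.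 (These are the defining identities showing that φ₀ is a left-invariant strong G₂T-structure on SU(2)×U(1)⁴ with Lee form e⁷ and torsion 3-form e^{456}, solving the twisted G₂ equation.) -/
open scoped BigOperators

namespace Stmt9

/-- The underlying vector space of the Lie algebra `𝔤₁ ≅ ℝ³ ⊕ 𝔰𝔲(2) ⊕ ℝ`,
in the coordinates of the basis `(e₁,…,e₇)`. -/
abbrev V : Type := Fin 7 → ℝ

/-- The Lie bracket of `𝔤₁`: the bilinear extension of
`⁅e₄,e₅⁆ = −e₆, ⁅e₅,e₆⁆ = −e₄, ⁅e₆,e₄⁆ = −e₅` (all other brackets of basis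
vectors zero), written 0-indexed. -/
def br (x y : V) : V :=
  ![0, 0, 0,
    -(x 4 * y 5 - x 5 * y 4),
    -(x 5 * y 3 - x 3 * y 5),
    -(x 3 * y 4 - x 4 * y 3),
    0]

/-- The basis wedge `e^{idx 0} ∧ ⋯ ∧ e^{idx (k-1)}` of the dual basis
(determinant convention). -/
def eW {k : ℕ} (idx : Fin k → Fin 7) : (Fin k → V) → ℝ :=
  fun x => Matrix.det (Matrix.of fun a b => x a (idx b))

/-- The wedge product of a `k`-form and an `l`-form. -/
noncomputable def wedge {k l : ℕ} (α : (Fin k → V) → ℝ) (β : (Fin l → V) → ℝ) :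
    (Fin (k + l) → V) → ℝ :=
  fun x => ((Nat.factorial k * Nat.factorial l : ℕ) : ℝ)⁻¹ *
    ∑ σ : Equiv.Perm (Fin (k + l)),
      ((Equiv.Perm.sign σ : ℤ) : ℝ) *
        (α fun i => x (σ (Fin.castAdd l i))) * (β fun j => x (σ (Fin.natAdd k j)))

/-- The Chevalley–Eilenberg differential of a 3-form. -/
def d3 (α : (Fin 3 → V) → ℝ) : (Fin 4 → V) → ℝ :=
  fun x =>
    -α ![br (x 0) (x 1), x 2, x 3] + α ![br (x 0) (x 2), x 1, x 3]
      - α ![br (x 0) (x 3), x 1, x 2] - α ![br (x 1) (x 2), x 0, x 3]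
      + α ![br (x 1) (x 3), x 0, x 2] - α ![br (x 2) (x 3), x 0, x 1]

/-- The Chevalley–Eilenberg differential of a 4-form. -/
def d4 (α : (Fin 4 → V) → ℝ) : (Fin 5 → V) → ℝ :=
  fun x =>
    -α ![br (x 0) (x 1), x 2, x 3, x 4] + α ![br (x 0) (x 2), x 1, x 3, x 4]
      - α ![br (x 0) (x 3), x 1, x 2, x 4] + α ![br (x 0) (x 4), x 1, x 2, x 3]
      - α ![br (x 1) (x 2), x 0, x 3, x 4] + α ![br (x 1) (x 3), x 0, x 2, x 4]
      - α ![br (x 1) (x 4), x 0, x 2, x 3] - α ![br (x 2) (x 3), x 0, x 1, x 4]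
      + α ![br (x 2) (x 4), x 0, x 1, x 3] - α ![br (x 3) (x 4), x 0, x 1, x 2]

/-- `φ₀ = e^{123} + e¹∧(e^{45}+e^{67}) + e²∧(e^{46}−e^{57}) − e³∧(e^{47}+e^{56})`
(0-indexed). -/
noncomputable def phi0 : (Fin 3 → V) → ℝ :=
  fun x => eW ![0, 1, 2] x
    + wedge (eW ![0]) (fun y => eW ![3, 4] y + eW ![5, 6] y) x
    + wedge (eW ![1]) (fun y => eW ![3, 5] y - eW ![4, 6] y) x
    - wedge (eW ![2]) (fun y => eW ![3, 6] y + eW ![4, 5] y) x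

/-- `ψ₀ = e^{4567} + e^{23}∧(e^{45}+e^{67}) − e^{13}∧(e^{46}−e^{57}) − e^{12}∧(e^{47}+e^{56})`
(0-indexed). -/
noncomputable def psi0 : (Fin 4 → V) → ℝ :=
  fun x => eW ![3, 4, 5, 6] x
    + wedge (eW ![1, 2]) (fun y => eW ![3, 4] y + eW ![5, 6] y) x
    - wedge (eW ![0, 2]) (fun y => eW ![3, 5] y - eW ![4, 6] y) x
    - wedge (eW ![0, 1]) (fun y => eW ![3, 6] y + eW ![4, 5] y) x

section Wedge

variable {k l : ℕ}

lemma wedge_add_left (α α' : (Fin k → V) → ℝ) (β : (Fin l → V) → ℝ) :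
    wedge (α + α') β = wedge α β + wedge α' β := by
  funext x
  simp only [wedge, Pi.add_apply, mul_add, add_mul, Finset.sum_add_distrib]

lemma wedge_add_right (α : (Fin k → V) → ℝ) (β β' : (Fin l → V) → ℝ) :
    wedge α (β + β') = wedge α β + wedge α β' := by
  funext x
  simp only [wedge, Pi.add_apply, mul_add, Finset.sum_add_distrib]

lemma wedge_neg_left (α : (Fin k → V) → ℝ) (β : (Fin l → V) → ℝ) :
    wedge (-α) β = -wedge α β := by
  funext x
  simp only [wedge, Pi.neg_apply, mul_neg, neg_mul, Finset.sum_neg_distrib]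

lemma wedge_neg_right (α : (Fin k → V) → ℝ) (β : (Fin l → V) → ℝ) :
    wedge α (-β) = -wedge α β := by
  funext x
  simp only [wedge, Pi.neg_apply, mul_neg, Finset.sum_neg_distrib]

lemma wedge_sub_left (α α' : (Fin k → V) → ℝ) (β : (Fin l → V) → ℝ) :
    wedge (α - α') β = wedge α β - wedge α' β := by
  rw [sub_eq_add_neg, wedge_add_left, wedge_neg_left, sub_eq_add_neg]

lemma wedge_sub_right (α : (Fin k → V) → ℝ) (β β' : (Fin l → V) → ℝ) :
    wedge α (β - β') = wedge α β - wedge α β' := by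
  rw [sub_eq_add_neg, wedge_add_right, wedge_neg_right, sub_eq_add_neg]

/-- Reindexing the alternating sum by a block permutation. -/
lemma sum_sign_mul_prod_block (I : Fin k → Fin 7) (J : Fin l → Fin 7) (x : Fin (k + l) → V)
    (τ : Equiv.Perm (Fin k)) (ρ : Equiv.Perm (Fin l)) :
    ∑ σ : Equiv.Perm (Fin (k + l)), ((Equiv.Perm.sign σ : ℤ) : ℝ) *
        ((((Equiv.Perm.sign τ : ℤ) : ℝ) * ∏ i, x (σ (Fin.castAdd l (τ i))) (I i)) *
          (((Equiv.Perm.sign ρ : ℤ) : ℝ) * ∏ j, x (σ (Fin.natAdd k (ρ j))) (J j))) =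
      eW (Fin.append I J) x := by
  rw [eW, Matrix.det_apply']
  refine Fintype.sum_equiv
    (Equiv.mulRight (finSumFinEquiv.permCongr (Equiv.Perm.sumCongr τ ρ))) _ _ fun σ => ?_
  simp only [Equiv.coe_mulRight, Equiv.Perm.sign_mul, Equiv.Perm.sign_permCongr,
    Equiv.Perm.sign_sumCongr, Fin.prod_univ_add, Matrix.of_apply, Equiv.Perm.mul_apply,
    Equiv.permCongr_apply, finSumFinEquiv_symm_apply_castAdd, finSumFinEquiv_symm_apply_natAdd,
    Equiv.Perm.sumCongr_apply, Sum.map_inl, Sum.map_inr, finSumFinEquiv_apply_left,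
    finSumFinEquiv_apply_right, Fin.append_left, Fin.append_right]
  push_cast
  ring

lemma wedge_eW (I : Fin k → Fin 7) (J : Fin l → Fin 7) :
    wedge (eW I) (eW J) = eW (Fin.append I J) := by
  funext x
  have h : ∑ σ : Equiv.Perm (Fin (k + l)), ((Equiv.Perm.sign σ : ℤ) : ℝ) *
        (eW I fun i => x (σ (Fin.castAdd l i))) * (eW J fun j => x (σ (Fin.natAdd k j))) =
      ∑ _τ : Equiv.Perm (Fin k), ∑ _ρ : Equiv.Perm (Fin l), eW (Fin.append I J) x := by
    refine Eq.trans ?_ (Finset.sum_congr rfl fun τ _ => Finset.sum_congr rfl fun ρ _ =>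
      sum_sign_mul_prod_block I J x τ ρ)
    simp_rw [eW, Matrix.det_apply', Matrix.of_apply, mul_assoc _ (∑ _, _) (∑ _, _),
      Finset.sum_mul_sum, Finset.mul_sum]
    rw [Finset.sum_comm]
    exact Finset.sum_congr rfl fun τ _ => Finset.sum_comm
  rw [wedge, h]
  simp only [Finset.sum_const, Finset.card_univ, Fintype.card_perm, Fintype.card_fin,
    nsmul_eq_mul, ← mul_assoc, Nat.cast_mul]
  field_simp

lemma eW_eq_zero {I : Fin k → Fin 7} (hI : ¬ Function.Injective I) : eW I = 0 := by
  obtain ⟨i, j, hij, hne⟩ := Function.not_injective_iff.mp hI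
  funext x
  exact Matrix.det_zero_of_column_eq hne fun a => by simp [hij]

end Wedge

section Differential

lemma d3_add (α β : (Fin 3 → V) → ℝ) : d3 (α + β) = d3 α + d3 β := by
  funext x
  simp only [d3, Pi.add_apply]
  ring

lemma d3_sub (α β : (Fin 3 → V) → ℝ) : d3 (α - β) = d3 α - d3 β := by
  funext x
  simp only [d3, Pi.sub_apply]
  ring

lemma d4_add (α β : (Fin 4 → V) → ℝ) : d4 (α + β) = d4 α + d4 β := by
  funext x
  simp only [d4, Pi.add_apply]
  ring

lemma d4_sub (α β : (Fin 4 → V) → ℝ) : d4 (α - β) = d4 α - d4 β := by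
  funext x
  simp only [d4, Pi.sub_apply]
  ring

/-- The covectors `de^a`, as antisymmetric bilinear functions. -/
lemma br_apply (x y : V) (a : Fin 7) :
    br x y a = ![0, 0, 0, x 5 * y 4 - x 4 * y 5, x 3 * y 5 - x 5 * y 3,
      x 4 * y 3 - x 3 * y 4, 0] a := by
  fin_cases a <;> simp [br]

lemma eW_three (a b c : Fin 7) (u v w : V) :
    eW ![a, b, c] ![u, v, w] =
      u a * (v b * w c - v c * w b) - u b * (v a * w c - v c * w a)
        + u c * (v a * w b - v b * w a) := by
  simp [eW, Matrix.det_fin_three]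
  ring

lemma eW_four (I : Fin 4 → Fin 7) (x : Fin 4 → V) :
    eW I x = x 0 (I 0) * eW ![I 1, I 2, I 3] ![x 1, x 2, x 3]
      - x 0 (I 1) * eW ![I 0, I 2, I 3] ![x 1, x 2, x 3]
      + x 0 (I 2) * eW ![I 0, I 1, I 3] ![x 1, x 2, x 3]
      - x 0 (I 3) * eW ![I 0, I 1, I 2] ![x 1, x 2, x 3] := by
  simp only [eW_three]
  simp [eW, Matrix.det_succ_row_zero, Fin.sum_univ_succ, Fin.succAbove]
  ring

lemma eW_five (I : Fin 5 → Fin 7) (x : Fin 5 → V) :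
    eW I x = x 0 (I 0) * eW ![I 1, I 2, I 3, I 4] ![x 1, x 2, x 3, x 4]
      - x 1 (I 0) * eW ![I 1, I 2, I 3, I 4] ![x 0, x 2, x 3, x 4]
      + x 2 (I 0) * eW ![I 1, I 2, I 3, I 4] ![x 0, x 1, x 3, x 4]
      - x 3 (I 0) * eW ![I 1, I 2, I 3, I 4] ![x 0, x 1, x 2, x 4]
      + x 4 (I 0) * eW ![I 1, I 2, I 3, I 4] ![x 0, x 1, x 2, x 3] := by
  have h : eW I x = ∑ i : Fin 5, (-1) ^ (i : ℕ) * x i (I 0) *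
      eW (fun b => I b.succ) (fun c => x (i.succAbove c)) := Matrix.det_succ_column_zero _
  have hI : (fun b : Fin 4 => I b.succ) = ![I 1, I 2, I 3, I 4] := by
    ext b; fin_cases b <;> rfl
  have e0 : (fun c => x ((0 : Fin 5).succAbove c)) = ![x 1, x 2, x 3, x 4] := by
    ext c; fin_cases c <;> rfl
  have e1 : (fun c => x ((1 : Fin 5).succAbove c)) = ![x 0, x 2, x 3, x 4] := by
    ext c; fin_cases c <;> rfl
  have e2 : (fun c => x ((2 : Fin 5).succAbove c)) = ![x 0, x 1, x 3, x 4] := by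
    ext c; fin_cases c <;> rfl
  have e3 : (fun c => x ((3 : Fin 5).succAbove c)) = ![x 0, x 1, x 2, x 4] := by
    ext c; fin_cases c <;> rfl
  have e4 : (fun c => x ((4 : Fin 5).succAbove c)) = ![x 0, x 1, x 2, x 3] := by
    ext c; fin_cases c <;> rfl
  rw [h, hI, Fin.sum_univ_five, e0, e1, e2, e3, e4]
  norm_num
  ring

lemma d3_eW_012 : d3 (eW ![0, 1, 2]) = 0 := by
  funext x
  simp [d3, eW_three, br_apply]

lemma d3_eW_034 : d3 (eW ![0, 3, 4]) = 0 := by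
  funext x
  simp [d3, eW_three, br_apply]
  ring

lemma d3_eW_056 : d3 (eW ![0, 5, 6]) = -eW ![0, 3, 4, 6] := by
  funext x
  simp [d3, eW_four, eW_three, br_apply]
  ring

lemma d3_eW_135 : d3 (eW ![1, 3, 5]) = 0 := by
  funext x
  simp [d3, eW_three, br_apply]
  ring

lemma d3_eW_146 : d3 (eW ![1, 4, 6]) = eW ![1, 3, 5, 6] := by
  funext x
  simp [d3, eW_four, eW_three, br_apply]
  ring

lemma d3_eW_236 : d3 (eW ![2, 3, 6]) = -eW ![2, 4, 5, 6] := by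
  funext x
  simp [d3, eW_four, eW_three, br_apply]
  ring

lemma d3_eW_245 : d3 (eW ![2, 4, 5]) = 0 := by
  funext x
  simp [d3, eW_three, br_apply]
  ring

lemma d3_eW_345 : d3 (eW ![3, 4, 5]) = 0 := by
  funext x
  simp [d3, eW_three, br_apply]
  ring

lemma d4_eW_3456 : d4 (eW ![3, 4, 5, 6]) = 0 := by
  funext x
  simp [d4, eW_four, eW_three, br_apply]
  ring

lemma d4_eW_1234 : d4 (eW ![1, 2, 3, 4]) = 0 := by
  funext x
  simp [d4, eW_four, eW_three, br_apply]
  ring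

lemma d4_eW_1256 : d4 (eW ![1, 2, 5, 6]) = eW ![6, 1, 2, 3, 4] := by
  funext x
  simp [d4, eW_five, eW_four, eW_three, br_apply]
  ring

lemma d4_eW_0235 : d4 (eW ![0, 2, 3, 5]) = 0 := by
  funext x
  simp [d4, eW_four, eW_three, br_apply]
  ring

lemma d4_eW_0246 : d4 (eW ![0, 2, 4, 6]) = -eW ![6, 0, 2, 3, 5] := by
  funext x
  simp [d4, eW_five, eW_four, eW_three, br_apply]
  ring

lemma d4_eW_0136 : d4 (eW ![0, 1, 3, 6]) = eW ![6, 0, 1, 4, 5] := by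
  funext x
  simp [d4, eW_five, eW_four, eW_three, br_apply]
  ring

lemma d4_eW_0145 : d4 (eW ![0, 1, 4, 5]) = 0 := by
  funext x
  simp [d4, eW_four, eW_three, br_apply]
  ring

end Differential

lemma phi0_eq : phi0 = eW ![0, 1, 2] + (eW ![0, 3, 4] + eW ![0, 5, 6])
    + (eW ![1, 3, 5] - eW ![1, 4, 6]) - (eW ![2, 3, 6] + eW ![2, 4, 5]) := by
  have h (a b c : Fin 7) : eW ![a, b, c] = wedge (eW ![a]) (eW ![b, c]) := by
    rw [wedge_eW]
    congr 1
    ext i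
    fin_cases i <;> rfl
  rw [h 0 3 4, h 0 5 6, h 1 3 5, h 1 4 6, h 2 3 6, h 2 4 5, ← wedge_add_right,
    ← wedge_sub_right, ← wedge_add_right]
  rfl

lemma psi0_eq : psi0 = eW ![3, 4, 5, 6] + (eW ![1, 2, 3, 4] + eW ![1, 2, 5, 6])
    - (eW ![0, 2, 3, 5] - eW ![0, 2, 4, 6]) - (eW ![0, 1, 3, 6] + eW ![0, 1, 4, 5]) := by
  have h (a b c d : Fin 7) : eW ![a, b, c, d] = wedge (eW ![a, b]) (eW ![c, d]) := by
    rw [wedge_eW]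
    congr 1
    ext i
    fin_cases i <;> rfl
  rw [h 1 2 3 4, h 1 2 5 6, h 0 2 3 5, h 0 2 4 6, h 0 1 3 6, h 0 1 4 5, ← wedge_add_right,
    ← wedge_sub_right, ← wedge_add_right]
  rfl

lemma d3_phi0 : d3 phi0 = -eW ![0, 3, 4, 6] - eW ![1, 3, 5, 6] + eW ![2, 4, 5, 6] := by
  rw [phi0_eq]
  simp only [d3_add, d3_sub, d3_eW_012, d3_eW_034, d3_eW_056, d3_eW_135, d3_eW_146, d3_eW_236,
    d3_eW_245]
  abel

lemma d4_psi0 : d4 psi0 = eW ![6, 1, 2, 3, 4] - eW ![6, 0, 2, 3, 5] - eW ![6, 0, 1, 4, 5] := by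
  rw [psi0_eq]
  simp only [d4_add, d4_sub, d4_eW_3456, d4_eW_1234, d4_eW_1256, d4_eW_0235, d4_eW_0246,
    d4_eW_0136, d4_eW_0145]
  abel

lemma wedge_psi0 : wedge (eW ![6]) psi0 =
    eW ![6, 1, 2, 3, 4] - eW ![6, 0, 2, 3, 5] - eW ![6, 0, 1, 4, 5] := by
  have h (a b c d : Fin 7) : wedge (eW ![6]) (eW ![a, b, c, d]) = eW ![6, a, b, c, d] := by
    rw [wedge_eW]
    congr 1
    ext i
    fin_cases i <;> rfl
  rw [psi0_eq]
  simp only [wedge_add_right, wedge_sub_right, h]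
  rw [eW_eq_zero (I := ![6, 3, 4, 5, 6]) (by decide),
    eW_eq_zero (I := ![6, 1, 2, 5, 6]) (by decide),
    eW_eq_zero (I := ![6, 0, 2, 4, 6]) (by decide),
    eW_eq_zero (I := ![6, 0, 1, 3, 6]) (by decide)]
  abel

lemma wedge_d3_phi0_phi0 : wedge (d3 phi0) phi0 = 0 := by
  have h (I : Fin 4 → Fin 7) (J : Fin 3 → Fin 7) (hIJ : ∃ i j, I i = J j) :
      wedge (eW I) (eW J) = 0 := by
    obtain ⟨i, j, hij⟩ := hIJ
    rw [wedge_eW]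
    refine eW_eq_zero fun hinj => ?_
    have := @hinj (Fin.castAdd 3 i) (Fin.natAdd 4 j) (by simpa using hij)
    simp [Fin.ext_iff] at this
    omega
  rw [d3_phi0, phi0_eq]
  simp (discharger := decide) only [wedge_add_left, wedge_add_right, wedge_sub_left,
    wedge_sub_right, wedge_neg_left, h, add_zero, sub_zero, neg_zero]

/-- on the Lie algebra `𝔤₁ ≅ ℝ³ ⊕ 𝔰𝔲(2) ⊕ ℝ` one has
`(i) dψ₀ = e⁷∧ψ₀`, `(ii) dφ₀∧φ₀ = 0`, `(iii) d(e^{456}) = 0`: the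
3-form `φ₀` defines a left-invariant strong G₂T-structure on `SU(2)×U(1)⁴` with
Lee form `e⁷` and closed torsion 3-form `e^{456}`, solving the twisted G₂ equation. -/
theorem strongG2T_su2_t4 :
    d4 psi0 = wedge (eW ![6]) psi0 ∧
    wedge (d3 phi0) phi0 = 0 ∧
    d3 (eW ![3, 4, 5]) = 0 := by
  exact ⟨d4_psi0.trans wedge_psi0.symm, wedge_d3_phi0_phi0, d3_eW_345⟩

end Stmt9
end

section
/- Let 𝔤₂ be the 7-dimensional real Lie algebra with basis (e₁,…,e₇) whose only nonzero Lie brackets among basis vectors are ⁅e₂,e₃⁆ = −e₁, ⁅e₃,e₁⁆ = −e₂, ⁅e₁,e₂⁆ = −e₃, ⁅e₅,e₆⁆ = −e₄, ⁅e₆,e₄⁆ = −e₅, ⁅e₄,e₅⁆ = −e₆ (so 𝔤₂ ≅ 𝔰𝔲(2) ⊕ 𝔰𝔲(2) ⊕ ℝ and the dual basis satisfies de¹ = e^{23}, de² = −e^{13}, de³ = e^{12}, de⁴ = e^{56}, de⁵ = −e^{46}, de⁶ = e^{45}, de⁷ = 0). Let ψ₀ = e^{4567} + e^{2345} + e^{2367}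 − e^{1346} + e^{1357} − e^{1247} − e^{1256}. Then: (i) dψ₀ = e⁷∧ψ₀; (ii) d(e^{123} + e^{456}) = 0. (These identities show that the corresponding left-invariant G₂-structure on SU(2)×SU(2)×U(1) is a strong G₂T-structure with closed Lee form e⁷ and closed torsion 3-form e^{123}+e^{456}.) -/
open scoped BigOperators

namespace Stmt10

/-- The underlying vector space of the Lie algebra `𝔤₂ ≅ 𝔰𝔲(2) ⊕ 𝔰𝔲(2) ⊕ ℝ`,
in the coordinates of the basis `(e₁,…,e₇)`. -/
abbrev V : Type := Fin 7 → ℝ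

/-- The Lie bracket of `𝔤₂`: the bilinear extension of
`⁅e₂,e₃⁆ = −e₁, ⁅e₃,e₁⁆ = −e₂, ⁅e₁,e₂⁆ = −e₃, ⁅e₅,e₆⁆ = −e₄, ⁅e₆,e₄⁆ = −e₅,
⁅e₄,e₅⁆ = −e₆` (all other brackets of basis vectors zero), written 0-indexed. -/
def br (x y : V) : V :=
  ![-(x 1 * y 2 - x 2 * y 1),
    -(x 2 * y 0 - x 0 * y 2),
    -(x 0 * y 1 - x 1 * y 0),
    -(x 4 * y 5 - x 5 * y 4),
    -(x 5 * y 3 - x 3 * y 5),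
    -(x 3 * y 4 - x 4 * y 3),
    0]

/-- The basis wedge `e^{idx 0} ∧ ⋯ ∧ e^{idx (k-1)}` of the dual basis
(determinant convention). -/
def eW {k : ℕ} (idx : Fin k → Fin 7) : (Fin k → V) → ℝ :=
  fun x => Matrix.det (Matrix.of fun a b => x a (idx b))

/-- The wedge product of a `k`-form and an `l`-form. -/
noncomputable def wedge {k l : ℕ} (α : (Fin k → V) → ℝ) (β : (Fin l → V) → ℝ) :
    (Fin (k + l) → V) → ℝ :=
  fun x => ((Nat.factorial k * Nat.factorial l : ℕ) : ℝ)⁻¹ *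
    ∑ σ : Equiv.Perm (Fin (k + l)),
      ((Equiv.Perm.sign σ : ℤ) : ℝ) *
        (α fun i => x (σ (Fin.castAdd l i))) * (β fun j => x (σ (Fin.natAdd k j)))

/-- The Chevalley–Eilenberg differential of a 3-form. -/
def d3 (α : (Fin 3 → V) → ℝ) : (Fin 4 → V) → ℝ :=
  fun x =>
    -α ![br (x 0) (x 1), x 2, x 3] + α ![br (x 0) (x 2), x 1, x 3]
      - α ![br (x 0) (x 3), x 1, x 2] - α ![br (x 1) (x 2), x 0, x 3]
      + α ![br (x 1) (x 3), x 0, x 2] - α ![br (x 2) (x 3), x 0, x 1]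

/-- The Chevalley–Eilenberg differential of a 4-form. -/
def d4 (α : (Fin 4 → V) → ℝ) : (Fin 5 → V) → ℝ :=
  fun x =>
    -α ![br (x 0) (x 1), x 2, x 3, x 4] + α ![br (x 0) (x 2), x 1, x 3, x 4]
      - α ![br (x 0) (x 3), x 1, x 2, x 4] + α ![br (x 0) (x 4), x 1, x 2, x 3]
      - α ![br (x 1) (x 2), x 0, x 3, x 4] + α ![br (x 1) (x 3), x 0, x 2, x 4]
      - α ![br (x 1) (x 4), x 0, x 2, x 3] - α ![br (x 2) (x 3), x 0, x 1, x 4]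
      + α ![br (x 2) (x 4), x 0, x 1, x 3] - α ![br (x 3) (x 4), x 0, x 1, x 2]

/-- `ψ₀ = e^{4567} + e^{2345} + e^{2367} − e^{1346} + e^{1357} − e^{1247} − e^{1256}`
(0-indexed). -/
def psi0 : (Fin 4 → V) → ℝ :=
  fun x => eW ![3, 4, 5, 6] x + eW ![1, 2, 3, 4] x + eW ![1, 2, 5, 6] x
    - eW ![0, 2, 3, 5] x + eW ![0, 2, 4, 6] x - eW ![0, 1, 3, 6] x
    - eW ![0, 1, 4, 5] x

/-- The Leibniz formula for `eW`. -/
theorem eW_apply {k : ℕ} (idx : Fin k → Fin 7) (x : Fin k → V) :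
    eW idx x = ∑ τ : Equiv.Perm (Fin k), ((Equiv.Perm.sign τ : ℤ) : ℝ) * ∏ i, x (τ i) (idx i) := by
  simp [eW, Matrix.det_apply']

theorem eW_eq_zero_of_eq {k : ℕ} {idx : Fin k → Fin 7} {i j : Fin k} (hij : i ≠ j)
    (h : idx i = idx j) : eW idx = 0 := by
  funext x
  exact Matrix.det_zero_of_column_eq hij fun a => by simp [h]

/-- Basis wedges multiply by concatenation of their indices. -/
theorem wedge_eW_eW {k l : ℕ} (a : Fin k → Fin 7) (b : Fin l → Fin 7) :
    wedge (eW a) (eW b) = eW (Fin.append a b) := by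
  funext x
  have key (τ : Equiv.Perm (Fin k)) (ρ : Equiv.Perm (Fin l)) :
      ∑ σ : Equiv.Perm (Fin (k + l)), ((Equiv.Perm.sign σ : ℤ) : ℝ) *
        (((Equiv.Perm.sign τ : ℤ) : ℝ) * ∏ i, x (σ (Fin.castAdd l (τ i))) (a i)) *
        (((Equiv.Perm.sign ρ : ℤ) : ℝ) * ∏ j, x (σ (Fin.natAdd k (ρ j))) (b j)) =
      eW (Fin.append a b) x := by
    rw [eW_apply]
    refine Fintype.sum_equiv
      (Equiv.mulRight (finSumFinEquiv.permCongr (Equiv.Perm.sumCongr τ ρ))) _ _ fun σ => ?_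
    simp only [Equiv.coe_mulRight, Equiv.Perm.sign_mul, Equiv.Perm.sign_permCongr,
      Equiv.Perm.sign_sumCongr, Fin.prod_univ_add, Equiv.Perm.mul_apply, Equiv.permCongr_apply,
      finSumFinEquiv_symm_apply_castAdd, finSumFinEquiv_symm_apply_natAdd,
      Equiv.Perm.sumCongr_apply, Sum.map_inl, Sum.map_inr, finSumFinEquiv_apply_left,
      finSumFinEquiv_apply_right, Fin.append_left, Fin.append_right, Units.val_mul, Int.cast_mul]
    ring
  have swap : ∑ σ : Equiv.Perm (Fin (k + l)), ((Equiv.Perm.sign σ : ℤ) : ℝ) *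
        eW a (fun i => x (σ (Fin.castAdd l i))) * eW b (fun j => x (σ (Fin.natAdd k j))) =
      ∑ _τ : Equiv.Perm (Fin k), ∑ _ρ : Equiv.Perm (Fin l), eW (Fin.append a b) x := by
    rw [← Fintype.sum_congr _ _ fun τ => Fintype.sum_congr _ _ (key τ), Finset.sum_comm]
    simp only [eW_apply a, eW_apply b, Finset.mul_sum, Finset.sum_mul]
    rw [Finset.sum_comm]
    refine Fintype.sum_congr _ _ fun ρ => ?_
    exact Finset.sum_comm
  rw [wedge, swap]
  simp only [Finset.sum_const, Finset.card_univ, Fintype.card_perm, Fintype.card_fin, nsmul_eq_mul]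
  push_cast
  field_simp

theorem wedge_add {k l : ℕ} (α : (Fin k → V) → ℝ) (β γ : (Fin l → V) → ℝ) :
    wedge α (β + γ) = wedge α β + wedge α γ := by
  funext x
  simp [wedge, mul_add, Finset.sum_add_distrib]

theorem wedge_sub {k l : ℕ} (α : (Fin k → V) → ℝ) (β γ : (Fin l → V) → ℝ) :
    wedge α (β - γ) = wedge α β - wedge α γ := by
  funext x
  simp [wedge, mul_sub, Finset.sum_sub_distrib]

theorem d3_add (α β : (Fin 3 → V) → ℝ) : d3 (α + β) = d3 α + d3 β := by
  funext x
  simp only [d3, Pi.add_apply]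
  ring

theorem d4_add (α β : (Fin 4 → V) → ℝ) : d4 (α + β) = d4 α + d4 β := by
  funext x
  simp only [d4, Pi.add_apply]
  ring

theorem d4_sub (α β : (Fin 4 → V) → ℝ) : d4 (α - β) = d4 α - d4 β := by
  funext x
  simp only [d4, Pi.sub_apply]
  ring

theorem psi0_eq : psi0 = eW ![3, 4, 5, 6] + eW ![1, 2, 3, 4] + eW ![1, 2, 5, 6]
    - eW ![0, 2, 3, 5] + eW ![0, 2, 4, 6] - eW ![0, 1, 3, 6] - eW ![0, 1, 4, 5] := rfl

theorem eW_three (i j k : Fin 7) (x y z : V) :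
    eW ![i, j, k] ![x, y, z] =
      x i * (y j * z k - y k * z j) - x j * (y i * z k - y k * z i)
        + x k * (y i * z j - y j * z i) := by
  simp [eW, Matrix.det_fin_three]
  ring

/-- Laplace expansion of a basis 4-form along the first vector. -/
theorem eW_four (i j k l : Fin 7) (x y z w : V) :
    eW ![i, j, k, l] ![x, y, z, w] =
      x i * eW ![j, k, l] ![y, z, w] - x j * eW ![i, k, l] ![y, z, w]
        + x k * eW ![i, j, l] ![y, z, w] - x l * eW ![i, j, k] ![y, z, w] := by
  simp [eW, Matrix.det_succ_row_zero, Fin.sum_univ_succ, Fin.succAbove]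
  ring

/-- Laplace expansion of a basis 5-form along the first vector. -/
theorem eW_five (i j k l m : Fin 7) (x : Fin 5 → V) :
    eW ![i, j, k, l, m] x =
      x 0 i * eW ![j, k, l, m] ![x 1, x 2, x 3, x 4]
        - x 0 j * eW ![i, k, l, m] ![x 1, x 2, x 3, x 4]
        + x 0 k * eW ![i, j, l, m] ![x 1, x 2, x 3, x 4]
        - x 0 l * eW ![i, j, k, m] ![x 1, x 2, x 3, x 4]
        + x 0 m * eW ![i, j, k, l] ![x 1, x 2, x 3, x 4] := by
  simp [eW, Matrix.det_succ_row_zero, Fin.sum_univ_succ, Fin.succAbove]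
  ring

theorem br_apply (x y : V) :
    br x y 0 = -(x 1 * y 2 - x 2 * y 1) ∧ br x y 1 = -(x 2 * y 0 - x 0 * y 2) ∧
    br x y 2 = -(x 0 * y 1 - x 1 * y 0) ∧ br x y 3 = -(x 4 * y 5 - x 5 * y 4) ∧
    br x y 4 = -(x 5 * y 3 - x 3 * y 5) ∧ br x y 5 = -(x 3 * y 4 - x 4 * y 3) ∧
    br x y 6 = 0 :=
  ⟨rfl, rfl, rfl, rfl, rfl, rfl, rfl⟩

theorem d3_eW_012 : d3 (eW ![0, 1, 2]) = 0 := by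
  funext x
  simp only [d3, eW_three, br_apply, Pi.zero_apply]
  ring

theorem d3_eW_345 : d3 (eW ![3, 4, 5]) = 0 := by
  funext x
  simp only [d3, eW_three, br_apply, Pi.zero_apply]
  ring

theorem d4_eW_3456 : d4 (eW ![3, 4, 5, 6]) = 0 := by
  funext x
  simp only [d4, eW_four, eW_three, br_apply, Pi.zero_apply]
  ring

theorem d4_eW_1234 : d4 (eW ![1, 2, 3, 4]) = 0 := by
  funext x
  simp only [d4, eW_four, eW_three, br_apply, Pi.zero_apply]
  ring

theorem d4_eW_1256 : d4 (eW ![1, 2, 5, 6]) = eW ![6, 1, 2, 3, 4] := by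
  funext x
  simp only [d4, eW_four, eW_three, br_apply, eW_five]
  ring

theorem d4_eW_0235 : d4 (eW ![0, 2, 3, 5]) = 0 := by
  funext x
  simp only [d4, eW_four, eW_three, br_apply, Pi.zero_apply]
  ring

theorem d4_eW_0246 : d4 (eW ![0, 2, 4, 6]) = -eW ![6, 0, 2, 3, 5] := by
  funext x
  simp only [d4, eW_four, eW_three, br_apply, eW_five, Pi.neg_apply]
  ring

theorem d4_eW_0136 : d4 (eW ![0, 1, 3, 6]) = eW ![6, 0, 1, 4, 5] := by
  funext x
  simp only [d4, eW_four, eW_three, br_apply, eW_five]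
  ring

theorem d4_eW_0145 : d4 (eW ![0, 1, 4, 5]) = 0 := by
  funext x
  simp only [d4, eW_four, eW_three, br_apply, Pi.zero_apply]
  ring

/-- `e⁷ ∧ e^{ijkl} = e^{7ijkl}`. -/
theorem wedge_e7_eW (i j k l : Fin 7) :
    wedge (eW ![6]) (eW ![i, j, k, l]) = eW ![6, i, j, k, l] := by
  rw [wedge_eW_eW]
  congr 1
  funext a
  fin_cases a <;> rfl

/-- `e⁷ ∧ e^{ijk7} = 0`. -/
theorem wedge_e7_eW_e7 (i j k : Fin 7) : wedge (eW ![6]) (eW ![i, j, k, 6]) = 0 := by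
  rw [wedge_e7_eW]
  exact eW_eq_zero_of_eq (i := 0) (j := 4) (by decide) rfl

/-- on the Lie algebra `𝔤₂ ≅ 𝔰𝔲(2) ⊕ 𝔰𝔲(2) ⊕ ℝ` one has
`(i) dψ₀ = e⁷∧ψ₀` and `(ii) d(e^{123} + e^{456}) = 0`: the corresponding
left-invariant G₂-structure on `SU(2)×SU(2)×U(1)` is a strong G₂T-structure with
closed Lee form `e⁷` and closed torsion 3-form `e^{123}+e^{456}`. -/
theorem strongG2T_su2_su2_u1 :
    d4 psi0 = wedge (eW ![6]) psi0 ∧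
    d3 (fun x => eW ![0, 1, 2] x + eW ![3, 4, 5] x) = 0 := by
  constructor
  · rw [psi0_eq]
    simp only [d4_add, d4_sub, wedge_add, wedge_sub, d4_eW_3456, d4_eW_1234, d4_eW_1256,
      d4_eW_0235, d4_eW_0246, d4_eW_0136, d4_eW_0145, wedge_e7_eW_e7]
    simp only [wedge_e7_eW]
    abel
  · exact (d3_add _ _).trans (by rw [d3_eW_012, d3_eW_345, add_zero])

end Stmt10
end

section
/- Let 𝔤 be the 6-dimensional real Lie algebra with basis (e₁,…,e₆) whose only nonzero Lie brackets among basis vectors are ⁅e₂,e₃⁆ = −e₁, ⁅e₃,e₁⁆ = −e₂, ⁅e₁,e₂⁆ = −e₃, ⁅e₅,e₆⁆ = −e₄, ⁅e₆,e₄⁆ = −e₅, ⁅e₄,e₅⁆ = −e₆ (so 𝔤 ≅ 𝔰𝔲(2) ⊕ 𝔰𝔲(2) and the dual basis satisfies de¹ = e^{23}, de² = −e^{13}, de³ = e^{12}, de⁴ = e^{56}, de⁵ = −e^{46}, de⁶ = e^{45}). Let ω = e^{14} + e^{25} − e^{36}, ψ₊ = e^{123} + e^{156} − e^{246} − e^{345},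 ψ₋ = e^{456} + e^{234} − e^{135} − e^{126}, and w₃ = (1/4)(3e^{123} − 3e^{456} − e^{126} − e^{135} − e^{156} + e^{234} + e^{246} + e^{345}). Then: (i) dψ₊ = (1/2)·ω∧ω; (ii) dψ₋ = (1/2)·ω∧ω; (iii) dω = −(3/4)ψ₊ + (3/4)ψ₋ + w₃; (iv) dw₃ = 0; (v) w₃∧ω = 0, w₃∧ψ₊ = 0, and w₃∧ψ₋ = 0. (These identities say that for this SU(3)-structure on SU(2)×SU(2) the only nonvanishing intrinsic torsion forms are w₁⁺ = w₁⁻ = 1/2 and the closed primitive 3-form w₃.) -/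
open scoped BigOperators

namespace Stmt11

/-- The underlying vector space of the Lie algebra `𝔤 ≅ 𝔰𝔲(2) ⊕ 𝔰𝔲(2)`,
in the coordinates of the basis `(e₁,…,e₆)`. -/
abbrev V : Type := Fin 6 → ℝ

/-- The Lie bracket of `𝔤`: the bilinear extension of
`⁅e₂,e₃⁆ = −e₁, ⁅e₃,e₁⁆ = −e₂, ⁅e₁,e₂⁆ = −e₃, ⁅e₅,e₆⁆ = −e₄, ⁅e₆,e₄⁆ = −e₅,
⁅e₄,e₅⁆ = −e₆` (all other brackets of basis vectors zero), written 0-indexed. -/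
def br (x y : V) : V :=
  ![-(x 1 * y 2 - x 2 * y 1),
    -(x 2 * y 0 - x 0 * y 2),
    -(x 0 * y 1 - x 1 * y 0),
    -(x 4 * y 5 - x 5 * y 4),
    -(x 5 * y 3 - x 3 * y 5),
    -(x 3 * y 4 - x 4 * y 3)]

/-- The basis wedge `e^{idx 0} ∧ ⋯ ∧ e^{idx (k-1)}` of the dual basis
(determinant convention). -/
def eW {k : ℕ} (idx : Fin k → Fin 6) : (Fin k → V) → ℝ :=
  fun x => Matrix.det (Matrix.of fun a b => x a (idx b))

/-- The wedge product of a `k`-form and an `l`-form. -/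
noncomputable def wedge {k l : ℕ} (α : (Fin k → V) → ℝ) (β : (Fin l → V) → ℝ) :
    (Fin (k + l) → V) → ℝ :=
  fun x => ((Nat.factorial k * Nat.factorial l : ℕ) : ℝ)⁻¹ *
    ∑ σ : Equiv.Perm (Fin (k + l)),
      ((Equiv.Perm.sign σ : ℤ) : ℝ) *
        (α fun i => x (σ (Fin.castAdd l i))) * (β fun j => x (σ (Fin.natAdd k j)))

/-- The Chevalley–Eilenberg differential of a 2-form. -/
def d2 (α : (Fin 2 → V) → ℝ) : (Fin 3 → V) → ℝ :=
  fun x =>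
    -α ![br (x 0) (x 1), x 2] + α ![br (x 0) (x 2), x 1] - α ![br (x 1) (x 2), x 0]

/-- The Chevalley–Eilenberg differential of a 3-form. -/
def d3 (α : (Fin 3 → V) → ℝ) : (Fin 4 → V) → ℝ :=
  fun x =>
    -α ![br (x 0) (x 1), x 2, x 3] + α ![br (x 0) (x 2), x 1, x 3]
      - α ![br (x 0) (x 3), x 1, x 2] - α ![br (x 1) (x 2), x 0, x 3]
      + α ![br (x 1) (x 3), x 0, x 2] - α ![br (x 2) (x 3), x 0, x 1]

/-- `ω = e^{14} + e^{25} − e^{36}` (0-indexed). -/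
def om : (Fin 2 → V) → ℝ :=
  fun x => eW ![0, 3] x + eW ![1, 4] x - eW ![2, 5] x

/-- `ψ₊ = e^{123} + e^{156} − e^{246} − e^{345}` (0-indexed). -/
def psiP : (Fin 3 → V) → ℝ :=
  fun x => eW ![0, 1, 2] x + eW ![0, 4, 5] x - eW ![1, 3, 5] x - eW ![2, 3, 4] x

/-- `ψ₋ = e^{456} + e^{234} − e^{135} − e^{126}` (0-indexed). -/
def psiM : (Fin 3 → V) → ℝ :=
  fun x => eW ![3, 4, 5] x + eW ![1, 2, 3] x - eW ![0, 2, 4] x - eW ![0, 1, 5] x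

/-- `w₃ = (1/4)(3e^{123} − 3e^{456} − e^{126} − e^{135} − e^{156} + e^{234} + e^{246} + e^{345})`
(0-indexed). -/
noncomputable def w3 : (Fin 3 → V) → ℝ :=
  fun x => (4 : ℝ)⁻¹ * (3 * eW ![0, 1, 2] x - 3 * eW ![3, 4, 5] x - eW ![0, 1, 5] x
    - eW ![0, 2, 4] x - eW ![0, 4, 5] x + eW ![1, 2, 3] x + eW ![1, 3, 5] x
    + eW ![2, 3, 4] x)

theorem eW_comp_perm {k : ℕ} (idx : Fin k → Fin 6) (σ : Equiv.Perm (Fin k)) (x : Fin k → V) :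
    eW (idx ∘ σ) x = ((Equiv.Perm.sign σ : ℤ) : ℝ) * eW idx x :=
  Matrix.det_permute' σ (Matrix.of fun a b => x a (idx b))

theorem eW_eq_zero_of_eq {k : ℕ} {idx : Fin k → Fin 6} {i j : Fin k} (hij : i ≠ j)
    (h : idx i = idx j) : eW idx = 0 := by
  funext x
  exact Matrix.det_zero_of_column_eq hij fun a => by simp [h]

theorem eW_eq_zero_of_not_injective {k : ℕ} {idx : Fin k → Fin 6}
    (h : ¬ Function.Injective idx) : eW idx = 0 := by
  obtain ⟨i, j, hidx, hij⟩ := Function.not_injective_iff.mp h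
  exact eW_eq_zero_of_eq hij hidx

theorem eW_apply {k : ℕ} (idx : Fin k → Fin 6) (x : Fin k → V) :
    eW idx x = ∑ σ : Equiv.Perm (Fin k),
      ((Equiv.Perm.sign σ : ℤ) : ℝ) * ∏ i, x (σ i) (idx i) :=
  Matrix.det_apply' _

/-- The wedge product of two basis wedges concatenates their index tuples. -/
theorem wedge_eW {k l : ℕ} (a : Fin k → Fin 6) (b : Fin l → Fin 6) :
    wedge (eW a) (eW b) = eW (Fin.append a b) := by
  funext x
  let s : Equiv.Perm (Fin k) → Equiv.Perm (Fin l) → Equiv.Perm (Fin (k + l)) := fun τ ρ =>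
    finSumFinEquiv.permCongr (Equiv.Perm.sumCongr τ ρ)
  have hs : ∀ τ ρ, ((Equiv.Perm.sign (s τ ρ) : ℤ) : ℝ) =
      ((Equiv.Perm.sign τ : ℤ) : ℝ) * ((Equiv.Perm.sign ρ : ℤ) : ℝ) := fun τ ρ => by
    simp [s, Equiv.Perm.sign_permCongr]
  have hsl : ∀ τ ρ i, s τ ρ (Fin.castAdd l i) = Fin.castAdd l (τ i) := fun τ ρ i => by
    simp [s, Equiv.permCongr_apply]
  have hsr : ∀ τ ρ j, s τ ρ (Fin.natAdd k j) = Fin.natAdd k (ρ j) := fun τ ρ j => by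
    simp [s, Equiv.permCongr_apply]
  have key : ∀ τ ρ, ∑ σ : Equiv.Perm (Fin (k + l)), ((Equiv.Perm.sign σ : ℤ) : ℝ) *
      (((Equiv.Perm.sign τ : ℤ) : ℝ) * ∏ i, x (σ (Fin.castAdd l (τ i))) (a i)) *
      (((Equiv.Perm.sign ρ : ℤ) : ℝ) * ∏ j, x (σ (Fin.natAdd k (ρ j))) (b j)) =
      eW (Fin.append a b) x := fun τ ρ => by
    rw [eW_apply]
    conv_rhs => rw [← Equiv.sum_comp (Equiv.mulRight (s τ ρ))]
    refine Finset.sum_congr rfl fun σ _ => ?_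
    simp only [Equiv.coe_mulRight, Equiv.Perm.sign_mul, Units.val_mul, Int.cast_mul, hs,
      Fin.prod_univ_add, Equiv.Perm.mul_apply, hsl, hsr, Fin.append_left, Fin.append_right]
    ring
  have hsum : ∑ σ : Equiv.Perm (Fin (k + l)), ((Equiv.Perm.sign σ : ℤ) : ℝ) *
      (eW a fun i => x (σ (Fin.castAdd l i))) * (eW b fun j => x (σ (Fin.natAdd k j))) =
      ((Nat.factorial k * Nat.factorial l : ℕ) : ℝ) * eW (Fin.append a b) x := by
    simp only [eW_apply a, eW_apply b, Finset.mul_sum, Finset.sum_mul]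
    rw [Finset.sum_comm]
    simp_rw [Finset.sum_comm (s := (Finset.univ : Finset (Equiv.Perm (Fin (k + l))))), key]
    simp [Fintype.card_perm]
    ring
  rw [wedge, hsum, inv_mul_cancel_left₀]
  exact_mod_cast (Nat.mul_pos k.factorial_pos l.factorial_pos).ne'

section Bilinearity

variable {k l : ℕ} (α α' : (Fin k → V) → ℝ) (β β' : (Fin l → V) → ℝ) (c : ℝ)

theorem wedge_add_left : wedge (α + α') β = wedge α β + wedge α' β := by
  funext x
  simp [wedge, mul_add, add_mul, Finset.sum_add_distrib]

theorem wedge_add_right : wedge α (β + β') = wedge α β + wedge α β' := by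
  funext x
  simp [wedge, mul_add, Finset.sum_add_distrib]

theorem wedge_smul_left : wedge (c • α) β = c • wedge α β := by
  funext x
  simp only [wedge, Pi.smul_apply, smul_eq_mul, Finset.mul_sum]
  exact Finset.sum_congr rfl fun σ _ => by ring

theorem wedge_smul_right : wedge α (c • β) = c • wedge α β := by
  funext x
  simp only [wedge, Pi.smul_apply, smul_eq_mul, Finset.mul_sum]
  exact Finset.sum_congr rfl fun σ _ => by ring

theorem wedge_sub_left : wedge (α - α') β = wedge α β - wedge α' β := by
  funext x
  simp [wedge, mul_sub, sub_mul, Finset.sum_sub_distrib]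

theorem wedge_sub_right : wedge α (β - β') = wedge α β - wedge α β' := by
  funext x
  simp [wedge, mul_sub, Finset.sum_sub_distrib]

end Bilinearity

theorem om_eq : om = eW ![0, 3] + eW ![1, 4] - eW ![2, 5] := rfl

theorem psiP_eq :
    psiP = eW ![0, 1, 2] + eW ![0, 4, 5] - eW ![1, 3, 5] - eW ![2, 3, 4] := rfl

theorem psiM_eq :
    psiM = eW ![3, 4, 5] + eW ![1, 2, 3] - eW ![0, 2, 4] - eW ![0, 1, 5] := rfl

theorem w3_eq : w3 = (4 : ℝ)⁻¹ • ((3 : ℝ) • eW ![0, 1, 2] - (3 : ℝ) • eW ![3, 4, 5]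
    - eW ![0, 1, 5] - eW ![0, 2, 4] - eW ![0, 4, 5] + eW ![1, 2, 3] + eW ![1, 3, 5]
    + eW ![2, 3, 4]) := rfl

theorem eW_two (i j : Fin 6) (x : Fin 2 → V) :
    eW ![i, j] x = x 0 i * x 1 j - x 0 j * x 1 i := by
  simp [eW, Matrix.det_fin_two]

theorem eW_three (i j k : Fin 6) (x : Fin 3 → V) :
    eW ![i, j, k] x = x 0 i * (x 1 j * x 2 k - x 1 k * x 2 j)
      - x 0 j * (x 1 i * x 2 k - x 1 k * x 2 i) + x 0 k * (x 1 i * x 2 j - x 1 j * x 2 i) := by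
  simp [eW, Matrix.det_fin_three]
  ring

theorem eW_four (i j k l : Fin 6) (x : Fin 4 → V) :
    eW ![i, j, k, l] x = x 0 i * eW ![j, k, l] (Fin.tail x) - x 0 j * eW ![i, k, l] (Fin.tail x)
      + x 0 k * eW ![i, j, l] (Fin.tail x) - x 0 l * eW ![i, j, k] (Fin.tail x) := by
  simp only [eW_three]
  simp [eW, Matrix.det_succ_row_zero, Fin.sum_univ_succ, Fin.tail, Fin.succAbove]
  ring

theorem om_wedge_om (x : Fin 4 → V) : (2 : ℝ)⁻¹ * wedge om om x =
    eW ![0, 3, 1, 4] x - eW ![0, 3, 2, 5] x - eW ![1, 4, 2, 5] x := by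
  have hxx : ∀ i j : Fin 6, eW (Fin.append ![i, j] ![i, j]) = 0 := fun i j =>
    eW_eq_zero_of_eq (i := 0) (j := 2) (by decide) rfl
  have hcomm : ∀ i j k l : Fin 6, eW (Fin.append ![i, j] ![k, l]) x = eW ![k, l, i, j] x := by
    intro i j k l
    rw [show Fin.append ![i, j] ![k, l] = ![i, j, k, l] by ext t; fin_cases t <;> rfl]
    simp only [eW_four, eW_three]
    ring
  simp only [om_eq, wedge_add_left, wedge_add_right, wedge_sub_left, wedge_sub_right, wedge_eW,
    hxx, Pi.add_apply, Pi.sub_apply, Pi.zero_apply, hcomm]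
  simp only [eW_four, eW_three]
  ring

theorem d3_psiP (x : Fin 4 → V) : d3 psiP x = (2 : ℝ)⁻¹ * wedge om om x := by
  rw [om_wedge_om]
  simp [d3, psiP, eW_four, eW_three, br, Fin.tail]
  ring

theorem d3_psiM (x : Fin 4 → V) : d3 psiM x = (2 : ℝ)⁻¹ * wedge om om x := by
  rw [om_wedge_om]
  simp [d3, psiM, eW_four, eW_three, br, Fin.tail]
  ring

theorem d2_om (x : Fin 3 → V) :
    d2 om x = -(3 / 4 : ℝ) * psiP x + (3 / 4 : ℝ) * psiM x + w3 x := by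
  simp [d2, om, psiP, psiM, w3, eW_two, eW_three, br]
  ring

theorem d3_w3 : d3 w3 = 0 := by
  funext x
  simp [d3, w3, eW_three, br]
  ring

theorem wedge_w3_om : wedge w3 om = 0 := by
  simp only [w3_eq, om_eq, wedge_smul_left, wedge_add_left, wedge_add_right, wedge_sub_left,
    wedge_sub_right, wedge_eW]
  simp (discharger := decide) only [eW_eq_zero_of_not_injective]
  simp

theorem eW_append_eq {a b : Fin 3 → Fin 6} (σ : Equiv.Perm (Fin 6))
    (h : ∀ i, Fin.append a b i = σ i) :
    eW (Fin.append a b) = ((Equiv.Perm.sign σ : ℤ) : ℝ) • eW (k := 6) id := by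
  rw [show Fin.append a b = id ∘ σ from funext h]
  exact funext (eW_comp_perm (k := 6) id σ)

theorem wedge_w3_psiP : wedge w3 psiP = 0 := by
  have h₁ : eW (Fin.append ![3, 4, 5] ![0, 1, 2]) = -eW id :=
    eW_append_eq (.swap 2 5 * .swap 1 4 * .swap 0 3) (by decide) |>.trans (by
      simp [Equiv.Perm.sign_swap'])
  have h₂ : eW (Fin.append ![0, 1, 5] ![2, 3, 4]) = -eW id :=
    eW_append_eq (.swap 4 5 * .swap 3 4 * .swap 2 3) (by decide) |>.trans (by
      simp [Equiv.Perm.sign_swap'])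
  have h₃ : eW (Fin.append ![0, 2, 4] ![1, 3, 5]) = -eW id :=
    eW_append_eq (.swap 3 4 * .swap 2 3 * .swap 1 3) (by decide) |>.trans (by
      simp [Equiv.Perm.sign_swap'])
  have h₄ : eW (Fin.append ![1, 2, 3] ![0, 4, 5]) = -eW id :=
    eW_append_eq (.swap 2 3 * .swap 1 3 * .swap 0 3) (by decide) |>.trans (by
      simp [Equiv.Perm.sign_swap'])
  simp only [w3_eq, psiP_eq, wedge_smul_left, wedge_add_left, wedge_add_right, wedge_sub_left,
    wedge_sub_right, wedge_eW]
  simp only [h₁, h₂, h₃, h₄]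
  simp (discharger := decide) only [eW_eq_zero_of_not_injective]
  module

theorem wedge_w3_psiM : wedge w3 psiM = 0 := by
  have h₁ : eW (Fin.append ![0, 1, 2] ![3, 4, 5]) = eW id :=
    eW_append_eq 1 (by decide) |>.trans (by
      simp)
  have h₂ : eW (Fin.append ![0, 4, 5] ![1, 2, 3]) = eW id :=
    eW_append_eq (.swap 4 5 * .swap 3 5 * .swap 2 4 * .swap 1 3) (by decide) |>.trans (by
      simp [Equiv.Perm.sign_swap'])
  have h₃ : eW (Fin.append ![1, 3, 5] ![0, 2, 4]) = eW id :=
    eW_append_eq (.swap 4 5 * .swap 2 4 * .swap 1 3 * .swap 0 3) (by decide) |>.trans (by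
      simp [Equiv.Perm.sign_swap'])
  have h₄ : eW (Fin.append ![2, 3, 4] ![0, 1, 5]) = eW id :=
    eW_append_eq (.swap 3 4 * .swap 2 3 * .swap 1 4 * .swap 0 3) (by decide) |>.trans (by
      simp [Equiv.Perm.sign_swap'])
  simp only [w3_eq, psiM_eq, wedge_smul_left, wedge_add_left, wedge_add_right, wedge_sub_left,
    wedge_sub_right, wedge_eW]
  simp only [h₁, h₂, h₃, h₄]
  simp (discharger := decide) only [eW_eq_zero_of_not_injective]
  module

/-- for the SU(3)-structure `(ω, ψ₊, ψ₋)` on `𝔰𝔲(2) ⊕ 𝔰𝔲(2)`: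
`(i) dψ₊ = ½ ω∧ω`, `(ii) dψ₋ = ½ ω∧ω`, `(iii) dω = −(3/4)ψ₊ + (3/4)ψ₋ + w₃`,
`(iv) dw₃ = 0`, `(v) w₃∧ω = 0, w₃∧ψ₊ = 0, w₃∧ψ₋ = 0`. -/
theorem su3_structure_su2_su2 :
    (d3 psiP = fun x => (2 : ℝ)⁻¹ * wedge om om x) ∧
    (d3 psiM = fun x => (2 : ℝ)⁻¹ * wedge om om x) ∧
    (d2 om = fun x => -(3 / 4 : ℝ) * psiP x + (3 / 4 : ℝ) * psiM x + w3 x) ∧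
    d3 w3 = 0 ∧
    wedge w3 om = 0 ∧ wedge w3 psiP = 0 ∧ wedge w3 psiM = 0 := by
  exact ⟨funext d3_psiP, funext d3_psiM, funext d2_om, d3_w3, wedge_w3_om, wedge_w3_psiP,
    wedge_w3_psiM⟩

end Stmt11
end

section
/- Let a₁, a₂ : ℝ → ℝ be differentiable functions with a₁(t) > 0 for all t ∈ ℝ. Suppose that a₁′(t) = 0 and a₂′(t) = (a₁(t) + a₂(t))/√(a₁(t)) for all t, and that a₁(0) = a₂(0) = 1. Then for all t ∈ ℝ: a₁(t) = 1 and a₂(t) = 2·exp(t) − 1. -/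
/-- the solution of the ODE system of the homogeneous Laplacian coflow
on `SU(2)×SU(2)×U(1)`: if `a₁, a₂ : ℝ → ℝ` are differentiable with `a₁ > 0`,
`a₁′ = 0`, `a₂′ = (a₁ + a₂)/√a₁` and `a₁(0) = a₂(0) = 1`, then `a₁ ≡ 1` and
`a₂(t) = 2·exp(t) − 1`. -/
theorem coflow_ode_su2_su2_u1 (a₁ a₂ : ℝ → ℝ)
    (ha₁ : Differentiable ℝ a₁) (ha₂ : Differentiable ℝ a₂)
    (hpos : ∀ t : ℝ, 0 < a₁ t)
    (hd1 : ∀ t : ℝ, deriv a₁ t = 0)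
    (hd2 : ∀ t : ℝ, deriv a₂ t = (a₁ t + a₂ t) / Real.sqrt (a₁ t))
    (h10 : a₁ 0 = 1) (h20 : a₂ 0 = 1) :
    ∀ t : ℝ, a₁ t = 1 ∧ a₂ t = 2 * Real.exp t - 1 := by
  have h1 : ∀ t, a₁ t = 1 := fun t => (is_const_of_deriv_eq_zero ha₁ hd1 t 0).trans h10
  have hd : ∀ t, HasDerivAt a₂ (1 + a₂ t) t := fun t => by
    simpa [hd2, h1] using (ha₂ t).hasDerivAt
  have hg : ∀ t, HasDerivAt (fun s => (1 + a₂ s) * Real.exp (-s)) 0 t := fun t => by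
    refine (((hd t).const_add 1).mul (hasDerivAt_neg t).exp).congr_deriv ?_
    ring
  intro t
  have hc : (1 + a₂ t) * Real.exp (-t) = 2 := by
    have h := is_const_of_deriv_eq_zero (fun s => (hg s).differentiableAt)
      (fun s => (hg s).deriv) t 0
    norm_num [h20] at h
    exact h
  have he : Real.exp (-t) * Real.exp t = 1 := by rw [← Real.exp_add]; simp
  refine ⟨h1 t, ?_⟩
  linear_combination Real.exp t * hc - (1 + a₂ t) * he
end

section
/- Let 𝔤 = 𝔰𝔲(2) × 𝔰𝔲(2) × ℝ (with ℝ abelian), let 𝔥 = span((σ₁,σ₁,0)), and let 𝔫 = span(e₁,…,e₆) where e₁ = (σ₂,0,0), e₂ = (σ₃,0,0), e₃ = (0,σ₂,0), e₄ = (0,σ₃,0), e₅ = (σ₁,−σ₁,0), e₆ = (0,0,1), so that 𝔤 = 𝔫 ⊕ 𝔥; let (e¹,…,e⁶) be the dual basis of 𝔫* and D the projected differential. For real numbers a₀, a₁, a₃, a₄ let ω = a₀(e^{12}+e^{34}) + a₁(e^{12}−e^{34}) + a₃(e^{14}−e^{23}) + a₄·e^{56}. Then: (i) ω∧ω∧ω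 = 6a₄(a₀² − a₁² − a₃²)·e^{123456}; (ii) Dω∧ω = 2a₁a₄·e^{12346}; (iii) if ω∧ω∧ω ≠ 0 then Dω ≠ 0 (so ω cannot be symplectic); (iv) if ω∧ω∧ω ≠ 0 then Dω∧ω = 0 if and only if a₁ = 0. -/
open scoped BigOperators

namespace Stmt14

open Complex (I)

/-- The ambient space containing `𝔤 = 𝔰𝔲(2) × 𝔰𝔲(2) × ℝ`. -/
abbrev G : Type :=
  Matrix (Fin 2) (Fin 2) ℂ × Matrix (Fin 2) (Fin 2) ℂ × ℝ

noncomputable def σ1 : Matrix (Fin 2) (Fin 2) ℂ := !![I, 0; 0, -I]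
noncomputable def σ2 : Matrix (Fin 2) (Fin 2) ℂ := !![0, 1; -1, 0]
noncomputable def σ3 : Matrix (Fin 2) (Fin 2) ℂ := !![0, I; I, 0]

/-- The Lie bracket of `𝔤` (componentwise commutators; the factor ℝ is abelian). -/
noncomputable def brG (a b : G) : G :=
  (a.1 * b.1 - b.1 * a.1, a.2.1 * b.2.1 - b.2.1 * a.2.1, 0)

/-- The basis `(e₁,…,e₆)` of the complement `𝔫` of `𝔥 = span((σ₁,σ₁,0))`. -/
noncomputable def E : Fin 6 → G :=
  ![(σ2, 0, 0), (σ3, 0, 0), (0, σ2, 0), (0, σ3, 0), (σ1, -σ1, 0), (0, 0, 1)]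

/-- The generator of `𝔥`. -/
noncomputable def W : G := (σ1, σ1, 0)

/-- Coordinates on `𝔫`. -/
abbrev V : Type := Fin 6 → ℝ

/-- The identification of coordinates with elements of `𝔫`: `v ↦ Σᵢ vᵢ eᵢ`. -/
noncomputable def Φ (v : V) : G := ∑ i, v i • E i

/-- The basis wedge `e^{idx 0} ∧ ⋯ ∧ e^{idx (k-1)}` of the dual basis
(determinant convention). -/
def eW {k : ℕ} (idx : Fin k → Fin 6) : (Fin k → V) → ℝ :=
  fun x => Matrix.det (Matrix.of fun a b => x a (idx b))

/-- The wedge product of a `k`-form and an `l`-form. -/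
noncomputable def wedge {k l : ℕ} (α : (Fin k → V) → ℝ) (β : (Fin l → V) → ℝ) :
    (Fin (k + l) → V) → ℝ :=
  fun x => ((Nat.factorial k * Nat.factorial l : ℕ) : ℝ)⁻¹ *
    ∑ σ : Equiv.Perm (Fin (k + l)),
      ((Equiv.Perm.sign σ : ℤ) : ℝ) *
        (α fun i => x (σ (Fin.castAdd l i))) * (β fun j => x (σ (Fin.natAdd k j)))

/-- The projected Chevalley–Eilenberg differential of a 2-form, for the projected
bracket `pb`. -/
def D2 (pb : V → V → V) (α : (Fin 2 → V) → ℝ) : (Fin 3 → V) → ℝ :=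
  fun x =>
    -α ![pb (x 0) (x 1), x 2] + α ![pb (x 0) (x 2), x 1] - α ![pb (x 1) (x 2), x 0]

/-- `ω = a₀(e^{12}+e^{34}) + a₁(e^{12}−e^{34}) + a₃(e^{14}−e^{23}) + a₄e^{56}`
(0-indexed). -/
def om (a₀ a₁ a₃ a₄ : ℝ) : (Fin 2 → V) → ℝ :=
  fun x => a₀ * (eW ![0, 1] x + eW ![2, 3] x) + a₁ * (eW ![0, 1] x - eW ![2, 3] x)
    + a₃ * (eW ![0, 3] x - eW ![1, 2] x) + a₄ * eW ![4, 5] x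

theorem wedge_add_left {k l : ℕ} (α α' : (Fin k → V) → ℝ) (β : (Fin l → V) → ℝ) :
    wedge (α + α') β = wedge α β + wedge α' β := by
  ext x
  simp only [wedge, Pi.add_apply, mul_add, add_mul, Finset.sum_add_distrib]

theorem wedge_add_right {k l : ℕ} (α : (Fin k → V) → ℝ) (β β' : (Fin l → V) → ℝ) :
    wedge α (β + β') = wedge α β + wedge α β' := by
  ext x
  simp only [wedge, Pi.add_apply, mul_add, Finset.sum_add_distrib]

theorem wedge_smul_left {k l : ℕ} (c : ℝ) (α : (Fin k → V) → ℝ) (β : (Fin l → V) → ℝ) :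
    wedge (c • α) β = c • wedge α β := by
  ext x
  simp only [wedge, Pi.smul_apply, smul_eq_mul, Finset.mul_sum]
  exact Finset.sum_congr rfl fun _ _ => by ring

theorem wedge_smul_right {k l : ℕ} (c : ℝ) (α : (Fin k → V) → ℝ) (β : (Fin l → V) → ℝ) :
    wedge α (c • β) = c • wedge α β := by
  ext x
  simp only [wedge, Pi.smul_apply, smul_eq_mul, Finset.mul_sum]
  exact Finset.sum_congr rfl fun _ _ => by ring

/-- The permutation of `Fin (k + l)` acting by `ρ` on the first `k` indices and by `τ` on the
last `l`. -/
def blockPerm {k l : ℕ} (ρ : Equiv.Perm (Fin k)) (τ : Equiv.Perm (Fin l)) :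
    Equiv.Perm (Fin (k + l)) :=
  finSumFinEquiv.permCongr (Equiv.Perm.sumCongr ρ τ)

theorem blockPerm_castAdd {k l : ℕ} (ρ : Equiv.Perm (Fin k)) (τ : Equiv.Perm (Fin l))
    (i : Fin k) : blockPerm ρ τ (Fin.castAdd l i) = Fin.castAdd l (ρ i) := by
  simp [blockPerm, Equiv.permCongr_apply]

theorem blockPerm_natAdd {k l : ℕ} (ρ : Equiv.Perm (Fin k)) (τ : Equiv.Perm (Fin l))
    (j : Fin l) : blockPerm ρ τ (Fin.natAdd k j) = Fin.natAdd k (τ j) := by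
  simp [blockPerm, Equiv.permCongr_apply]

theorem sign_blockPerm {k l : ℕ} (ρ : Equiv.Perm (Fin k)) (τ : Equiv.Perm (Fin l)) :
    Equiv.Perm.sign (blockPerm ρ τ) = Equiv.Perm.sign ρ * Equiv.Perm.sign τ := by
  simp [blockPerm, Equiv.Perm.sign_permCongr, Equiv.Perm.sign_sumCongr]

theorem eW_apply {k : ℕ} (f : Fin k → Fin 6) (x : Fin k → V) :
    eW f x = ∑ σ : Equiv.Perm (Fin k),
      ((Equiv.Perm.sign σ : ℤ) : ℝ) * ∏ i, x (σ i) (f i) := by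
  simp [eW, Matrix.det_apply']

theorem wedge_eW {k l : ℕ} (f : Fin k → Fin 6) (g : Fin l → Fin 6) :
    wedge (eW f) (eW g) = eW (Fin.append f g) := by
  ext x
  have key : ∀ (ρ : Equiv.Perm (Fin k)) (τ : Equiv.Perm (Fin l)),
      ∑ σ : Equiv.Perm (Fin (k + l)), ((Equiv.Perm.sign σ : ℤ) : ℝ) *
        (((Equiv.Perm.sign ρ : ℤ) : ℝ) * ∏ i, x (σ (Fin.castAdd l (ρ i))) (f i)) *
        (((Equiv.Perm.sign τ : ℤ) : ℝ) * ∏ j, x (σ (Fin.natAdd k (τ j))) (g j))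
      = eW (Fin.append f g) x := by
    intro ρ τ
    rw [eW_apply]
    refine Eq.trans ?_ (Equiv.sum_comp (Equiv.mulRight (blockPerm ρ τ)) _)
    refine Finset.sum_congr rfl fun σ _ => ?_
    simp only [Equiv.coe_mulRight, Equiv.Perm.sign_mul, sign_blockPerm, Fin.prod_univ_add,
      Equiv.Perm.mul_apply, blockPerm_castAdd, blockPerm_natAdd, Fin.append_left,
      Fin.append_right]
    push_cast
    ring
  have expand : ∀ σ : Equiv.Perm (Fin (k + l)),
      ((Equiv.Perm.sign σ : ℤ) : ℝ) * (eW f fun i => x (σ (Fin.castAdd l i))) *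
        (eW g fun j => x (σ (Fin.natAdd k j)))
      = ∑ ρ : Equiv.Perm (Fin k), ∑ τ : Equiv.Perm (Fin l), ((Equiv.Perm.sign σ : ℤ) : ℝ) *
        (((Equiv.Perm.sign ρ : ℤ) : ℝ) * ∏ i, x (σ (Fin.castAdd l (ρ i))) (f i)) *
        (((Equiv.Perm.sign τ : ℤ) : ℝ) * ∏ j, x (σ (Fin.natAdd k (τ j))) (g j)) := by
    intro σ
    rw [eW_apply, eW_apply, mul_assoc, Finset.sum_mul_sum]
    simp only [Finset.mul_sum, mul_assoc]
  simp only [wedge, expand]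
  rw [Finset.sum_comm]
  simp only [Finset.sum_comm (s := (Finset.univ : Finset (Equiv.Perm (Fin (k + l))))), key,
    Finset.sum_const, Finset.card_univ, Fintype.card_perm, Fintype.card_fin, nsmul_eq_mul]
  have hk : (k.factorial : ℝ) ≠ 0 := by exact_mod_cast k.factorial_ne_zero
  have hl : (l.factorial : ℝ) ≠ 0 := by exact_mod_cast l.factorial_ne_zero
  push_cast
  field_simp

theorem eW_eq_zero {k : ℕ} {f : Fin k → Fin 6} (hf : ¬ Function.Injective f) : eW f = 0 := by
  obtain ⟨i, j, hij, hne⟩ := Function.not_injective_iff.mp hf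
  ext x
  exact Matrix.det_zero_of_column_eq hne fun a => by simp [hij]

theorem eW_eq_of_even_perm {k : ℕ} {f g : Fin k → Fin 6} (σ : Equiv.Perm (Fin k))
    (hσ : Equiv.Perm.sign σ = 1) (hfg : f = g ∘ σ) : eW f = eW g := by
  ext x
  subst hfg
  have hdet := Matrix.det_permute' σ (Matrix.of fun a b => x a (g b))
  rw [hσ, Units.val_one, Int.cast_one, one_mul] at hdet
  exact hdet

theorem om_eq (a₀ a₁ a₃ a₄ : ℝ) :
    om a₀ a₁ a₃ a₄ = (a₀ + a₁) • eW ![0, 1] + (a₀ - a₁) • eW ![2, 3] + a₃ • eW ![0, 3]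
      + (-a₃) • eW ![1, 2] + a₄ • eW ![4, 5] := by
  ext x
  simp only [om, Pi.add_apply, Pi.smul_apply, smul_eq_mul]
  ring

theorem eW_apply_single {k : ℕ} {f : Fin k → Fin 6} (hf : Function.Injective f) :
    eW f (fun i => Pi.single (f i) 1) = 1 := by
  have : (Matrix.of fun a b => (Pi.single (f a) 1 : V) (f b)) = (1 : Matrix _ _ ℝ) := by
    ext a b
    simp [Pi.single_apply, Matrix.one_apply, hf.eq_iff, eq_comm]
  rw [eW, this, Matrix.det_one]

theorem wedge_om_om (a₀ a₁ a₃ a₄ : ℝ) :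
    wedge (om a₀ a₁ a₃ a₄) (om a₀ a₁ a₃ a₄)
      = (2 * (a₀ ^ 2 - a₁ ^ 2 - a₃ ^ 2)) • eW (k := 2 + 2) ![0, 1, 2, 3]
        + (2 * (a₀ + a₁) * a₄) • eW (k := 2 + 2) ![0, 1, 4, 5]
        + (2 * (a₀ - a₁) * a₄) • eW (k := 2 + 2) ![2, 3, 4, 5]
        + (2 * a₃ * a₄) • eW (k := 2 + 2) ![0, 3, 4, 5]
        + (-(2 * a₃ * a₄)) • eW (k := 2 + 2) ![1, 2, 4, 5] := by
  have h01_23 : eW (Fin.append ![0, 1] ![2, 3]) = eW (k := 2 + 2) ![0, 1, 2, 3] :=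
    eW_eq_of_even_perm 1 (by decide) (by decide)
  have h01_45 : eW (Fin.append ![0, 1] ![4, 5]) = eW (k := 2 + 2) ![0, 1, 4, 5] :=
    eW_eq_of_even_perm 1 (by decide) (by decide)
  have h23_01 : eW (Fin.append ![2, 3] ![0, 1]) = eW (k := 2 + 2) ![0, 1, 2, 3] :=
    eW_eq_of_even_perm (Equiv.swap 1 3 * Equiv.swap 0 2) (by decide) (by decide)
  have h23_45 : eW (Fin.append ![2, 3] ![4, 5]) = eW (k := 2 + 2) ![2, 3, 4, 5] :=
    eW_eq_of_even_perm 1 (by decide) (by decide)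
  have h03_12 : eW (Fin.append ![0, 3] ![1, 2]) = eW (k := 2 + 2) ![0, 1, 2, 3] :=
    eW_eq_of_even_perm (Equiv.swap 2 3 * Equiv.swap 1 2) (by decide) (by decide)
  have h03_45 : eW (Fin.append ![0, 3] ![4, 5]) = eW (k := 2 + 2) ![0, 3, 4, 5] :=
    eW_eq_of_even_perm 1 (by decide) (by decide)
  have h12_03 : eW (Fin.append ![1, 2] ![0, 3]) = eW (k := 2 + 2) ![0, 1, 2, 3] :=
    eW_eq_of_even_perm (Equiv.swap 1 2 * Equiv.swap 0 2) (by decide) (by decide)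
  have h12_45 : eW (Fin.append ![1, 2] ![4, 5]) = eW (k := 2 + 2) ![1, 2, 4, 5] :=
    eW_eq_of_even_perm 1 (by decide) (by decide)
  have h45_01 : eW (Fin.append ![4, 5] ![0, 1]) = eW (k := 2 + 2) ![0, 1, 4, 5] :=
    eW_eq_of_even_perm (Equiv.swap 1 3 * Equiv.swap 0 2) (by decide) (by decide)
  have h45_23 : eW (Fin.append ![4, 5] ![2, 3]) = eW (k := 2 + 2) ![2, 3, 4, 5] :=
    eW_eq_of_even_perm (Equiv.swap 1 3 * Equiv.swap 0 2) (by decide) (by decide)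
  have h45_03 : eW (Fin.append ![4, 5] ![0, 3]) = eW (k := 2 + 2) ![0, 3, 4, 5] :=
    eW_eq_of_even_perm (Equiv.swap 1 3 * Equiv.swap 0 2) (by decide) (by decide)
  have h45_12 : eW (Fin.append ![4, 5] ![1, 2]) = eW (k := 2 + 2) ![1, 2, 4, 5] :=
    eW_eq_of_even_perm (Equiv.swap 1 3 * Equiv.swap 0 2) (by decide) (by decide)
  rw [om_eq]
  simp (disch := decide) only [wedge_add_left, wedge_add_right, wedge_smul_left,
    wedge_smul_right, wedge_eW, eW_eq_zero,
    h01_23, h01_45, h23_01, h23_45, h03_12, h03_45,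
    h12_03, h12_45, h45_01, h45_23, h45_03, h45_12,
    smul_zero, add_zero, zero_add]
  module

theorem wedge_om_om_om (a₀ a₁ a₃ a₄ : ℝ) :
    wedge (wedge (om a₀ a₁ a₃ a₄) (om a₀ a₁ a₃ a₄)) (om a₀ a₁ a₃ a₄)
      = (6 * a₄ * (a₀ ^ 2 - a₁ ^ 2 - a₃ ^ 2)) • eW (k := 2 + 2 + 2) ![0, 1, 2, 3, 4, 5] := by
  have h0123_45 : eW (Fin.append (m := 2 + 2) ![0, 1, 2, 3] ![4, 5])
      = eW (k := 2 + 2 + 2) ![0, 1, 2, 3, 4, 5] :=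
    eW_eq_of_even_perm 1 (by decide) (by decide)
  have h0145_23 : eW (Fin.append (m := 2 + 2) ![0, 1, 4, 5] ![2, 3])
      = eW (k := 2 + 2 + 2) ![0, 1, 2, 3, 4, 5] :=
    eW_eq_of_even_perm (Equiv.swap 3 5 * Equiv.swap 2 4) (by decide) (by decide)
  have h2345_01 : eW (Fin.append ![2, 3, 4, 5] ![0, 1]) = eW (k := 2 + 2 + 2) ![0, 1, 2, 3, 4, 5] :=
    eW_eq_of_even_perm (Equiv.swap 3 5 * Equiv.swap 2 4 * Equiv.swap 1 5 * Equiv.swap 0 4)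
      (by decide) (by decide)
  have h0345_12 : eW (Fin.append (m := 2 + 2) ![0, 3, 4, 5] ![1, 2])
      = eW (k := 2 + 2 + 2) ![0, 1, 2, 3, 4, 5] :=
    eW_eq_of_even_perm (Equiv.swap 4 5 * Equiv.swap 3 4 * Equiv.swap 2 5 * Equiv.swap 1 4)
      (by decide) (by decide)
  have h1245_03 : eW (Fin.append ![1, 2, 4, 5] ![0, 3]) = eW (k := 2 + 2 + 2) ![0, 1, 2, 3, 4, 5] :=
    eW_eq_of_even_perm (Equiv.swap 3 5 * Equiv.swap 2 4 * Equiv.swap 1 4 * Equiv.swap 0 4)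
      (by decide) (by decide)
  rw [wedge_om_om, om_eq]
  simp (disch := decide) only [wedge_add_left, wedge_add_right, wedge_smul_left,
    wedge_smul_right, wedge_eW, eW_eq_zero,
    h0123_45, h0145_23, h2345_01, h0345_12, h1245_03,
    smul_zero, add_zero, zero_add]
  module

theorem projected_bracket_eq {pb : V → V → V} {h : V → V → ℝ}
    (hbr : ∀ x y : V, brG (Φ x) (Φ y) = Φ (pb x y) + h x y • W) (x y : V) :
    pb x y = ![2 * (x 1 * y 4 - x 4 * y 1), 2 * (x 4 * y 0 - x 0 * y 4),
      2 * (x 4 * y 3 - x 3 * y 4), 2 * (x 2 * y 4 - x 4 * y 2),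
      (x 0 * y 1 - x 1 * y 0) - (x 2 * y 3 - x 3 * y 2), 0] := by
  have e := hbr x y
  have e₁ := congrArg (fun a : G => a.1) e
  have e₂ := congrArg (fun a : G => a.2.1) e
  have e₃ := congrArg (fun a : G => a.2.2) e
  have c₁ := congrFun (congrFun e₁ 0) 0
  have c₂ := congrFun (congrFun e₁ 0) 1
  have c₃ := congrFun (congrFun e₂ 0) 0
  have c₄ := congrFun (congrFun e₂ 0) 1
  simp [brG, Φ, E, W, Fin.sum_univ_six, σ1, σ2, σ3, Complex.ext_iff] at c₁ c₂ c₃ c₄ e₃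
  ext i
  fin_cases i <;> simp <;> linarith

theorem D2_om {pb : V → V → V} {h : V → V → ℝ}
    (hbr : ∀ x y : V, brG (Φ x) (Φ y) = Φ (pb x y) + h x y • W) (a₀ a₁ a₃ a₄ : ℝ) :
    D2 pb (om a₀ a₁ a₃ a₄) = (4 * a₃) • eW ![0, 2, 4] + (4 * a₃) • eW ![1, 3, 4]
      + (-a₄) • eW ![0, 1, 5] + a₄ • eW ![2, 3, 5] := by
  ext x
  simp only [D2, om, eW, projected_bracket_eq hbr, Matrix.det_fin_two, Matrix.det_fin_three,
    Pi.add_apply, Pi.smul_apply, smul_eq_mul, Matrix.of_apply]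
  simp
  ring

theorem wedge_D2_om_om {pb : V → V → V} {h : V → V → ℝ}
    (hbr : ∀ x y : V, brG (Φ x) (Φ y) = Φ (pb x y) + h x y • W) (a₀ a₁ a₃ a₄ : ℝ) :
    wedge (D2 pb (om a₀ a₁ a₃ a₄)) (om a₀ a₁ a₃ a₄)
      = (2 * a₁ * a₄) • eW (k := 3 + 2) ![0, 1, 2, 3, 5] := by
  have h015_23 : eW (Fin.append ![0, 1, 5] ![2, 3]) = eW (k := 3 + 2) ![0, 1, 2, 3, 5] :=
    eW_eq_of_even_perm (Equiv.swap 3 4 * Equiv.swap 2 3) (by decide) (by decide)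
  have h235_01 : eW (Fin.append ![2, 3, 5] ![0, 1]) = eW (k := 3 + 2) ![0, 1, 2, 3, 5] :=
    eW_eq_of_even_perm (Equiv.swap 3 4 * Equiv.swap 2 3 * Equiv.swap 1 4 * Equiv.swap 0 3)
      (by decide) (by decide)
  rw [D2_om hbr, om_eq]
  simp (disch := decide) only [wedge_add_left, wedge_add_right, wedge_smul_left,
    wedge_smul_right, wedge_eW, eW_eq_zero,
    h015_23, h235_01,
    smul_zero, add_zero, zero_add]
  module

/-- for the generic invariant 2-form `ω` on the homogeneous space
`V^{4,2} × S¹`: `(i) ω³ = 6a₄(a₀²−a₁²−a₃²)e^{123456}`, `(ii) Dω∧ω = 2a₁a₄e^{12346}`,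
`(iii)` if `ω³ ≠ 0` then `Dω ≠ 0` (`ω` cannot be symplectic), and `(iv)` if
`ω³ ≠ 0` then `Dω∧ω = 0 ↔ a₁ = 0`.  Here `D` is the projected Chevalley–Eilenberg
differential of the splitting `𝔤 = 𝔫 ⊕ 𝔥`, and the projected bracket is
characterized by `⁅Φ(x), Φ(y)⁆ = Φ(pb x y) + h(x,y)·(σ₁,σ₁,0)`. -/
theorem omega_V42 (a₀ a₁ a₃ a₄ : ℝ) (pb : V → V → V) (h : V → V → ℝ)
    (hbr : ∀ x y : V, brG (Φ x) (Φ y) = Φ (pb x y) + h x y • W) :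
    (wedge (wedge (om a₀ a₁ a₃ a₄) (om a₀ a₁ a₃ a₄)) (om a₀ a₁ a₃ a₄)
        = fun x => 6 * a₄ * (a₀ ^ 2 - a₁ ^ 2 - a₃ ^ 2) * eW ![0, 1, 2, 3, 4, 5] x) ∧
    (wedge (D2 pb (om a₀ a₁ a₃ a₄)) (om a₀ a₁ a₃ a₄)
        = fun x => 2 * a₁ * a₄ * eW ![0, 1, 2, 3, 5] x) ∧
    (wedge (wedge (om a₀ a₁ a₃ a₄) (om a₀ a₁ a₃ a₄)) (om a₀ a₁ a₃ a₄) ≠ 0 →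
      D2 pb (om a₀ a₁ a₃ a₄) ≠ 0) ∧
    (wedge (wedge (om a₀ a₁ a₃ a₄) (om a₀ a₁ a₃ a₄)) (om a₀ a₁ a₃ a₄) ≠ 0 →
      (wedge (D2 pb (om a₀ a₁ a₃ a₄)) (om a₀ a₁ a₃ a₄) = 0 ↔ a₁ = 0)) := by
  have hcube := wedge_om_om_om a₀ a₁ a₃ a₄
  have hD := wedge_D2_om_om hbr a₀ a₁ a₃ a₄
  have a₄_ne : wedge (wedge (om a₀ a₁ a₃ a₄) (om a₀ a₁ a₃ a₄)) (om a₀ a₁ a₃ a₄) ≠ 0 →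
      a₄ ≠ 0 := by
    rintro hne rfl
    exact hne (by rw [hcube]; simp)
  refine ⟨hcube, hD, fun hne hzero => a₄_ne hne ?_, fun hne => ⟨fun hzero => ?_, fun ha => ?_⟩⟩
  · have hval := congrFun hzero ![Pi.single 2 1, Pi.single 3 1, Pi.single 5 1]
    rw [D2_om hbr] at hval
    simpa [eW, Matrix.det_fin_three] using hval
  · have hval := congrFun hzero fun i => Pi.single ((![0, 1, 2, 3, 5] : Fin 5 → Fin 6) i) 1
    rw [hD, Pi.smul_apply, eW_apply_single (by decide)] at hval
    simpa [a₄_ne hne] using hval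
  · rw [hD, ha]
    simp

end Stmt14
end

section
/- Let 𝔤 = 𝔰𝔲(2) × 𝔰𝔲(2) × 𝔰𝔲(2), let 𝔪 = span(e₁,…,e₇) where e₁ = (σ₂,0,0), e₂ = (σ₃,0,0), e₃ = (0,σ₂,0), e₄ = (0,σ₃,0), e₅ = (0,0,σ₂), e₆ = (0,0,σ₃), e₇ = (σ₁,σ₁,σ₁), and let 𝔥 = span((σ₁,0,−σ₁), (0,σ₁,−σ₁)), so that 𝔤 = 𝔪 ⊕ 𝔥. Let α be any alternating 2-form on 𝔪 satisfying α(π(⁅W,x⁆), y) + α(x, π(⁅W,y⁆)) = 0 for all W ∈ 𝔥 and x, y ∈ 𝔪 (i.e., α is ad(𝔥)-invariant). Then Dα = 0. (This is the statement that every invariant 2-form on the homogeneous space Q^{1,1,1} = SU(2)³/U(1)² is closed.) -/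
open scoped BigOperators

namespace Stmt15

open Complex (I)

/-- The ambient space containing `𝔤 = 𝔰𝔲(2) × 𝔰𝔲(2) × 𝔰𝔲(2)`. -/
abbrev G3 : Type :=
  Matrix (Fin 2) (Fin 2) ℂ × Matrix (Fin 2) (Fin 2) ℂ × Matrix (Fin 2) (Fin 2) ℂ

noncomputable def σ1 : Matrix (Fin 2) (Fin 2) ℂ := !![I, 0; 0, -I]
noncomputable def σ2 : Matrix (Fin 2) (Fin 2) ℂ := !![0, 1; -1, 0]
noncomputable def σ3 : Matrix (Fin 2) (Fin 2) ℂ := !![0, I; I, 0]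

/-- The Lie bracket of `𝔤` (componentwise commutators). -/
noncomputable def brG (a b : G3) : G3 :=
  (a.1 * b.1 - b.1 * a.1, a.2.1 * b.2.1 - b.2.1 * a.2.1,
    a.2.2 * b.2.2 - b.2.2 * a.2.2)

/-- The basis `(e₁,…,e₇)` of the complement `𝔪`. -/
noncomputable def E : Fin 7 → G3 :=
  ![(σ2, 0, 0), (σ3, 0, 0), (0, σ2, 0), (0, σ3, 0), (0, 0, σ2), (0, 0, σ3),
    (σ1, σ1, σ1)]

/-- The basis of `𝔥 = span((σ₁,0,−σ₁), (0,σ₁,−σ₁))`. -/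
noncomputable def W : Fin 2 → G3 :=
  ![(σ1, 0, -σ1), (0, σ1, -σ1)]

/-- Coordinates on `𝔪`. -/
abbrev V : Type := Fin 7 → ℝ

/-- The identification of coordinates with elements of `𝔪`: `v ↦ Σᵢ vᵢ eᵢ`. -/
noncomputable def Φ (v : V) : G3 := ∑ i, v i • E i

/-- The projected Chevalley–Eilenberg differential of a 2-form, for the projected
bracket `pb`. -/
def D2 (pb : V → V → V) (α : (Fin 2 → V) → ℝ) : (Fin 3 → V) → ℝ :=
  fun x =>
    -α ![pb (x 0) (x 1), x 2] + α ![pb (x 0) (x 2), x 1] - α ![pb (x 1) (x 2), x 0]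

/-- The bracket of `𝔰𝔲(2)` in the basis `σ₁, σ₂, σ₃`. -/
lemma commutator_smul_σ (a b c a' b' c' : ℝ) :
    (a • σ1 + b • σ2 + c • σ3) * (a' • σ1 + b' • σ2 + c' • σ3) -
        (a' • σ1 + b' • σ2 + c' • σ3) * (a • σ1 + b • σ2 + c • σ3) =
      (2 * (b * c' - c * b')) • σ1 + (2 * (c * a' - a * c')) • σ2 +
        (2 * (a * b' - b * a')) • σ3 := by
  ext i j
  fin_cases i <;> fin_cases j <;> apply Complex.ext <;>
    simp [σ1, σ2, σ3] <;> ring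

/-- `σ₁, σ₂, σ₃` are linearly independent over `ℝ`. -/
lemma smul_σ_inj {a b c a' b' c' : ℝ}
    (h : a • σ1 + b • σ2 + c • σ3 = a' • σ1 + b' • σ2 + c' • σ3) :
    a = a' ∧ b = b' ∧ c = c' := by
  have h0 := congrArg Complex.im (congrFun (congrFun h 0) 0)
  have h1 := congrArg Complex.re (congrFun (congrFun h 0) 1)
  have h2 := congrArg Complex.im (congrFun (congrFun h 0) 1)
  simp [σ1, σ2, σ3] at h0 h1 h2
  exact ⟨h0, h1, h2⟩

lemma Φ_add_sum_W (v : V) (c : Fin 2 → ℝ) :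
    Φ v + ∑ j, c j • W j =
      ((v 6 + c 0) • σ1 + v 0 • σ2 + v 1 • σ3,
        (v 6 + c 1) • σ1 + v 2 • σ2 + v 3 • σ3,
        (v 6 - c 0 - c 1) • σ1 + v 4 • σ2 + v 5 • σ3) := by
  refine Prod.ext ?_ (Prod.ext ?_ ?_) <;>
    simp [Φ, E, W, Fin.sum_univ_succ] <;> module

lemma Φ_eq (v : V) :
    Φ v = (v 6 • σ1 + v 0 • σ2 + v 1 • σ3, v 6 • σ1 + v 2 • σ2 + v 3 • σ3,
      v 6 • σ1 + v 4 • σ2 + v 5 • σ3) := by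
  simpa using Φ_add_sum_W v 0

lemma sum_W_eq (c : Fin 2 → ℝ) :
    ∑ j, c j • W j = (c 0 • σ1 + (0 : ℝ) • σ2 + (0 : ℝ) • σ3,
      c 1 • σ1 + (0 : ℝ) • σ2 + (0 : ℝ) • σ3,
      (-c 0 - c 1) • σ1 + (0 : ℝ) • σ2 + (0 : ℝ) • σ3) := by
  simpa [Φ] using Φ_add_sum_W 0 c

/-- The projected bracket on `𝔪` in coordinates. -/
noncomputable def projBracket (x y : V) : V :=
  ![2 * (x 1 * y 6 - x 6 * y 1), 2 * (x 6 * y 0 - x 0 * y 6),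
    2 * (x 3 * y 6 - x 6 * y 3), 2 * (x 6 * y 2 - x 2 * y 6),
    2 * (x 5 * y 6 - x 6 * y 5), 2 * (x 6 * y 4 - x 4 * y 6),
    2 / 3 * ((x 0 * y 1 - x 1 * y 0) + (x 2 * y 3 - x 3 * y 2) + (x 4 * y 5 - x 5 * y 4))]

lemma eq_projBracket {x y v : V} {c : Fin 2 → ℝ}
    (h : brG (Φ x) (Φ y) = Φ v + ∑ j, c j • W j) : v = projBracket x y := by
  rw [Φ_add_sum_W, Φ_eq, Φ_eq] at h
  simp only [brG, commutator_smul_σ, Prod.mk.injEq] at h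
  obtain ⟨h0, h1, h2⟩ := h
  obtain ⟨a0, b0, c0⟩ := smul_σ_inj h0
  obtain ⟨a1, b1, c1⟩ := smul_σ_inj h1
  obtain ⟨a2, b2, c2⟩ := smul_σ_inj h2
  ext i
  fin_cases i <;> simp [projBracket] <;> linarith

/-- The action of `Σⱼ cⱼ·Wⱼ ∈ 𝔥` on `𝔪` in coordinates. -/
def isotropyAction (c : Fin 2 → ℝ) (x : V) : V :=
  ![-2 * c 0 * x 1, 2 * c 0 * x 0, -2 * c 1 * x 3, 2 * c 1 * x 2,
    2 * (c 0 + c 1) * x 5, -2 * (c 0 + c 1) * x 4, 0]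

lemma brG_sum_W_Φ (c : Fin 2 → ℝ) (x : V) :
    brG (∑ j, c j • W j) (Φ x) =
      Φ (isotropyAction c x) + ∑ j, (0 : Fin 2 → ℝ) j • W j := by
  rw [Φ_add_sum_W, Φ_eq, sum_W_eq]
  simp only [brG, commutator_smul_σ, isotropyAction]
  refine Prod.ext ?_ (Prod.ext ?_ ?_) <;> simp <;> module

lemma alternating_two_swap (α : AlternatingMap ℝ V ℝ (Fin 2)) (x y : V) :
    α ![x, y] = -α ![y, x] := by
  have h := α.map_swap ![y, x] (show (0 : Fin 2) ≠ 1 by decide)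
  rw [← h]
  congr 1
  ext i
  fin_cases i <;> rfl

lemma alternating_two_eq_sum_left (α : AlternatingMap ℝ V ℝ (Fin 2)) (x y : V) :
    α ![x, y] = ∑ i, x i * α ![Pi.single i 1, y] := by
  let L : V →ₗ[ℝ] ℝ :=
    { toFun := fun z => α ![z, y]
      map_add' := fun u v => α.map_vecCons_add ![y] u v
      map_smul' := fun c v => α.map_vecCons_smul ![y] c v }
  have h : L x = ∑ i, x i • L (Pi.single i 1) := by
    conv_lhs => rw [← (Pi.basisFun ℝ (Fin 7)).sum_repr x]
    simp only [map_sum, map_smul, Pi.basisFun_repr, Pi.basisFun_apply]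
  exact h

lemma alternating_two_eq_sum (α : AlternatingMap ℝ V ℝ (Fin 2)) (x y : V) :
    α ![x, y] = ∑ i, ∑ j, x i * y j * α ![Pi.single i 1, Pi.single j 1] := by
  rw [alternating_two_eq_sum_left]
  refine Finset.sum_congr rfl fun i _ => ?_
  rw [alternating_two_swap, alternating_two_eq_sum_left, ← Finset.sum_neg_distrib, Finset.mul_sum]
  refine Finset.sum_congr rfl fun j _ => ?_
  rw [alternating_two_swap α (Pi.single j 1)]
  ring

/-- An `ad(𝔥)`-invariant 2-form on `𝔪` is a combination of `e¹²`, `e³⁴` and `e⁵⁶`. -/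
lemma exists_eq_of_isotropy_invariant (α : AlternatingMap ℝ V ℝ (Fin 2))
    (h : ∀ c x y, α ![isotropyAction c x, y] + α ![x, isotropyAction c y] = 0) :
    ∃ p q r : ℝ, ∀ x y : V, α ![x, y] = p * (x 0 * y 1 - x 1 * y 0) +
      q * (x 2 * y 3 - x 3 * y 2) + r * (x 4 * y 5 - x 5 * y 4) := by
  obtain ⟨A, hA⟩ : ∃ A : Fin 7 → Fin 7 → ℝ, ∀ i j, A i j = α ![Pi.single i 1, Pi.single j 1] :=
    ⟨_, fun _ _ => rfl⟩
  have hα (x y : V) : α ![x, y] = ∑ i, ∑ j, x i * y j * A i j := by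
    simp only [hA]
    exact alternating_two_eq_sum α x y
  have hs (i j) : A i j = -A j i := by
    rw [hA, hA]
    exact alternating_two_swap α _ _
  have hB (c : Fin 2 → ℝ) (i j : Fin 7) :
      ∑ k, isotropyAction c (Pi.single i 1) k * A k j +
        ∑ k, isotropyAction c (Pi.single j 1) k * A i k = 0 := by
    have := h c (Pi.single i 1) (Pi.single j 1)
    simpa [hα, Pi.single_apply] using this
  have hB0 (i j) := hB ![1, 0] i j
  have hB1 (i j) := hB ![0, 1] i j
  clear hB h
  simp only [Fin.forall_fin_succ] at hB0 hB1
  simp [isotropyAction, Fin.sum_univ_succ, Pi.single_apply] at hB0 hB1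
  have hd (i) : A i i = 0 := by linarith [hs i i]
  refine ⟨A 0 1, A 2 3, A 4 5, fun x y => ?_⟩
  rw [hα]
  simp [Fin.sum_univ_succ, hB0, hB1, hd, hs 1 0, hs 3 2, hs 5 4]
  ring

/-- every `ad(𝔥)`-invariant alternating 2-form `α` on `𝔪` satisfies
`Dα = 0`; i.e. every invariant 2-form on `Q^{1,1,1} = SU(2)³/U(1)²` is closed.
The projected bracket is characterized by
`⁅Φ(x), Φ(y)⁆ = Φ(pb x y) + Σⱼ cc(x,y)ⱼ·Wⱼ`, and invariance is stated for all
`w = Σⱼ cⱼ·Wⱼ ∈ 𝔥`, with `π(⁅w, Φ(x)⁆)` characterized analogously. -/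
theorem invariant_two_forms_closed_Q111
    (α : AlternatingMap ℝ V ℝ (Fin 2))
    (pb : V → V → V) (cc : V → V → Fin 2 → ℝ)
    (hbr : ∀ x y : V, brG (Φ x) (Φ y) = Φ (pb x y) + ∑ j, cc x y j • W j)
    (hinv : ∀ (c : Fin 2 → ℝ) (aw : V → V) (cw : V → Fin 2 → ℝ),
      (∀ x : V, brG (∑ j, c j • W j) (Φ x) = Φ (aw x) + ∑ j, cw x j • W j) →
      ∀ x y : V, α ![aw x, y] + α ![x, aw y] = 0) :
    D2 pb ⇑α = 0 := by
  obtain ⟨p, q, r, hα⟩ := exists_eq_of_isotropy_invariant α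
    fun c => hinv c (isotropyAction c) (fun _ => 0) (brG_sum_W_Φ c)
  ext x
  have hpb (x y : V) : pb x y = projBracket x y := eq_projBracket (hbr x y)
  simp only [D2, hpb, hα]
  simp [projBracket]
  ring

end Stmt15
end

section
/- In 𝔰𝔲(3), set e₁ = diag(−i,i,0), e₂ = [[0,1,0],[−1,0,0],[0,0,0]], e₃ = [[0,i,0],[i,0,0],[0,0,0]], e₄ = [[0,0,1],[0,0,0],[−1,0,0]], e₅ = [[0,0,i],[0,0,0],[i,0,0]], e₆ = [[0,0,0],[0,0,1],[0,−1,0]], e₇ = [[0,0,0],[0,0,i],[0,i,0]], e₈ = diag(i,i,−2i). Let 𝔤 = 𝔰𝔲(3) × 𝔰𝔲(2), let 𝔥 = span((e₁,0), (e₂,0), (e₃,0), (e₈,3σ₁)), and let 𝔪 = span(f₁,…,f₇) where f₁ = (e₄,0), f₂ = (e₅,0), f₃ = (e₆,0), f₄ = (e₇,0), f₅ = (0,σ₂), f₆ = (0,σ₃), f₇ = (e₈,0), so that 𝔤 = 𝔪 ⊕ 𝔥. Let α be any alternating 2-form on 𝔪 satisfying α(π(⁅W,x⁆), y) + α(x,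 π(⁅W,y⁆)) = 0 for all W ∈ 𝔥 and x, y ∈ 𝔪 (i.e., α is ad(𝔥)-invariant). Then Dα = 0. (This is the statement that every invariant 2-form on the homogeneous space M^{1,1,0} = SU(3)×SU(2)/(SU(2)×U(1)) is closed.) -/
open scoped BigOperators

namespace Stmt17

open Complex (I)

/-- The ambient space containing `𝔤 = 𝔰𝔲(3) × 𝔰𝔲(2)`. -/
abbrev G : Type := Matrix (Fin 3) (Fin 3) ℂ × Matrix (Fin 2) (Fin 2) ℂ

noncomputable def σ1 : Matrix (Fin 2) (Fin 2) ℂ := !![I, 0; 0, -I]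
noncomputable def σ2 : Matrix (Fin 2) (Fin 2) ℂ := !![0, 1; -1, 0]
noncomputable def σ3 : Matrix (Fin 2) (Fin 2) ℂ := !![0, I; I, 0]

/-- The basis `(e₁,…,e₈)` of `𝔰𝔲(3)` used in Statement 17. -/
noncomputable def e : Fin 8 → Matrix (Fin 3) (Fin 3) ℂ :=
  ![!![-I, 0, 0; 0, I, 0; 0, 0, 0],
    !![0, 1, 0; -1, 0, 0; 0, 0, 0],
    !![0, I, 0; I, 0, 0; 0, 0, 0],
    !![0, 0, 1; 0, 0, 0; -1, 0, 0],
    !![0, 0, I; 0, 0, 0; I, 0, 0],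
    !![0, 0, 0; 0, 0, 1; 0, -1, 0],
    !![0, 0, 0; 0, 0, I; 0, I, 0],
    !![I, 0, 0; 0, I, 0; 0, 0, -2 * I]]

/-- The Lie bracket of `𝔤` (componentwise commutators). -/
noncomputable def brG (a b : G) : G :=
  (a.1 * b.1 - b.1 * a.1, a.2 * b.2 - b.2 * a.2)

/-- The basis `((e₁,0), (e₂,0), (e₃,0), (e₈,3σ₁))` of `𝔥 = 𝔰𝔲(2) ⊕ ℝ`. -/
noncomputable def W : Fin 4 → G :=
  ![(e 0, 0), (e 1, 0), (e 2, 0), (e 7, (3 : ℂ) • σ1)]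

/-- The basis `(f₁,…,f₇)` of the complement `𝔪`. -/
noncomputable def F : Fin 7 → G :=
  ![(e 3, 0), (e 4, 0), (e 5, 0), (e 6, 0), (0, σ2), (0, σ3), (e 7, 0)]

/-- Coordinates on `𝔪`. -/
abbrev V : Type := Fin 7 → ℝ

/-- The identification of coordinates with elements of `𝔪`: `v ↦ Σᵢ vᵢ fᵢ`. -/
noncomputable def Φ (v : V) : G := ∑ i, v i • F i

/-- The projected Chevalley–Eilenberg differential of a 2-form, for the projected
bracket `pb`. -/
def D2 (pb : V → V → V) (α : (Fin 2 → V) → ℝ) : (Fin 3 → V) → ℝ :=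
  fun x =>
    -α ![pb (x 0) (x 1), x 2] + α ![pb (x 0) (x 2), x 1] - α ![pb (x 1) (x 2), x 0]

/-- The `𝔰𝔲(3)`-component of `Φ v` as an explicit matrix. -/
lemma Φ_fst (v : V) : (Φ v).1 =
    !![v 6 * I, 0, v 0 + v 1 * I; 0, v 6 * I, v 2 + v 3 * I;
      -v 0 + v 1 * I, -v 2 + v 3 * I, -2 * v 6 * I] := by
  ext i j
  fin_cases i <;> fin_cases j <;> simp [Φ, F, e, Fin.sum_univ_succ]
  ring

/-- The `𝔰𝔲(2)`-component of `Φ v` as an explicit matrix. -/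
lemma Φ_snd (v : V) : (Φ v).2 = !![0, v 4 + v 5 * I; -v 4 + v 5 * I, 0] := by
  ext i j
  fin_cases i <;> fin_cases j <;> simp [Φ, F, σ2, σ3, Fin.sum_univ_succ]

/-- The `𝔰𝔲(3)`-component of an element of `𝔥` as an explicit matrix. -/
lemma sum_W_fst (c : Fin 4 → ℝ) : (∑ j, c j • W j).1 =
    !![(c 3 - c 0) * I, c 1 + c 2 * I, 0; -c 1 + c 2 * I, (c 3 + c 0) * I, 0;
      0, 0, -2 * c 3 * I] := by
  ext i j
  fin_cases i <;> fin_cases j <;> simp [W, e, Fin.sum_univ_succ] <;> ring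

/-- The `𝔰𝔲(2)`-component of an element of `𝔥` as an explicit matrix. -/
lemma sum_W_snd (c : Fin 4 → ℝ) :
    (∑ j, c j • W j).2 = !![3 * c 3 * I, 0; 0, -3 * c 3 * I] := by
  ext i j
  fin_cases i <;> fin_cases j <;> simp [W, σ1, Fin.sum_univ_succ] <;> ring

/-- The projected bracket on `𝔪` in coordinates. -/
lemma projected_bracket_eq {x y p : V} {c : Fin 4 → ℝ}
    (h : brG (Φ x) (Φ y) = Φ p + ∑ j, c j • W j) :
    p = ![-3 * (x 6 * y 1 - y 6 * x 1), 3 * (x 6 * y 0 - y 6 * x 0),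
      -3 * (x 6 * y 3 - y 6 * x 3), 3 * (x 6 * y 2 - y 6 * x 2), 0, 0,
      x 0 * y 1 - x 1 * y 0 + x 2 * y 3 - x 3 * y 2 + 2 / 3 * (x 5 * y 4 - x 4 * y 5)] := by
  have h₁ := congrArg Prod.fst h
  have h₂ := congrArg Prod.snd h
  simp only [brG, Prod.fst_add, Prod.snd_add, Φ_fst, Φ_snd, sum_W_fst, sum_W_snd] at h₁ h₂
  have h02 := congrFun (congrFun h₁ 0) 2
  have h12 := congrFun (congrFun h₁ 1) 2
  have h22 := congrFun (congrFun h₁ 2) 2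
  have k00 := congrFun (congrFun h₂ 0) 0
  have k01 := congrFun (congrFun h₂ 0) 1
  simp [Complex.ext_iff] at h02 h12 h22 k00 k01
  ext i
  fin_cases i <;> simp <;> linarith

/-- The action of `𝔥` on `𝔪` in coordinates. -/
def isotropy (c : Fin 4 → ℝ) (x : V) : V :=
  ![(c 0 - 3 * c 3) * x 1 + c 1 * x 2 - c 2 * x 3,
    (3 * c 3 - c 0) * x 0 + c 1 * x 3 + c 2 * x 2,
    -(c 0 + 3 * c 3) * x 3 - c 1 * x 0 - c 2 * x 1,
    (c 0 + 3 * c 3) * x 2 - c 1 * x 1 + c 2 * x 0,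
    -6 * c 3 * x 5, 6 * c 3 * x 4, 0]

/-- The complement `𝔪` is `ad(𝔥)`-stable, and `𝔥` acts on it by `isotropy`. -/
lemma brG_sum_W_Φ (c : Fin 4 → ℝ) (x : V) :
    brG (∑ j, c j • W j) (Φ x) = Φ (isotropy c x) + ∑ j, (0 : Fin 4 → ℝ) j • W j := by
  refine Prod.ext ?_ ?_
  · simp only [brG, Prod.fst_add, Φ_fst, sum_W_fst]
    ext i j
    fin_cases i <;> fin_cases j <;>
      simp [isotropy, Complex.ext_iff] <;>
      (try constructor) <;> ring
  · simp only [brG, Prod.snd_add, Φ_snd, sum_W_snd]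
    ext i j
    fin_cases i <;> fin_cases j <;>
      simp [isotropy, Complex.ext_iff] <;>
      (try constructor) <;> ring

/-- An alternating 2-form expands in coordinates. -/
lemma alternating_two_form_eq_sum {n : ℕ} (α : AlternatingMap ℝ (Fin n → ℝ) ℝ (Fin 2))
    (x y : Fin n → ℝ) :
    α ![x, y] = ∑ i, ∑ j, x i * y j * α ![Pi.single i 1, Pi.single j 1] := by
  have hl (a b c : Fin n → ℝ) : Function.update ![a, b] 0 c = ![c, b] := by
    ext k
    fin_cases k <;> simp
  have hr (a b c : Fin n → ℝ) : Function.update ![a, b] 1 c = ![a, c] := by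
    ext k
    fin_cases k <;> simp
  let B := LinearMap.mk₂ ℝ (fun x y => α ![x, y])
    (fun a b c => by simpa only [hl] using α.map_update_add ![a, c] 0 a b)
    (fun r a c => by simpa only [hl] using α.map_update_smul ![a, c] 0 r a)
    (fun c a b => by simpa only [hr] using α.map_update_add ![c, a] 1 a b)
    (fun r c a => by simpa only [hr] using α.map_update_smul ![c, a] 1 r a)
  have h : B x y = ∑ i, ∑ j, x i * y j * B (Pi.single i 1) (Pi.single j 1) := by
    conv_lhs => rw [pi_eq_sum_univ' x, pi_eq_sum_univ' y]
    simp only [map_sum, map_smul, LinearMap.sum_apply, LinearMap.smul_apply, smul_eq_mul,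
      Finset.mul_sum, mul_assoc]
    rw [Finset.sum_comm]
    simp only [mul_left_comm]
  exact h

/-- Every `ad(𝔥)`-invariant 2-form on `𝔪` is a combination of the two standard ones. -/
lemma invariant_two_form_eq (α : AlternatingMap ℝ V ℝ (Fin 2))
    (hα : ∀ c x y, α ![isotropy c x, y] + α ![x, isotropy c y] = 0) :
    ∃ a b : ℝ, ∀ x y, α ![x, y] =
      a * (x 0 * y 1 - x 1 * y 0 + x 2 * y 3 - x 3 * y 2) + b * (x 4 * y 5 - x 5 * y 4) := by
  have hself (i : Fin 7) : α ![Pi.single i 1, Pi.single i 1] = 0 :=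
    α.map_eq_zero_of_eq _ (i := 0) (j := 1) (by simp) (by simp)
  have hswap (i j : Fin 7) :
      α ![Pi.single i 1, Pi.single j 1] = -α ![Pi.single j 1, Pi.single i 1] := by
    have := α.map_swap ![Pi.single j 1, Pi.single i 1] (i := 0) (j := 1) (by simp)
    rw [← this]
    congr 1
    ext k
    fin_cases k <;> simp
  have hexp := alternating_two_form_eq_sum α
  have hmat (c : Fin 4 → ℝ) (i j : Fin 7) :
      ∑ k, isotropy c (Pi.single i 1) k * α ![Pi.single k 1, Pi.single j 1] +
        ∑ k, isotropy c (Pi.single j 1) k * α ![Pi.single i 1, Pi.single k 1] = 0 := by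
    have := hα c (Pi.single i 1) (Pi.single j 1)
    rw [hexp (isotropy c _), hexp _ (isotropy c _)] at this
    simpa [Pi.single_apply] using this
  generalize hm : (fun i j : Fin 7 => α ![Pi.single i 1, Pi.single j 1]) = m
  have hentry (i j : Fin 7) : α ![Pi.single i 1, Pi.single j 1] = m i j := by rw [← hm]
  simp only [hentry] at hself hswap hexp hmat
  simp only [Fin.sum_univ_seven] at hmat
  have h₁ (i j : Fin 7) := hmat ![1, 0, 0, 0] i j
  have h₂ (i j : Fin 7) := hmat ![0, 1, 0, 0] i j
  have h₃ (i j : Fin 7) := hmat ![0, 0, 0, 1] i j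
  simp [isotropy] at h₁ h₂ h₃
  have h04 : m 0 4 = 0 := by simpa using h₁ 1 4
  have h05 : m 0 5 = 0 := by simpa using h₁ 1 5
  have h06 : m 0 6 = 0 := by simpa using h₁ 1 6
  have h14 : m 1 4 = 0 := by simpa using h₁ 0 4
  have h15 : m 1 5 = 0 := by simpa using h₁ 0 5
  have h16 : m 1 6 = 0 := by simpa using h₁ 0 6
  have h24 : m 2 4 = 0 := by simpa using h₁ 3 4
  have h25 : m 2 5 = 0 := by simpa using h₁ 3 5
  have h26 : m 2 6 = 0 := by simpa using h₁ 3 6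
  have h34 : m 3 4 = 0 := by simpa using h₁ 2 4
  have h35 : m 3 5 = 0 := by simpa using h₁ 2 5
  have h36 : m 3 6 = 0 := by simpa using h₁ 2 6
  have h46 : m 4 6 = 0 := by simpa using h₃ 5 6
  have h56 : m 5 6 = 0 := by simpa using h₃ 4 6
  have h₁02 := h₁ 0 2
  have h₁03 := h₁ 0 3
  have h₃02 := h₃ 0 2
  have h₃03 := h₃ 0 3
  have h₂03 := h₂ 0 3
  simp at h₁02 h₁03 h₃02 h₃03 h₂03
  have h02 : m 0 2 = 0 := by linarith
  have h03 : m 0 3 = 0 := by linarith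
  have h12 : m 1 2 = 0 := by linarith
  have h13 : m 1 3 = 0 := by linarith
  have h23 : m 2 3 = m 0 1 := by linarith
  refine ⟨m 0 1, m 4 5, fun x y => ?_⟩
  rw [hexp]
  simp only [Fin.sum_univ_seven, hself, hswap 1 0, hswap 2 0, hswap 3 0, hswap 4 0, hswap 5 0,
    hswap 6 0, hswap 2 1, hswap 3 1, hswap 4 1, hswap 5 1, hswap 6 1, hswap 3 2, hswap 4 2,
    hswap 5 2, hswap 6 2, hswap 4 3, hswap 5 3, hswap 6 3, hswap 5 4, hswap 6 4, hswap 6 5,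
    h02, h03, h04, h05, h06, h12, h13, h14, h15, h16, h23, h24, h25, h26, h34, h35, h36,
    h46, h56]
  ring

/-- every `ad(𝔥)`-invariant alternating 2-form `α` on `𝔪` satisfies
`Dα = 0`; i.e. every invariant 2-form on `M^{1,1,0} = SU(3)×SU(2)/(SU(2)×U(1))` is
closed.  The projected bracket is characterized by
`⁅Φ(x), Φ(y)⁆ = Φ(pb x y) + Σⱼ cc(x,y)ⱼ·Wⱼ`, and invariance is stated for all
`w = Σⱼ cⱼ·Wⱼ ∈ 𝔥`, with `π(⁅w, Φ(x)⁆)` characterized analogously. -/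
theorem invariant_two_forms_closed_M110
    (α : AlternatingMap ℝ V ℝ (Fin 2))
    (pb : V → V → V) (cc : V → V → Fin 4 → ℝ)
    (hbr : ∀ x y : V, brG (Φ x) (Φ y) = Φ (pb x y) + ∑ j, cc x y j • W j)
    (hinv : ∀ (c : Fin 4 → ℝ) (aw : V → V) (cw : V → Fin 4 → ℝ),
      (∀ x : V, brG (∑ j, c j • W j) (Φ x) = Φ (aw x) + ∑ j, cw x j • W j) →
      ∀ x y : V, α ![aw x, y] + α ![x, aw y] = 0) :
    D2 pb ⇑α = 0 := by
  have hα (c : Fin 4 → ℝ) := hinv c (isotropy c) (fun _ => 0) (brG_sum_W_Φ c)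
  obtain ⟨a, b, h⟩ := invariant_two_form_eq α hα
  funext x
  simp only [D2, h, fun x y => projected_bracket_eq (hbr x y)]
  simp
  ring

end Stmt17
end
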